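/- Let ρ be a quasi-periodic labelling and let G_ρ be the associated group. Then every action of G_ρ on the circle has a global fixed point: for every group homomorphism Φ from G_ρ to the group of homeomorphisms of the circle ℝ/ℤ, there exists a point x of the circle with Φ(g)(x) = x for all g ∈ G_ρ. -/

import Mathlib

/-! ### Letters, labellings and quasi-periodicity -/

/-- The four letters `a, b, a⁻¹, b⁻¹`. -/
inductive Letter : Type
  | a : Letter
  | b : Letter
  | A : Letter  -- `a⁻¹`
  | B : Letter  -- `b⁻¹`
  deriving DecidableEq

/-- The formal inverse of a letter. -/
def Letter.inv : Letter → Letter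
  | .a => .A
  | .A => .a
  | .b => .B
  | .B => .b

/-- We encode the set of half-integers `½ℤ` by `ℤ` via `m ↦ m / 2`; integer points
correspond to even indices and proper half-integer points to odd indices.
A labelling assigns `a^{±1}` to integer points and `b^{±1}` to half-integer points. -/
def IsLabelling (ρ : ℤ → Letter) : Prop :=
  ∀ m : ℤ, (Even m → ρ m = Letter.a ∨ ρ m = Letter.A) ∧
    (Odd m → ρ m = Letter.b ∨ ρ m = Letter.B)

/-- The word of the labelling `ρ` along the block `{k, k+1, …, k+n}` (in the
half-integer encoding, the block of size `n+1` starting at `k/2`). -/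
def blockWord (ρ : ℤ → Letter) (k : ℤ) (n : ℕ) : List Letter :=
  (List.range (n + 1)).map fun i => ρ (k + i)

/-- The formal inverse of a word: reverse the word and invert each letter. -/
def wordInv (w : List Letter) : List Letter :=
  (w.map Letter.inv).reverse

/-- A labelling is quasi-periodic if (1) every subword of the labelling appears as a
subword (string of consecutive letters) of every sufficiently large block, and (2) the
formal inverse of every subword of the labelling is again a subword of the labelling. -/
def IsQuasiPeriodic (ρ : ℤ → Letter) : Prop :=
  IsLabelling ρ ∧
    (∀ (k : ℤ) (n : ℕ), ∃ N : ℕ, ∀ (k' : ℤ) (n' : ℕ), N ≤ n' + 1 →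
      (blockWord ρ k n) <:+: (blockWord ρ k' n')) ∧
    (∀ (k : ℤ) (n : ℕ), ∃ k' : ℤ, blockWord ρ k' n = wordInv (blockWord ρ k n))

/-! ### Thompson's group `F` and the subgroup `H`

Orientation-preserving homeomorphisms of `[0,1]` are realised as order-automorphisms
of `ℝ` that are the identity outside `[0,1]`; orientation-preserving homeomorphisms of
the line are order-automorphisms of `ℝ`. -/

/-- A dyadic rational real number, i.e. an element of `ℤ[1/2]`. -/
def IsDyadic (x : ℝ) : Prop :=
  ∃ (a : ℤ) (b : ℕ), x = (a : ℝ) / 2 ^ b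

/-- Membership in Thompson's group `F`: the identity outside `[0,1]`, and on `[0,1]`
piecewise linear with breakpoints in `ℤ[1/2]` and slopes integer powers of `2`. -/
def InThompsonF (f : ℝ ≃o ℝ) : Prop :=
  (∀ x : ℝ, x ∉ Set.Icc (0 : ℝ) 1 → f x = x) ∧
    ∃ (m : ℕ) (x : Fin (m + 1) → ℝ), x 0 = 0 ∧ x (Fin.last m) = 1 ∧ StrictMono x ∧
      (∀ i, IsDyadic (x i)) ∧
      ∀ i : Fin m, ∃ (k : ℤ) (c : ℝ),
        ∀ t ∈ Set.Icc (x i.castSucc) (x i.succ), f t = 2 ^ k * t + c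

/-- Membership in the subgroup `H ≤ F` of elements whose slopes at `0` and `1`
coincide. -/
def InH (f : ℝ ≃o ℝ) : Prop :=
  InThompsonF f ∧
    ∃ (k : ℤ) (ε : ℝ), 0 < ε ∧ (∀ t ∈ Set.Icc (0 : ℝ) ε, f t = 2 ^ k * t) ∧
      ∀ t ∈ Set.Icc (1 - ε) (1 : ℝ), f t = 1 + 2 ^ k * (t - 1)

/-! ### The generators of `G_ρ` -/

/-- `ζ` is the homeomorphism of `ℝ` which on each `[n, n+1]` is the conjugate of `ν`
(a homeomorphism of `[0,1]`) by the orientation-preserving isometry `[n,n+1] → [0,1]`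
if `ρ(n + ½) = b`, and by the orientation-reversing isometry if `ρ(n + ½) = b⁻¹`.
(In the encoding of `½ℤ` by `ℤ`, the point `n + ½` has index `2n + 1`.) -/
def IsZeta (ρ : ℤ → Letter) (ν ζ : ℝ ≃o ℝ) : Prop :=
  ∀ n : ℤ, ∀ x ∈ Set.Icc (n : ℝ) (n + 1),
    (ρ (2 * n + 1) = Letter.b → ζ x = n + ν (x - n)) ∧
    (ρ (2 * n + 1) = Letter.B → ζ x = (n + 1) - ν ((n + 1) - x))

/-- `χ` is the homeomorphism of `ℝ` which on each `[n-½, n+½]` is the conjugate of `ν`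
by the orientation-preserving isometry `[n-½, n+½] → [0,1]` if `ρ(n) = a`, and by the
orientation-reversing isometry if `ρ(n) = a⁻¹`. -/
def IsChi (ρ : ℤ → Letter) (ν χ : ℝ ≃o ℝ) : Prop :=
  ∀ n : ℤ, ∀ x ∈ Set.Icc ((n : ℝ) - 1/2) ((n : ℝ) + 1/2),
    (ρ (2 * n) = Letter.a → χ x = ((n : ℝ) - 1/2) + ν (x - ((n : ℝ) - 1/2))) ∧
    (ρ (2 * n) = Letter.A → χ x = ((n : ℝ) + 1/2) - ν (((n : ℝ) + 1/2) - x))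

/-! ### Bounded cohomology in degree two -/

/-- A bounded 2-cocycle on `G` with trivial real coefficients. -/
def IsBounded2Cocycle {G : Type*} [Group G] (ω : G → G → ℝ) : Prop :=
  (∃ C : ℝ, ∀ g h : G, |ω g h| ≤ C) ∧
    ∀ g₁ g₂ g₃ : G, ω g₂ g₃ - ω (g₁ * g₂) g₃ + ω g₁ (g₂ * g₃) - ω g₁ g₂ = 0

/-- `ω` is the coboundary of a bounded real-valued function. -/
def IsCoboundaryOfBounded {G : Type*} [Group G] (ω : G → G → ℝ) : Prop :=
  ∃ φ : G → ℝ, (∃ C : ℝ, ∀ g : G, |φ g| ≤ C) ∧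
    ∀ g h : G, ω g h = φ h - φ (g * h) + φ g

/-- A group is 2-boundedly acyclic if `H²_b(G; ℝ) = 0`, i.e. every bounded 2-cocycle is
the coboundary of a bounded function. -/
def Is2BoundedlyAcyclic (G : Type*) [Group G] : Prop :=
  ∀ ω : G → G → ℝ, IsBounded2Cocycle ω → IsCoboundaryOfBounded ω

/-- A 2-cocycle is homogeneous if it vanishes on powers of a single element. -/
def IsHomogeneous {G : Type*} [Group G] (ω : G → G → ℝ) : Prop :=
  ∀ (g : G) (i j : ℤ), ω (g ^ i) (g ^ j) = 0

/-- The group of homeomorphisms of a topological space, with composition as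
multiplication. -/
instance {X : Type*} [TopologicalSpace X] : Group (X ≃ₜ X) where
  mul f g := g.trans f
  one := Homeomorph.refl X
  inv := Homeomorph.symm
  mul_assoc _ _ _ := rfl
  one_mul _ := rfl
  mul_one _ := rfl
  inv_mul_cancel f := Homeomorph.ext fun x => f.symm_apply_apply x

/-- The circle `ℝ/ℤ`. -/
abbrev Circle' : Type := AddCircle (1 : ℝ)

set_option linter.unusedVariables false
namespace GR

/-- homeomorphisms mapping small dyadic cells affinely onto dyadic cells -/
def InD (f : ℝ ≃o ℝ) : Prop :=
  ∃ K N0 : ℕ, ∀ N : ℕ, N0 ≤ N → ∀ j : ℤ, ∃ (n : ℕ) (c : ℤ), N ≤ n + K ∧ n ≤ N + K ∧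
    ∀ s ∈ Set.Icc (0:ℝ) 1, f ((j + s) / 2 ^ N) = (c + s) / 2 ^ n

theorem InD.one : InD 1 :=
  ⟨0, 0, fun N _ j => ⟨N, j, by omega, by omega, fun s _ => rfl⟩⟩

theorem InD.mul {f g : ℝ ≃o ℝ} (hf : InD f) (hg : InD g) : InD (f * g) := by
  obtain ⟨K, N0, hf⟩ := hf
  obtain ⟨K', N0', hg⟩ := hg
  refine ⟨K + K', max N0' (N0 + K'), fun N hN j => ?_⟩
  obtain ⟨n, c, h1, h2, h3⟩ := hg N (by omega) j
  obtain ⟨n', c', h1', h2', h3'⟩ := hf n (by omega) c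
  refine ⟨n', c', by omega, by omega, fun s hs => ?_⟩
  rw [RelIso.mul_apply, h3 s hs, h3' s hs]

theorem InD.inv {f : ℝ ≃o ℝ} (hf : InD f) : InD f⁻¹ := by
  obtain ⟨K, N0, hf⟩ := hf
  refine ⟨K, N0 + K, fun N hN j => ?_⟩
  obtain ⟨N1, hN1⟩ : ∃ N1, N = N1 + K := ⟨N - K, by omega⟩
  set y : ℝ := (j + 1/2) / 2 ^ N with hy
  set x := f⁻¹ y with hx
  obtain ⟨n, c, h1, h2, h3⟩ := hf N1 (by omega) ⌊x * 2 ^ N1⌋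
  set i := ⌊x * 2 ^ N1⌋ with hi
  set s0 := x * 2 ^ N1 - i with hs0
  have hs0' : 0 ≤ s0 ∧ s0 < 1 := ⟨by have := Int.floor_le (x * 2 ^ N1); linarith,
    by have := Int.lt_floor_add_one (x * 2 ^ N1); linarith⟩
  have e1 : f x = (c + s0) / 2 ^ n := by
    rw [← h3 s0 ⟨hs0'.1, hs0'.2.le⟩]
    congr 1
    rw [hs0]; field_simp; ring
  have e2 : f x = y := by rw [hx]; exact RelIso.apply_inv_self _ _
  obtain ⟨m, hm⟩ : ∃ m, N = n + m := ⟨N - n, by omega⟩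
  have e3 : ((c:ℝ) + s0) * 2 ^ m = j + 1/2 := by
    have : ((c:ℝ) + s0) / 2 ^ n = (j + 1/2) / 2 ^ N := by rw [← e1, e2]
    rw [hm, pow_add] at this
    field_simp at this
    linarith
  have hp : (0:ℝ) < 2 ^ m := by positivity
  have c1 : c * 2 ^ m ≤ j := by
    have : ((c * 2 ^ m : ℤ) : ℝ) < j + 1 := by push_cast; nlinarith
    have := (by exact_mod_cast this : c * 2 ^ m < j + 1)
    omega
  have c2 : j + 1 ≤ (c + 1) * 2 ^ m := by
    have : (j : ℝ) < (((c + 1) * 2 ^ m : ℤ) : ℝ) := by push_cast; nlinarith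
    have := (by exact_mod_cast this : j < (c + 1) * 2 ^ m)
    omega
  have c1' : (c:ℝ) * 2 ^ m ≤ j := by exact_mod_cast c1
  have c2' : (j:ℝ) + 1 ≤ (c + 1) * 2 ^ m := by exact_mod_cast c2
  refine ⟨N1 + m, (i - c) * 2 ^ m + j, by omega, by omega, fun s hs => ?_⟩
  have k1 := h3 ((j + s) / 2 ^ m - c) ⟨by
      rw [sub_nonneg, le_div_iff₀ hp]; linarith [hs.1], by
      rw [sub_le_iff_le_add, div_le_iff₀ hp]; linarith [hs.2]⟩
  have k2 : ((j:ℝ) + s) / 2 ^ N = (c + ((j + s) / 2 ^ m - c)) / 2 ^ n := by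
    rw [hm, pow_add]; field_simp; ring
  rw [k2, ← k1, RelIso.inv_apply_self, pow_add]
  push_cast
  field_simp
  ring

def DGrp : Subgroup (ℝ ≃o ℝ) where
  carrier := {f | InD f}
  mul_mem' := fun h h' => InD.mul h h'
  one_mem' := InD.one
  inv_mem' := fun h => InD.inv h

theorem inv_fix {f : ℝ ≃o ℝ} {t : ℝ} (h : f t = t) : f⁻¹ t = t := by
  conv_lhs => rw [← h]
  exact RelIso.inv_apply_self _ _

/-- dyadic PL homeomorphisms with compact support in `(u,v)` -/
def Fc (u v : ℝ) : Subgroup (ℝ ≃o ℝ) where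
  carrier := {f | InD f ∧ ∃ u' v', u < u' ∧ v' < v ∧ (∀ t ≤ u', f t = t) ∧ ∀ t ≥ v', f t = t}
  mul_mem' := by
    rintro f g ⟨hf, a, b, h1, h2, h3, h4⟩ ⟨hg, a', b', h1', h2', h3', h4'⟩
    refine ⟨hf.mul hg, min a a', max b b', lt_min h1 h1', max_lt h2 h2', fun t ht => ?_, fun t ht => ?_⟩
    · rw [RelIso.mul_apply, h3' t (ht.trans (min_le_right _ _)), h3 t (ht.trans (min_le_left _ _))]
    · rw [RelIso.mul_apply, h4' t ((le_max_right _ _).trans ht), h4 t ((le_max_left _ _).trans ht)]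
  one_mem' := ⟨InD.one, u + 1, v - 1, by linarith, by linarith, fun _ _ => rfl, fun _ _ => rfl⟩
  inv_mem' := by
    rintro f ⟨hf, a, b, h1, h2, h3, h4⟩
    exact ⟨hf.inv, a, b, h1, h2, fun t ht => inv_fix (h3 t ht), fun t ht => inv_fix (h4 t ht)⟩

theorem Fc_mono {u v u' v' : ℝ} (h : u' ≤ u) (h' : v ≤ v') : Fc u v ≤ Fc u' v' := by
  rintro f ⟨hf, a, b, h1, h2, h3, h4⟩
  exact ⟨hf, a, b, by linarith, by linarith, h3, h4⟩

theorem Fc_fix {u v : ℝ} {f : ℝ ≃o ℝ} (hf : f ∈ Fc u v) {t : ℝ} (ht : t ∉ Set.Ioo u v) : f t = t := by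
  obtain ⟨hf, a, b, h1, h2, h3, h4⟩ := hf
  by_cases h : t ≤ u
  · exact h3 t (by linarith)
  · exact h4 t (by simp only [Set.mem_Ioo, not_and, not_lt] at ht; have := ht (by linarith); linarith)

theorem maps_Ioo {f : ℝ ≃o ℝ} {u v : ℝ} (hu : f u = u) (hv : f v = v) {t : ℝ} :
    f t ∈ Set.Ioo u v ↔ t ∈ Set.Ioo u v := by
  have h1 := f.lt_iff_lt (x := u) (y := t)
  have h2 := f.lt_iff_lt (x := t) (y := v)
  rw [hu] at h1; rw [hv] at h2
  simp only [Set.mem_Ioo, h1, h2]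

theorem maps_Icc {f : ℝ ≃o ℝ} {u v : ℝ} (hu : f u = u) (hv : f v = v) {t : ℝ} :
    f t ∈ Set.Icc u v ↔ t ∈ Set.Icc u v := by
  have h1 := f.le_iff_le (x := u) (y := t)
  have h2 := f.le_iff_le (x := t) (y := v)
  rw [hu] at h1; rw [hv] at h2
  simp only [Set.mem_Icc, h1, h2]

theorem Fc_left {u v : ℝ} {f : ℝ ≃o ℝ} (hf : f ∈ Fc u v) : f u = u := Fc_fix hf (by simp)
theorem Fc_right {u v : ℝ} {f : ℝ ≃o ℝ} (hf : f ∈ Fc u v) : f v = v := Fc_fix hf (by simp)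

/-- translation -/
def trl (c : ℝ) : ℝ ≃o ℝ := OrderIso.addRight c
@[simp] theorem trl_apply (c t : ℝ) : trl c t = t + c := rfl
@[simp] theorem trl_inv_apply (c t : ℝ) : (trl c)⁻¹ t = t - c := by
  apply (trl c).injective; rw [RelIso.apply_inv_self]; simp

/-- scaling by `2^{-n}` -/
noncomputable def scl (n : ℕ) : ℝ ≃o ℝ := OrderIso.mulLeft₀ ((2:ℝ) ^ n)⁻¹ (by positivity)
@[simp] theorem scl_apply (n : ℕ) (t : ℝ) : scl n t = t / 2 ^ n := by
  show ((2:ℝ) ^ n)⁻¹ * t = _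
  rw [div_eq_inv_mul]
@[simp] theorem scl_inv_apply (n : ℕ) (t : ℝ) : (scl n)⁻¹ t = t * 2 ^ n := by
  apply (scl n).injective; rw [RelIso.apply_inv_self, scl_apply]; field_simp

theorem trl_mem (j : ℤ) (m : ℕ) : InD (trl (j / 2 ^ m)) := by
  refine ⟨0, m, fun N hN i => ⟨N, i + j * 2 ^ (N - m), by omega, by omega, fun s _ => ?_⟩⟩
  obtain ⟨k, rfl⟩ := Nat.exists_eq_add_of_le hN
  rw [trl_apply, Nat.add_sub_cancel_left, pow_add]; push_cast; field_simp; ring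

theorem scl_mem (n : ℕ) : InD (scl n) := by
  refine ⟨n, 0, fun N hN i => ⟨N + n, i, by omega, by omega, fun s _ => ?_⟩⟩
  rw [scl_apply, pow_add]; field_simp

theorem theta_li (t : ℝ) : (fun t => min t (max (t / 2) (max (t - 1/4) (2 * t - 1))))
    (max t (min (2 * t) (min (t + 1/4) ((t + 1) / 2)))) = t := by
  simp only [min_def, max_def]; split_ifs <;> linarith

/-- the basic bump on `[0,1]` -/
noncomputable def theta : ℝ ≃o ℝ where
  toFun t := max t (min (2 * t) (min (t + 1/4) ((t + 1) / 2)))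
  invFun t := min t (max (t / 2) (max (t - 1/4) (2 * t - 1)))
  left_inv t := theta_li t
  right_inv t := by
    simp only [min_def, max_def]; split_ifs <;> linarith
  map_rel_iff' := by
    intro a b
    have m1 : Monotone fun t : ℝ => max t (min (2 * t) (min (t + 1/4) ((t + 1) / 2))) := by
      intro x y h; dsimp only; gcongr
    have m2 : Monotone fun t : ℝ => min t (max (t / 2) (max (t - 1/4) (2 * t - 1))) := by
      intro x y h; dsimp only; gcongr
    constructor
    · intro h
      have h2 := m2 h
      exact ((theta_li a).symm.le.trans h2).trans (theta_li b).le
    · intro h; exact m1 h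

theorem theta_apply (t : ℝ) : theta t = max t (min (2 * t) (min (t + 1/4) ((t + 1) / 2))) := rfl

theorem theta_le {t : ℝ} (h : t ≤ 0) : theta t = t := by
  rw [theta_apply]; simp only [min_def, max_def]; split_ifs <;> linarith
theorem theta_ge {t : ℝ} (h : 1 ≤ t) : theta t = t := by
  rw [theta_apply]; simp only [min_def, max_def]; split_ifs <;> linarith
theorem theta_1 {t : ℝ} (h : 0 ≤ t) (h' : t ≤ 1/4) : theta t = 2 * t := by
  rw [theta_apply]; simp only [min_def, max_def]; split_ifs <;> linarith
theorem theta_2 {t : ℝ} (h : 1/4 ≤ t) (h' : t ≤ 1/2) : theta t = t + 1/4 := by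
  rw [theta_apply]; simp only [min_def, max_def]; split_ifs <;> linarith
theorem theta_3 {t : ℝ} (h : 1/2 ≤ t) (h' : t ≤ 1) : theta t = (t + 1)/2 := by
  rw [theta_apply]; simp only [min_def, max_def]; split_ifs <;> linarith
theorem theta_gt {t : ℝ} (h : 0 < t) (h' : t < 1) : t < theta t := by
  rw [theta_apply]; simp only [min_def, max_def]; split_ifs <;> linarith

theorem theta_mem : InD theta := by
  refine ⟨1, 2, fun N hN j => ?_⟩
  obtain ⟨k, rfl⟩ := Nat.exists_eq_add_of_le hN
  have hp : (0:ℝ) < 2 ^ k := by positivity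
  have key : ∀ s ∈ Set.Icc (0:ℝ) 1, ∀ A : ℤ, 
      (j < A → ((j:ℝ) + s) / 2 ^ (2 + k) ≤ (A:ℝ) / 2 ^ (2 + k)) ∧ 
      (¬ j < A → (A:ℝ) / 2 ^ (2 + k) ≤ ((j:ℝ) + s) / 2 ^ (2 + k)) := by
    intro s hs A
    constructor
    · intro h
      have : (j:ℝ) + 1 ≤ A := by exact_mod_cast h
      gcongr; linarith [hs.2]
    · intro h
      have : (A:ℝ) ≤ j := by exact_mod_cast not_lt.mp h
      gcongr; linarith [hs.1]
  have p0 : (((0:ℤ):ℝ)) / 2 ^ (2 + k) = 0 := by simp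
  have p1 : (((2 ^ k:ℤ):ℝ)) / 2 ^ (2 + k) = 1/4 := by rw [pow_add]; push_cast; field_simp; norm_num
  have p2 : (((2 * 2 ^ k:ℤ):ℝ)) / 2 ^ (2 + k) = 1/2 := by rw [pow_add]; push_cast; field_simp
  have p3 : (((4 * 2 ^ k:ℤ):ℝ)) / 2 ^ (2 + k) = 1 := by rw [pow_add]; push_cast; field_simp; norm_num
  by_cases h0 : j < 0
  · refine ⟨2 + k, j, by omega, by omega, fun s hs => theta_le ?_⟩
    have := (key s hs 0).1 h0; rwa [p0] at this
  by_cases h1 : j < 2 ^ k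
  · refine ⟨1 + k, j, by omega, by omega, fun s hs => ?_⟩
    have a := (key s hs _).2 h0; rw [p0] at a
    have b := (key s hs _).1 h1; rw [p1] at b
    rw [theta_1 a b, pow_add, pow_add]; field_simp
  by_cases h2 : j < 2 * 2 ^ k
  · refine ⟨2 + k, j + 2 ^ k, by omega, by omega, fun s hs => ?_⟩
    have a := (key s hs _).2 h1; rw [p1] at a
    have b := (key s hs _).1 h2; rw [p2] at b
    rw [theta_2 a b, pow_add]; push_cast; field_simp; ring
  by_cases h3 : j < 4 * 2 ^ k
  · refine ⟨3 + k, j + 4 * 2 ^ k, by omega, by omega, fun s hs => ?_⟩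
    have a := (key s hs _).2 h2; rw [p2] at a
    have b := (key s hs _).1 h3; rw [p3] at b
    rw [theta_3 a b, pow_add, pow_add]; push_cast; field_simp; ring
  · refine ⟨2 + k, j, by omega, by omega, fun s hs => theta_ge ?_⟩
    have := (key s hs _).2 h3; rwa [p3] at this

/-- locally moving subgroup on `(u,v)` -/
def LM (N : Subgroup (ℝ ≃o ℝ)) (u v : ℝ) : Prop :=
  ∀ y ∈ Set.Ioo u v, ∀ ε > 0, ∃ g ∈ N, y < g y ∧ ∀ t, ε ≤ |t - y| → g t = t

theorem bump (y ε : ℝ) (hε : 0 < ε) : ∃ g, InD g ∧ y < g y ∧ ∀ t, ε ≤ |t - y| → g t = t := by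
  obtain ⟨n, hn⟩ := exists_pow_lt_of_lt_one hε (by norm_num : (1/2:ℝ) < 1)
  obtain ⟨j, j1, j2⟩ : ∃ j : ℤ, (j:ℝ) ≤ y * 2 ^ (n + 1) ∧ y * 2 ^ (n + 1) < j + 1 :=
    ⟨⌊y * 2 ^ (n + 1)⌋, Int.floor_le _, Int.lt_floor_add_one _⟩
  set B := trl (((j - 1 : ℤ) : ℝ) / 2 ^ (n + 1)) * scl n with hB
  have hBD : InD B := (trl_mem _ _).mul (scl_mem _)
  have hp : (0:ℝ) < 2 ^ n := by positivity
  have hn' : 1 < ε * 2 ^ n := by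
    rw [div_pow, one_pow, div_lt_iff₀ hp] at hn; exact hn
  have hBa : ∀ t, B t = (t + (j - 1) / 2) / 2 ^ n := by
    intro t; rw [hB, RelIso.mul_apply, scl_apply, trl_apply, pow_succ]; push_cast; field_simp
  have hBi : ∀ t, B⁻¹ t = t * 2 ^ n - (j - 1) / 2 := by
    intro t; apply B.injective; rw [RelIso.apply_inv_self, hBa]; field_simp; ring
  rw [pow_succ] at j1 j2
  refine ⟨B * theta * B⁻¹, (hBD.mul theta_mem).mul hBD.inv, ?_, ?_⟩
  · have h1 : B⁻¹ y < theta (B⁻¹ y) := by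
      rw [hBi]; apply theta_gt <;> linarith
    have := B.lt_iff_lt.mpr h1
    rwa [RelIso.apply_inv_self] at this
  · intro t ht
    have : theta (B⁻¹ t) = B⁻¹ t := by
      rw [hBi]
      rcases le_abs.mp ht with h | h
      · apply theta_ge; nlinarith
      · apply theta_le; nlinarith
    rw [RelIso.mul_apply, RelIso.mul_apply, this, RelIso.apply_inv_self]

theorem bump_Fc {u v y : ℝ} (hy : y ∈ Set.Ioo u v) (ε : ℝ) (hε : 0 < ε) :
    ∃ g ∈ Fc u v, y < g y ∧ ∀ t, ε ≤ |t - y| → g t = t := by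
  obtain ⟨g, h1, h2, h3⟩ := bump y (min ε (min ((y - u)/2) ((v - y)/2)))
    (lt_min hε (lt_min (by linarith [hy.1]) (by linarith [hy.2])))
  refine ⟨g, ⟨h1, (u + y)/2, (y + v)/2, by linarith [hy.1], by linarith [hy.2], fun t ht => ?_, fun t ht => ?_⟩, h2, fun t ht => h3 t ((min_le_left _ _).trans ht)⟩
  · apply h3; rw [abs_of_neg (by linarith [hy.1])]
    exact (min_le_right _ _).trans ((min_le_left _ _).trans (by linarith))
  · apply h3; rw [abs_of_pos (by linarith [hy.2])]
    exact (min_le_right _ _).trans ((min_le_right _ _).trans (by linarith))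

theorem LM_Fc (u v : ℝ) : LM (Fc u v) u v := fun y hy ε hε => bump_Fc hy ε hε

theorem push_up {N : Subgroup (ℝ ≃o ℝ)} {u v : ℝ} (h : LM N u v) {a b : ℝ} (ha : u ≤ a) (hb : b ≤ v)
    {y c : ℝ} (hy : y ∈ Set.Ioo a b) (hc : c < b) :
    ∃ g ∈ N, c < g y ∧ ∀ t, t ∉ Set.Ioo a b → g t = t := by
  by_contra hcon
  push Not at hcon
  set S := {z | ∃ g ∈ N, g y = z ∧ ∀ t, t ∉ Set.Ioo a b → g t = t} with hS
  have hyS : y ∈ S := ⟨1, N.one_mem, rfl, fun _ _ => rfl⟩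
  have hSb : ∀ z ∈ S, z ≤ c := by
    rintro z ⟨g, hg, rfl, hfix⟩
    by_contra hlt
    obtain ⟨t, h1, h2⟩ := hcon g hg (not_le.mp hlt)
    exact h2 (hfix t h1)
  have hbdd : BddAbove S := ⟨c, hSb⟩
  have i1 : y ≤ sSup S := le_csSup hbdd hyS
  have i2 : sSup S ≤ c := csSup_le ⟨y, hyS⟩ hSb
  set i := sSup S
  have hia : a < i := lt_of_lt_of_le hy.1 i1
  have hib : i < b := lt_of_le_of_lt i2 hc
  obtain ⟨g, hg, hgi, hfix⟩ := h i ⟨by linarith, by linarith⟩ (min (i - a) (b - i)) (lt_min (by linarith) (by linarith))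
  have : g⁻¹ i < i := by
    have := g⁻¹.lt_iff_lt.mpr hgi
    rwa [RelIso.inv_apply_self] at this
  obtain ⟨z, ⟨g', hg', hz, hfix'⟩, hz2⟩ := exists_lt_of_lt_csSup ⟨y, hyS⟩ this
  have : g z ∈ S := by
    refine ⟨g * g', N.mul_mem hg hg', by rw [RelIso.mul_apply, hz], fun t ht => ?_⟩
    rw [RelIso.mul_apply, hfix' t ht]
    apply hfix
    simp only [Set.mem_Ioo, not_and, not_lt] at ht
    by_cases hta : a < t
    · rw [abs_of_nonneg (by linarith [ht hta])]
      exact (min_le_right _ _).trans (by linarith [ht hta])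
    · rw [abs_of_nonpos (by linarith)]
      exact (min_le_left _ _).trans (by linarith)
  have h1 := le_csSup hbdd this
  have h2 := g.lt_iff_lt.mpr hz2
  rw [RelIso.apply_inv_self] at h2
  linarith

theorem push_down {N : Subgroup (ℝ ≃o ℝ)} {u v : ℝ} (h : LM N u v) {a b : ℝ} (ha : u ≤ a) (hb : b ≤ v)
    {y c : ℝ} (hy : y ∈ Set.Ioo a b) (hc : a < c) :
    ∃ g ∈ N, g y < c ∧ ∀ t, t ∉ Set.Ioo a b → g t = t := by
  by_cases hcb : c < b
  · obtain ⟨g, hg, h1, h2⟩ := push_up h ha hb ⟨hc, hcb⟩ hy.2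
    refine ⟨g⁻¹, N.inv_mem hg, ?_, fun t ht => inv_fix (h2 t ht)⟩
    have := g⁻¹.lt_iff_lt.mpr h1
    rwa [RelIso.inv_apply_self] at this
  · exact ⟨1, N.one_mem, lt_of_lt_of_le hy.2 (not_lt.mp hcb), fun _ _ => rfl⟩

theorem push2 {N : Subgroup (ℝ ≃o ℝ)} {u v : ℝ} (h : LM N u v) {a b c d : ℝ}
    (ha : u < a) (hab : a ≤ b) (hb : b < v) (hc : u ≤ c) (hcd : c < d) (hd : d ≤ v) :
    ∃ g ∈ N, c < g a ∧ g b < d ∧ g u = u ∧ g v = v := by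
  obtain ⟨g, hg, h1, h2⟩ := push_down h le_rfl le_rfl ⟨ha.trans_le hab, hb⟩ (lt_of_le_of_lt hc hcd)
  have hu := h2 u (by simp)
  have hv := h2 v (by simp)
  have hga : u < g a := by have := g.lt_iff_lt.mpr ha; rwa [hu] at this
  have hgab : g a ≤ g b := g.le_iff_le.mpr hab
  obtain ⟨k, hk, h3, h4⟩ := push_up h le_rfl hd ⟨hga, hgab.trans_lt h1⟩ hcd
  refine ⟨k * g, N.mul_mem hk hg, h3, ?_, ?_, ?_⟩
  · have := k.lt_iff_lt.mpr h1
    rw [h4 d (by simp)] at this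
    exact this
  · rw [RelIso.mul_apply, hu, h4 u (by simp)]
  · rw [RelIso.mul_apply, hv, h4 v (by simp [hd])]

/-- conjugating a compactly supported element into a smaller interval -/
theorem push_conj {N : Subgroup (ℝ ≃o ℝ)} {u v : ℝ} (h : LM N u v) (hN : N ≤ DGrp) {c d : ℝ}
    (hc : u ≤ c) (hcd : c < d) (hd : d ≤ v) {f : ℝ ≃o ℝ} (hf : f ∈ Fc u v) :
    ∃ g ∈ N, g * f * g⁻¹ ∈ Fc c d ∧ g u = u ∧ g v = v := by
  obtain ⟨hf, a, b, h1, h2, h3, h4⟩ := hf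
  obtain ⟨a', b', h1', h2', h3', h4', hab⟩ : ∃ a' b', u < a' ∧ b' < v ∧ (∀ t ≤ a', f t = t) ∧ (∀ t ≥ b', f t = t) ∧ a' ≤ b' := by
    have huv : u < v := by linarith
    refine ⟨min a ((u+v)/2), max b ((u+v)/2), lt_min h1 (by linarith), max_lt h2 (by linarith), fun t ht => h3 t (ht.trans (min_le_left _ _)), fun t ht => h4 t ((le_max_left _ _).trans ht), (min_le_right _ _).trans (le_max_right _ _)⟩
  obtain ⟨g, hg, g1, g2, g3, g4⟩ := push2 h h1' hab h2' hc hcd hd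
  refine ⟨g, hg, ⟨((hN hg : InD g).mul hf).mul (InD.inv (hN hg)), g a', g b', g1, g2, fun t ht => ?_, fun t ht => ?_⟩, g3, g4⟩
  · rw [RelIso.mul_apply, RelIso.mul_apply, h3', RelIso.apply_inv_self]
    have := g⁻¹.le_iff_le.mpr ht; rwa [RelIso.inv_apply_self] at this
  · rw [RelIso.mul_apply, RelIso.mul_apply, h4', RelIso.apply_inv_self]
    have := g⁻¹.le_iff_le.mpr ht; rwa [RelIso.inv_apply_self] at this

end GR

namespace GR

noncomputable def cl (c : ℤ × ℕ) (s : ℝ) : ℝ := ((c.1 : ℝ) + s) / 2 ^ c.2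
def lft (c : ℤ × ℕ) : ℤ × ℕ := (2 * c.1, c.2 + 1)
def rgt (c : ℤ × ℕ) : ℤ × ℕ := (2 * c.1 + 1, c.2 + 1)
theorem cl_lft (c : ℤ × ℕ) (s : ℝ) : cl (lft c) s = cl c (s / 2) := by
  simp only [cl, lft, pow_succ]; push_cast; field_simp
theorem cl_rgt (c : ℤ × ℕ) (s : ℝ) : cl (rgt c) s = cl c ((s + 1) / 2) := by
  simp only [cl, rgt, pow_succ]; push_cast; field_simp; ring
theorem cl_lt (c : ℤ × ℕ) {s t : ℝ} : cl c s < cl c t ↔ s < t := by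
  simp only [cl]; rw [div_lt_div_iff_of_pos_right (by positivity)]; simp
theorem cl_le (c : ℤ × ℕ) {s t : ℝ} : cl c s ≤ cl c t ↔ s ≤ t := by
  rw [← not_lt, cl_lt, not_lt]
theorem cl_inj (c : ℤ × ℕ) {s t : ℝ} : cl c s = cl c t ↔ s = t := by
  rw [le_antisymm_iff, cl_le, cl_le, ← le_antisymm_iff]

def mp (g : ℝ ≃o ℝ) (c c' : ℤ × ℕ) : Prop := ∀ s ∈ Set.Icc (0:ℝ) 1, g (cl c s) = cl c' s

theorem mp_lft {g c c'} (h : mp g c c') : mp g (lft c) (lft c') := by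
  intro s hs; rw [cl_lft, cl_lft]; exact h _ ⟨by linarith [hs.1], by linarith [hs.2]⟩
theorem mp_rgt {g c c'} (h : mp g c c') : mp g (rgt c) (rgt c') := by
  intro s hs; rw [cl_rgt, cl_rgt]; exact h _ ⟨by linarith [hs.1], by linarith [hs.2]⟩

def comb : ℤ × ℕ → ℕ → List (ℤ × ℕ)
  | c, 0 => [c]
  | c, n + 1 => lft c :: comb (rgt c) n

theorem mp_comb {g : ℝ ≃o ℝ} : ∀ (n : ℕ) {c c' : ℤ × ℕ}, mp g c c' → List.Forall₂ (mp g) (comb c n) (comb c' n)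
  | 0, _, _, h => by simpa [comb] using h
  | n + 1, _, _, h => List.Forall₂.cons (mp_lft h) (mp_comb n (mp_rgt h))

theorem mp_comp {g h : ℝ ≃o ℝ} {L L' L'' : List (ℤ × ℕ)} (h1 : List.Forall₂ (mp g) L L')
    (h2 : List.Forall₂ (mp h) L' L'') : List.Forall₂ (mp (h * g)) L L'' := by
  induction h1 generalizing L'' with
  | nil => cases h2; exact .nil
  | cons a b ih =>
    cases h2 with
    | cons a' b' => 
      refine .cons (fun s hs => ?_) (ih b')
      rw [RelIso.mul_apply, a s hs, a' s hs]

inductive Part : ℤ × ℕ → List (ℤ × ℕ) → Prop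
  | leaf (c) : Part c [c]
  | node {c L1 L2} : Part (lft c) L1 → Part (rgt c) L2 → Part c (L1 ++ L2)

theorem Part.len {c L} (h : Part c L) : ∃ n, L.length = n + 1 := by
  induction h with
  | leaf c => exact ⟨0, rfl⟩
  | node _ _ h1 h2 =>
    obtain ⟨a, ha⟩ := h1
    obtain ⟨b, hb⟩ := h2
    exact ⟨a + b + 1, by rw [List.length_append, ha, hb]; ring⟩

theorem Part.mp_id {g : ℝ ≃o ℝ} {c L} (h : Part c L) (hg : mp g c c) : List.Forall₂ (mp g) L L := by
  induction h with
  | leaf c => exact .cons hg .nil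
  | node _ _ h1 h2 => exact List.rel_append (h1 (mp_lft hg)) (h2 (mp_rgt hg))

def Out (g : ℝ ≃o ℝ) (c : ℤ × ℕ) : Prop := ∀ t, t ∉ Set.Ioo (cl c 0) (cl c 1) → g t = t

theorem Out.lft {g c} (h : Out g (lft c)) : Out g c := by
  intro t ht; apply h; intro h'
  rw [cl_lft, cl_lft] at h'
  exact ht ⟨lt_of_le_of_lt ((cl_le c).mpr (by norm_num)) h'.1, lt_of_lt_of_le h'.2 ((cl_le c).mpr (by norm_num))⟩
theorem Out.rgt {g c} (h : Out g (rgt c)) : Out g c := by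
  intro t ht; apply h; intro h'
  rw [cl_rgt, cl_rgt] at h'
  exact ht ⟨lt_of_le_of_lt ((cl_le c).mpr (by norm_num)) h'.1, lt_of_lt_of_le h'.2 ((cl_le c).mpr (by norm_num))⟩
theorem Out.mul {g h c} (h1 : Out g c) (h2 : Out h c) : Out (g * h) c := by
  intro t ht; rw [RelIso.mul_apply, h2 t ht, h1 t ht]
theorem Out.lft_r {g c} (h : Out g (GR.lft c)) : mp g (GR.rgt c) (GR.rgt c) := by
  intro s hs; apply h; intro h'
  rw [cl_rgt, cl_lft, cl_lft] at h'
  have := (cl_lt c).mp h'.2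
  linarith [hs.1]
theorem Out.rgt_l {g c} (h : Out g (GR.rgt c)) : mp g (GR.lft c) (GR.lft c) := by
  intro s hs; apply h; intro h'
  rw [cl_rgt, cl_rgt, cl_lft] at h'
  have := (cl_lt c).mp h'.1
  linarith [hs.2]

/-- affine chart of a cell -/
noncomputable def Bc (c : ℤ × ℕ) : ℝ ≃o ℝ := trl ((c.1 : ℝ) / 2 ^ c.2) * scl c.2
theorem Bc_apply (c : ℤ × ℕ) (s : ℝ) : Bc c s = cl c s := by
  rw [Bc, RelIso.mul_apply, scl_apply, trl_apply, cl]; ring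
theorem Bc_mem (c) : InD (Bc c) := (trl_mem _ _).mul (scl_mem _)

noncomputable def thetaC (c : ℤ × ℕ) : ℝ ≃o ℝ := Bc c * theta * (Bc c)⁻¹

theorem conj_apply (B g : ℝ ≃o ℝ) (t : ℝ) : (B * g * B⁻¹) (B t) = B (g t) := by
  rw [RelIso.mul_apply, RelIso.mul_apply, RelIso.inv_apply_self]

theorem thetaC_cl (c : ℤ × ℕ) (s : ℝ) : thetaC c (cl c s) = cl c (theta s) := by
  rw [← Bc_apply, thetaC, conj_apply, Bc_apply]

theorem thetaC_out (c) : Out (thetaC c) c := by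
  intro t ht
  obtain ⟨s, rfl⟩ := (Bc c).surjective t
  rw [Bc_apply] at *
  rw [thetaC_cl]
  simp only [Set.mem_Ioo, cl_lt, not_and, not_lt] at ht
  by_cases h : 0 < s
  · rw [theta_ge (ht h)]
  · rw [theta_le (by linarith)]

theorem thetaC_1 (c) : mp (thetaC c) (lft (lft c)) (lft c) := by
  intro s hs; rw [cl_lft, cl_lft, thetaC_cl, theta_1 (by linarith [hs.1]) (by linarith [hs.2]), cl_lft]; congr 1; ring
theorem thetaC_2 (c) : mp (thetaC c) (rgt (lft c)) (lft (rgt c)) := by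
  intro s hs; rw [cl_rgt, cl_lft, thetaC_cl, theta_2 (by linarith [hs.1]) (by linarith [hs.2]), cl_lft, cl_rgt]; congr 1; ring
theorem thetaC_3 (c) : mp (thetaC c) (rgt c) (rgt (rgt c)) := by
  intro s hs; rw [cl_rgt, thetaC_cl, theta_3 (by linarith [hs.1]) (by linarith [hs.2]), cl_rgt, cl_rgt]

def OKc (u v : ℝ) (c : ℤ × ℕ) : Prop := u < cl c (-1) ∧ cl c 2 < v
theorem OKc.lft {u v c} (h : OKc u v c) : OKc u v (lft c) := by
  refine ⟨h.1.trans_le ?_, lt_of_le_of_lt ?_ h.2⟩ <;> rw [cl_lft, cl_le] <;> norm_num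
theorem OKc.rgt {u v c} (h : OKc u v c) : OKc u v (rgt c) := by
  refine ⟨h.1.trans_le ?_, lt_of_le_of_lt ?_ h.2⟩ <;> rw [cl_rgt, cl_le] <;> norm_num


theorem cat_comb {u v : ℝ} {P : Subgroup (ℝ ≃o ℝ)} (hP : ∀ c, OKc u v c → thetaC c ∈ P)
    (n2 : ℕ) : ∀ (n1 : ℕ) (c), OKc u v c → ∃ g ∈ P, Out g c ∧
    List.Forall₂ (mp g) (comb (lft c) n1 ++ comb (rgt c) n2) (comb c (n1 + n2 + 1))
  | 0, c, hc => ⟨1, P.one_mem, fun _ _ => rfl, by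
      rw [Nat.zero_add]
      exact .cons (fun _ _ => rfl) (mp_comb _ fun _ _ => rfl)⟩
  | n1 + 1, c, hc => by
      obtain ⟨g, hg, h1, h2⟩ := cat_comb hP n2 n1 (rgt c) hc.rgt
      refine ⟨g * thetaC c, P.mul_mem hg (hP c hc), h1.rgt.mul (thetaC_out c), ?_⟩
      have : List.Forall₂ (mp (thetaC c)) (comb (lft c) (n1 + 1) ++ comb (rgt c) n2)
        (lft c :: (comb (lft (rgt c)) n1 ++ comb (rgt (rgt c)) n2)) :=
        .cons (thetaC_1 c) (List.rel_append (mp_comb _ (thetaC_2 c)) (mp_comb _ (thetaC_3 c)))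
      rw [show n1 + 1 + n2 + 1 = (n1 + n2 + 1) + 1 by ring]
      exact mp_comp this (.cons h1.rgt_l h2)

theorem part_comb {u v : ℝ} {P : Subgroup (ℝ ≃o ℝ)} (hP : ∀ c, OKc u v c → thetaC c ∈ P)
    {c L} (h : Part c L) (hc : OKc u v c) : ∃ n, L.length = n + 1 ∧ ∃ g ∈ P, Out g c ∧
    List.Forall₂ (mp g) L (comb c n) := by
  induction h with
  | leaf c => exact ⟨0, rfl, 1, P.one_mem, fun _ _ => rfl, .cons (fun _ _ => rfl) .nil⟩
  | node p1 p2 h1 h2 =>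
    rename_i c L1 L2
    obtain ⟨a, ha, g1, hg1, o1, f1⟩ := h1 hc.lft
    obtain ⟨b, hb, g2, hg2, o2, f2⟩ := h2 hc.rgt
    obtain ⟨g, hg, o, f⟩ := cat_comb hP b a c hc
    refine ⟨a + b + 1, by rw [List.length_append, ha, hb]; ring, g * (g1 * g2),
      P.mul_mem hg (P.mul_mem hg1 hg2), o.mul (o1.lft.mul o2.rgt), ?_⟩
    refine mp_comp ?_ f
    exact List.rel_append (mp_comp (p1.mp_id o2.rgt_l) f1) (mp_comp f2 (mp_comb _ o1.lft_r))

def unif (N : ℕ) (a : ℤ) (n : ℕ) : List (ℤ × ℕ) := (List.range n).map fun i : ℕ => (a + i, N)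
theorem unif_add (N : ℕ) (a : ℤ) (n m : ℕ) : unif N a (n + m) = unif N a n ++ unif N (a + n) m := by
  simp [unif, List.range_add, add_assoc]

theorem treeOf {f : ℝ ≃o ℝ} {N : ℕ} (hf : ∀ j : ℤ, ∃ (n : ℕ) (c : ℤ), 
    ∀ s ∈ Set.Icc (0:ℝ) 1, f ((j + s) / 2 ^ N) = (c + s) / 2 ^ n) (n : ℕ) :
    ∀ (a : ℤ) (c : ℤ × ℕ), f (a / 2 ^ N) = cl c 0 → f ((a + n) / 2 ^ N) = cl c 1 → 
      ∃ L, Part c L ∧ List.Forall₂ (mp f) (unif N a n) L := by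
  induction n using Nat.strong_induction_on with
  | _ n ih =>
  intro a c h0 h1
  have hN : (0:ℝ) < 2 ^ N := by positivity
  rcases Nat.lt_trichotomy n 1 with hn | rfl | hn
  · exfalso
    obtain rfl : n = 0 := by omega
    have : cl c 0 = cl c 1 := by rw [← h0, ← h1]; simp
    rw [cl_inj] at this; norm_num at this
  · refine ⟨[c], .leaf c, .cons ?_ .nil⟩
    obtain ⟨m, d, hd⟩ := hf a
    have e0 := hd 0 (by simp)
    have e1 := hd 1 (by simp)
    intro s hs
    simp only [add_zero, Nat.cast_one] at e0 e1 h1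
    rw [h0] at e0; rw [h1] at e1
    have := hd s hs
    simp only [cl, Nat.cast_zero, add_zero] at *
    rw [this, add_div, add_div]
    rw [add_div, add_div] at e1
    have : s / 2 ^ m = s * (1 / 2 ^ m) := by ring
    have h' : s / 2 ^ c.2 = s * (1 / 2 ^ c.2) := by ring
    rw [this, h', e0]; congr 2; linarith
  · -- midpoint
    obtain ⟨x, hx⟩ := f.surjective (cl c (1/2))
    have x0 : (a:ℝ) < x * 2 ^ N := by
      rw [← div_lt_iff₀ hN, ← f.lt_iff_lt, h0, hx, cl_lt]; norm_num
    have x1 : x * 2 ^ N < (a + n : ℝ) := by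
      rw [← lt_div_iff₀ hN, ← f.lt_iff_lt, h1, hx, cl_lt]; norm_num
    obtain ⟨i, i1, i2⟩ : ∃ i : ℤ, (i:ℝ) ≤ x * 2 ^ N ∧ x * 2 ^ N < i + 1 :=
      ⟨⌊x * 2 ^ N⌋, Int.floor_le _, Int.lt_floor_add_one _⟩
    have ia : a ≤ i := by
      have : (a:ℝ) < (i + 1 : ℤ) := by push_cast; linarith
      have := Int.cast_lt.mp this; omega
    have ib : i < a + n := by
      have : (i:ℝ) < ((a + n : ℤ) : ℝ) := by push_cast; linarith
      exact Int.cast_lt.mp this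
    by_cases hxi : (i:ℝ) = x * 2 ^ N
    · have hxi' : (i:ℝ) / 2 ^ N = x := by rw [hxi]; field_simp
      have ia' : a < i := by rw [← hxi] at x0; exact_mod_cast x0
      obtain ⟨k, hk⟩ : ∃ k : ℕ, i = a + k := ⟨(i - a).toNat, by omega⟩
      obtain ⟨m, hm⟩ : ∃ m : ℕ, n = k + m := ⟨n - k, by omega⟩
      obtain ⟨L1, p1, f1⟩ := ih k (by omega) a (lft c) (by rw [cl_lft, h0]; norm_num) (by
        rw [cl_lft, ← hx, ← hxi', hk]; push_cast; rfl)
      obtain ⟨L2, p2, f2⟩ := ih m (by omega) (a + k) (rgt c) (by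
        rw [cl_rgt, zero_add, ← hx, ← hxi', hk]) (by
        rw [cl_rgt, show ((1:ℝ) + 1)/2 = 1 by norm_num, ← h1, hm]; push_cast; congr 1; ring)
      refine ⟨L1 ++ L2, .node p1 p2, ?_⟩
      rw [hm, unif_add]
      exact List.rel_append f1 f2
    · exfalso
      have i1 : (i:ℝ) < x * 2 ^ N := lt_of_le_of_ne i1 hxi
      obtain ⟨m, d, hd⟩ := hf i
      have e0 := hd 0 (by simp)
      have e1 := hd 1 (by simp)
      simp only [add_zero] at e0
      have l0 : f (i / 2 ^ N) < cl c (1/2) := by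
        rw [← hx, f.lt_iff_lt, div_lt_iff₀ hN]; exact i1
      have l1 : cl c (1/2) < f ((i + 1) / 2 ^ N) := by
        rw [← hx, f.lt_iff_lt, lt_div_iff₀ hN]; exact i2
      have k0 : cl c 0 ≤ f (i / 2 ^ N) := by
        rw [← h0, f.le_iff_le, div_le_div_iff_of_pos_right hN]; exact_mod_cast ia
      have k1 : f ((i + 1) / 2 ^ N) ≤ cl c 1 := by
        rw [← h1, f.le_iff_le, div_le_div_iff_of_pos_right hN]; exact_mod_cast ib
      rw [e0] at l0; rw [e1] at l1
      have e0' := e0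
      have e1' := e1
      rw [e0] at k0; rw [e1] at k1
      obtain ⟨j, l⟩ := c
      simp only [cl, add_zero] at *
      by_cases hml : m ≤ l
      · obtain ⟨q, rfl⟩ := Nat.exists_eq_add_of_le hml
        have hq : (1:ℝ) ≤ 2 ^ q := one_le_pow₀ (by norm_num)
        have hm : (0:ℝ) < 2 ^ m := by positivity
        have hmq : (0:ℝ) < 2 ^ (m + q) := by positivity
        rw [pow_add] at k0 k1
        rw [div_le_div_iff₀ (by positivity) (by positivity)] at k0 k1
        have k0' : (j:ℝ) ≤ d * 2 ^ q := by nlinarith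
        have k1' : ((d:ℝ) + 1) * 2 ^ q ≤ j + 1 := by nlinarith
        have q1 : (2:ℝ) ^ q = 1 := by nlinarith
        have dj : (d:ℝ) = j := by rw [q1] at k0' k1'; linarith
        have g0 : f (i / 2 ^ N) = f (a / 2 ^ N) := by rw [e0', h0, pow_add, q1, dj]; simp
        have g1 : f ((i + 1) / 2 ^ N) = f ((a + n) / 2 ^ N) := by rw [e1', h1, pow_add, q1, dj]; simp
        have g0 := f.injective g0
        have g1 := f.injective g1
        have g0 : (i:ℝ) = a := by field_simp at g0; exact g0
        have g1 : (i:ℝ) + 1 = a + n := by field_simp at g1; exact g1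
        have : (n:ℝ) = 1 := by linarith
        have : n = 1 := by exact_mod_cast this
        omega
      · obtain ⟨q, rfl⟩ := Nat.exists_eq_add_of_lt (not_le.mp hml)
        have hl : (0:ℝ) < 2 ^ l := by positivity
        rw [show l + q + 1 = l + 1 + q by ring, pow_add, pow_succ] at l0 l1
        rw [div_lt_div_iff₀ (by positivity) (by positivity)] at l0 l1
        have l0' : (d:ℝ) < ((2 * j + 1) * 2 ^ q : ℤ) := by push_cast; nlinarith
        have l1' : (((2 * j + 1) * 2 ^ q : ℤ) : ℝ) < (d + 1 : ℤ) := by push_cast; nlinarith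
        have := Int.cast_lt.mp l0'
        have := Int.cast_lt.mp l1'
        omega

theorem forall2_both {α β : Type*} {R S : α → β → Prop} {U : List α} {C : List β}
    (h1 : List.Forall₂ R U C) (h2 : List.Forall₂ S U C) : ∀ c ∈ U, ∃ c', R c c' ∧ S c c' := by
  induction h1 with
  | nil => simp
  | cons a b ih =>
    cases h2 with
    | cons a' b' =>
      intro c hc
      rcases List.mem_cons.mp hc with rfl | hc
      · exact ⟨_, a, a'⟩
      · exact ih b' c hc

/-- dyadic maps supported in a standard cell are generated by the theta's -/
theorem gen_cell {u v : ℝ} {P : Subgroup (ℝ ≃o ℝ)} (hP : ∀ c, OKc u v c → thetaC c ∈ P)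
    {c : ℤ × ℕ} (hc : OKc u v c) {f : ℝ ≃o ℝ} (hf : InD f) (ho : Out f c) : f ∈ P := by
  obtain ⟨K, N0, hD⟩ := hf
  set N := max N0 c.2 with hN
  obtain ⟨q, hq⟩ : ∃ q, N = c.2 + q := Nat.exists_eq_add_of_le (le_max_right _ _)
  have p0 : (((c.1 * 2 ^ q : ℤ)):ℝ) / 2 ^ N = cl c 0 := by
    rw [cl, hq, pow_add]; push_cast; field_simp; ring
  have p1 : (((c.1 * 2 ^ q : ℤ):ℝ) + ((2 ^ q : ℕ) : ℝ)) / 2 ^ N = cl c 1 := by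
    rw [cl, hq, pow_add]; push_cast; field_simp
  obtain ⟨L, hL, FL⟩ := treeOf (f := f) (N := N) (fun j => by
    obtain ⟨n, d, _, _, h⟩ := hD N (le_max_left _ _) j
    exact ⟨n, d, h⟩) (2 ^ q) (c.1 * 2 ^ q) c (by rw [p0]; exact ho _ (by simp)) (by rw [p1]; exact ho _ (by simp))
  obtain ⟨L', hL', FL'⟩ := treeOf (f := 1) (N := N) (fun j => ⟨N, j, fun s _ => rfl⟩) (2 ^ q) (c.1 * 2 ^ q) c 
    (by rw [p0]; rfl) (by rw [p1]; rfl)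
  obtain ⟨n, hn, g, hg, og, fg⟩ := part_comb hP hL hc
  obtain ⟨n', hn', g', hg', og', fg'⟩ := part_comb hP hL' hc
  obtain rfl : n = n' := by
    have := FL.length_eq
    have := FL'.length_eq
    omega
  have key := forall2_both (mp_comp FL fg) (mp_comp FL' fg')
  have : f = g⁻¹ * g' := by
    ext t
    by_cases ht : t ∈ Set.Ioo (cl c 0) (cl c 1)
    · rw [RelIso.mul_apply]
      apply g.injective
      rw [RelIso.apply_inv_self]
      have hN : (0:ℝ) < 2 ^ N := by positivity
      obtain ⟨i, i1, i2⟩ : ∃ i : ℤ, (i:ℝ) ≤ t * 2 ^ N ∧ t * 2 ^ N < i + 1 :=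
        ⟨⌊t * 2 ^ N⌋, Int.floor_le _, Int.lt_floor_add_one _⟩
      have x0 : ((c.1 * 2 ^ q : ℤ) : ℝ) < t * 2 ^ N := by
        rw [← div_lt_iff₀ hN, p0]; exact ht.1
      have x1 : t * 2 ^ N < (((c.1 * 2 ^ q : ℤ) : ℝ) + ((2 ^ q : ℕ) : ℝ)) := by
        rw [← lt_div_iff₀ hN, p1]; exact ht.2
      have ia : c.1 * 2 ^ q ≤ i := by
        have : ((c.1 * 2 ^ q : ℤ):ℝ) < (i + 1 : ℤ) := by push_cast at *; linarith
        have := Int.cast_lt.mp this; omega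
      have ib : i < c.1 * 2 ^ q + (2 ^ q : ℕ) := by
        have : (i:ℝ) < ((c.1 * 2 ^ q + (2 ^ q : ℕ) : ℤ) : ℝ) := by push_cast at *; linarith
        exact Int.cast_lt.mp this
      obtain ⟨c', h1, h2⟩ := key (i, N) (by
        rw [unif, List.mem_map]
        exact ⟨(i - c.1 * 2 ^ q).toNat, by rw [List.mem_range]; omega, by
          rw [Prod.mk.injEq]; exact ⟨by omega, rfl⟩⟩)
      have hs : t * 2 ^ N - i ∈ Set.Icc (0:ℝ) 1 := ⟨by linarith, by linarith⟩
      have e1 := h1 _ hs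
      have e2 := h2 _ hs
      have : cl (i, N) (t * 2 ^ N - i) = t := by simp only [cl]; field_simp; ring
      rw [this] at e1 e2
      rw [RelIso.mul_apply] at e1 e2
      rw [e1, ← e2]; rfl
    · rw [ho t ht, RelIso.mul_apply, og' t ht, inv_fix (og t ht)]
  rw [this]
  exact P.mul_mem (P.inv_mem hg) hg'

end GR

namespace GR
open scoped commutatorElement

noncomputable def th2 : ℝ ≃o ℝ := (scl 1)⁻¹ * theta * scl 1
noncomputable def th3 : ℝ ≃o ℝ := (trl (-1)) * th2 * (trl (-1))⁻¹
theorem th2_apply (t : ℝ) : th2 t = 2 * theta (t / 2) := by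
  rw [th2, RelIso.mul_apply, RelIso.mul_apply, scl_apply, scl_inv_apply]; ring_nf
theorem th3_apply (t : ℝ) : th3 t = 2 * theta ((t + 1) / 2) - 1 := by
  rw [th3, RelIso.mul_apply, RelIso.mul_apply, trl_apply, trl_inv_apply, th2_apply]; ring_nf
theorem th2_mem : InD th2 := ((scl_mem 1).inv.mul theta_mem).mul (scl_mem 1)
theorem trl_int (j : ℤ) : InD (trl j) := by simpa using trl_mem j 0
theorem th3_mem : InD th3 := by
  have : InD (trl (-1)) := by simpa using trl_int (-1)
  exact (this.mul th2_mem).mul this.inv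
noncomputable def thL : ℝ ≃o ℝ := th2⁻¹ * theta * th2
noncomputable def thR : ℝ ≃o ℝ := th3 * theta * th3⁻¹

theorem th2_lin {t : ℝ} (h : 0 ≤ t) (h' : t ≤ 1/2) : th2 t = 2 * t := by
  rw [th2_apply, theta_1 (by linarith) (by linarith)]; ring
theorem th3_lin {t : ℝ} (h : 0 ≤ t) (h' : t ≤ 1) : th3 t = (t + 1) / 2 := by
  rw [th3_apply, theta_3 (by linarith) (by linarith)]; ring
theorem theta_01 {t : ℝ} (h : 0 ≤ t) (h' : t ≤ 1) : 0 ≤ theta t ∧ theta t ≤ 1 := by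
  have := (maps_Icc (f := theta) (u := 0) (v := 1) (theta_le le_rfl) (theta_ge le_rfl) (t := t)).2 ⟨h, h'⟩
  exact this

theorem thL_le {t : ℝ} (h : t ≤ 0) : thL t = t := by
  rw [thL, RelIso.mul_apply, RelIso.mul_apply, th2_apply, theta_le (by linarith : t / 2 ≤ 0),
    theta_le (by linarith)]
  apply th2.injective
  rw [RelIso.apply_inv_self, th2_apply, theta_le (by linarith)]
theorem thL_ge {t : ℝ} (h : 1/2 ≤ t) : thL t = t := by
  have : 1 ≤ th2 t := by
    have : th2 (1/2) = 1 := by rw [th2_lin (by norm_num) (by norm_num)]; norm_num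
    rw [← this]; exact th2.le_iff_le.mpr h
  rw [thL, RelIso.mul_apply, RelIso.mul_apply, theta_ge this, RelIso.inv_apply_self]
theorem thL_mid {t : ℝ} (h : 0 ≤ t) (h' : t ≤ 1/2) : thL t = theta (2 * t) / 2 := by
  have := theta_01 (t := 2 * t) (by linarith) (by linarith)
  rw [thL, RelIso.mul_apply, RelIso.mul_apply, th2_lin h h']
  apply th2.injective
  rw [RelIso.apply_inv_self, th2_lin (by linarith) (by linarith)]; ring
theorem thR_ge {t : ℝ} (h : 1 ≤ t) : thR t = t := by
  have : 1 ≤ th3⁻¹ t := by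
    have : th3 1 = 1 := by rw [th3_lin (by norm_num) (by norm_num)]; norm_num
    have := th3⁻¹.le_iff_le.mpr (this.le.trans h)
    rwa [RelIso.inv_apply_self] at this
  rw [thR, RelIso.mul_apply, RelIso.mul_apply, theta_ge this, RelIso.apply_inv_self]
theorem thR_le {t : ℝ} (h : t ≤ 1/2) : thR t = t := by
  have : th3⁻¹ t ≤ 0 := by
    have : th3 0 = 1/2 := by rw [th3_lin (by norm_num) (by norm_num)]; norm_num
    have := th3⁻¹.le_iff_le.mpr (h.trans this.ge)
    rwa [RelIso.inv_apply_self] at this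
  rw [thR, RelIso.mul_apply, RelIso.mul_apply, theta_le this, RelIso.apply_inv_self]
theorem thR_mid {t : ℝ} (h : 1/2 ≤ t) (h' : t ≤ 1) : thR t = (theta (2 * t - 1) + 1) / 2 := by
  have := theta_01 (t := 2 * t - 1) (by linarith) (by linarith)
  have e : th3⁻¹ t = 2 * t - 1 := by
    apply th3.injective; rw [RelIso.apply_inv_self, th3_lin (by linarith) (by linarith)]; ring
  rw [thR, RelIso.mul_apply, RelIso.mul_apply, e, th3_lin this.1 this.2]

theorem pentagon : thR * theta * thL = theta * theta := by
  ext t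
  simp only [RelIso.mul_apply]
  rcases le_total t 0 with h | h
  · rw [thL_le h, theta_le h, thR_le (by linarith), theta_le h]
  rcases le_total t (1/8) with h1 | h1
  · rw [thL_mid h (by linarith), theta_1 (t := 2 * t) (by linarith) (by linarith), theta_1 (by linarith) (by linarith), 
      thR_le (by linarith), theta_1 (t := t) (by linarith) (by linarith), theta_1 (by linarith) (by linarith)]; ring
  rcases le_total t (1/4) with h2 | h2
  · rw [thL_mid h (by linarith), theta_2 (t := 2 * t) (by linarith) (by linarith), theta_2 (t := _ / 2) (by linarith) (by linarith), 
      thR_mid (by linarith) (by linarith), theta_1 (t := 2 * _ - 1) (by linarith) (by linarith), theta_1 (t := t) (by linarith) (by linarith), theta_2 (by linarith) (by linarith)]; ring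
  rcases le_total t (1/2) with h3 | h3
  · rw [thL_mid h (by linarith), theta_3 (t := 2 * t) (by linarith) (by linarith), theta_2 (t := _ / 2) (by linarith) (by linarith), 
      thR_mid (by linarith) (by linarith), theta_2 (t := 2 * _ - 1) (by linarith) (by linarith), theta_2 (t := t) (by linarith) (by linarith), theta_3 (by linarith) (by linarith)]; ring
  rcases le_total t 1 with h4 | h4
  · rw [thL_ge h3, theta_3 (t := t) (by linarith) (by linarith),
      thR_mid (by linarith) (by linarith), theta_3 (t := 2 * _ - 1) (by linarith) (by linarith), theta_3 (by linarith) (by linarith)]; ring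
  · rw [thL_ge (by linarith), theta_ge h4, thR_ge h4, theta_ge h4]

theorem conj_Fc {u v : ℝ} {c : ℤ × ℕ} (hc : OKc u v c) {h : ℝ ≃o ℝ} (hD : InD h) (h1 : ∀ t ≤ -1, h t = t)
    (h2 : ∀ t ≥ 2, h t = t) : Bc c * h * (Bc c)⁻¹ ∈ Fc u v := by
  refine ⟨((Bc_mem c).mul hD).mul (Bc_mem c).inv, cl c (-1), cl c 2, hc.1, hc.2, ?_, ?_⟩
  · intro t ht
    obtain ⟨s, rfl⟩ := (Bc c).surjective t
    rw [conj_apply, h1]; rwa [Bc_apply, cl_le] at ht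
  · intro t ht
    obtain ⟨s, rfl⟩ := (Bc c).surjective t
    rw [conj_apply, h2]; rwa [ge_iff_le, Bc_apply, cl_le] at ht

theorem comm_of_pent {Γ : Type*} [Group Γ] {K : Subgroup Γ} {x k k' : Γ} (hx : x ∈ K) (hk : k ∈ K) (hk' : k' ∈ K)
    (h : (k' * x * k'⁻¹) * x * (k⁻¹ * x * k) = x * x) : x ∈ ⁅K, K⁆ := by
  have e : x⁻¹ = ⁅k', x⁆ * ⁅x * x * k⁻¹ * (x * x)⁻¹, x⁆ := by
    simp only [commutatorElement_def]
    have : k' * x * k'⁻¹ = x * x * (k⁻¹ * x * k)⁻¹ * x⁻¹ := by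
      rw [← h]; group
    rw [this]; group
  have : x⁻¹ ∈ ⁅K, K⁆ := by
    rw [e]
    refine Subgroup.mul_mem _ (Subgroup.commutator_mem_commutator hk' hx) (Subgroup.commutator_mem_commutator ?_ hx)
    exact K.mul_mem (K.mul_mem (K.mul_mem hx hx) (K.inv_mem hk)) (K.inv_mem (K.mul_mem hx hx))
  simpa using Subgroup.inv_mem _ this

theorem thetaC_comm {u v : ℝ} (c : ℤ × ℕ) (hc : OKc u v c) : thetaC c ∈ ⁅Fc u v, Fc u v⁆ := by
  have t1 : ∀ t ≤ -1, theta t = t := fun t ht => theta_le (by linarith)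
  have t2 : ∀ t ≥ 2, theta t = t := fun t ht => theta_ge (by linarith)
  have h1 := conj_Fc hc theta_mem t1 t2
  have h2 := conj_Fc hc th2_mem (fun t ht => by rw [th2_apply, theta_le (by linarith)]; ring) 
    (fun t ht => by rw [th2_apply, theta_ge (by linarith)]; ring)
  have h3 := conj_Fc hc th3_mem (fun t ht => by rw [th3_apply, theta_le (by linarith)]; ring) 
    (fun t ht => by rw [th3_apply, theta_ge (by linarith)]; ring)
  refine comm_of_pent h1 h2 h3 ?_
  have := congrArg (fun y => Bc c * y * (Bc c)⁻¹) pentagon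
  simp only [thL, thR] at this
  convert this using 1 <;> simp only [thetaC, mul_assoc, mul_inv_rev, inv_inv, inv_mul_cancel_left]

theorem exists_OKc {u v : ℝ} (h : u < v) : ∃ c, OKc u v c := by
  obtain ⟨n, hn⟩ := exists_pow_lt_of_lt_one (by linarith : 0 < (v - u) / 4) (by norm_num : (1/2:ℝ) < 1)
  have hp : (0:ℝ) < 2 ^ n := by positivity
  rw [div_pow, one_pow, div_lt_iff₀ hp] at hn
  have i1 := Int.floor_le (u * 2 ^ n)
  have i2 := Int.lt_floor_add_one (u * 2 ^ n)
  refine ⟨(⌊u * 2 ^ n⌋ + 2, n), ?_, ?_⟩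
  · simp only [cl]; rw [lt_div_iff₀ hp]; push_cast; linarith
  · simp only [cl]; rw [div_lt_iff₀ hp]; push_cast; nlinarith

theorem Fc_perfect (u v : ℝ) : Fc u v ≤ ⁅Fc u v, Fc u v⁆ := by
  intro f hf
  by_cases huv : u < v
  · obtain ⟨c, hc⟩ := exists_OKc huv
    have c1 : u ≤ cl c 0 := hc.1.le.trans ((cl_le c).2 (by norm_num))
    have c2 : cl c 1 ≤ v := ((cl_le c).2 (by norm_num)).trans hc.2.le
    obtain ⟨g, hg, h1, _, _⟩ := push_conj (LM_Fc u v) (fun x hx => hx.1) c1 ((cl_lt c).2 one_pos) c2 hf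
    have := gen_cell thetaC_comm hc h1.1 (fun t ht => Fc_fix h1 ht)
    have e : f = ⁅g⁻¹, g * f * g⁻¹⁆ * (g * f * g⁻¹) := by simp only [commutatorElement_def]; group
    rw [e]
    exact Subgroup.mul_mem _ (Subgroup.commutator_mem_commutator (Subgroup.inv_mem _ hg) (Fc_mono c1 c2 h1)) this
  · have : f = 1 := by
      ext t
      exact Fc_fix hf (by simp only [Set.mem_Ioo]; intro h; linarith [h.1, h.2])
    rw [this]; exact Subgroup.one_mem _

end GR

namespace GR

noncomputable def trF (f : ℝ ≃o ℝ) (u v : ℝ) (t : ℝ) : ℝ := by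
  classical exact if t ∈ Set.Icc u v then f t else t

theorem trF_in {f : ℝ ≃o ℝ} {u v t : ℝ} (h : t ∈ Set.Icc u v) : trF f u v t = f t := by
  simp only [trF, if_pos h]
theorem trF_out {f : ℝ ≃o ℝ} {u v t : ℝ} (h : t ∉ Set.Icc u v) : trF f u v t = t := by
  simp only [trF, if_neg h]

theorem trF_mono {f : ℝ ≃o ℝ} {u v : ℝ} (hu : f u = u) (hv : f v = v) : Monotone (trF f u v) := by
  intro a b hab
  by_cases ha : a ∈ Set.Icc u v <;> by_cases hb : b ∈ Set.Icc u v
  · rw [trF_in ha, trF_in hb]; exact f.le_iff_le.mpr hab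
  · rw [trF_in ha, trF_out hb]
    have := (maps_Icc hu hv).2 ha
    have h2 : v < b := by by_contra h; exact hb ⟨ha.1.trans hab, not_lt.mp h⟩
    linarith [this.2]
  · rw [trF_out ha, trF_in hb]
    have := (maps_Icc hu hv).2 hb
    have h2 : a < u := by by_contra h; exact ha ⟨not_lt.mp h, hab.trans hb.2⟩
    linarith [this.1]
  · rw [trF_out ha, trF_out hb]; exact hab

theorem trF_inv {f : ℝ ≃o ℝ} {u v : ℝ} (hu : f u = u) (hv : f v = v) (t : ℝ) :
    trF f⁻¹ u v (trF f u v t) = t := by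
  by_cases ht : t ∈ Set.Icc u v
  · rw [trF_in ht, trF_in ((maps_Icc hu hv).2 ht), RelIso.inv_apply_self]
  · rw [trF_out ht, trF_out ht]

theorem exists_trunc {f : ℝ ≃o ℝ} {u v : ℝ} (hu : f u = u) (hv : f v = v) :
    ∃ g : ℝ ≃o ℝ, (∀ t ∈ Set.Icc u v, g t = f t) ∧ (∀ t, t ∉ Set.Ioo u v → g t = t) ∧
      (InD f → IsDyadic u → IsDyadic v → InD g) := by
  let g : ℝ ≃o ℝ :=
    { toFun := trF f u v
      invFun := trF f⁻¹ u v
      left_inv := trF_inv hu hv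
      right_inv := fun t => by
        have := trF_inv (inv_fix hu) (inv_fix hv) t
        rwa [inv_inv] at this
      map_rel_iff' := by
        intro a b
        constructor
        · intro h
          have := trF_mono (inv_fix hu) (inv_fix hv) h
          simp only [Equiv.coe_fn_mk] at this
          rwa [trF_inv hu hv, trF_inv hu hv] at this
        · intro h; exact trF_mono hu hv h }
  have g1 : ∀ t ∈ Set.Icc u v, g t = f t := fun t ht => trF_in ht
  have g2 : ∀ t, t ∉ Set.Icc u v → g t = t := fun t ht => trF_out ht
  refine ⟨g, g1, ?_, ?_⟩
  · intro t ht
    by_cases h : t ∈ Set.Icc u v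
    · rcases eq_or_lt_of_le h.1 with rfl | h1
      · rw [g1 _ h, hu]
      rcases eq_or_lt_of_le h.2 with rfl | h2
      · rw [g1 _ h, hv]
      exact absurd ⟨h1, h2⟩ ht
    · exact g2 t h
  · rintro ⟨K, N0, hf⟩ ⟨a, m, hu⟩ ⟨b, m', hv⟩
    refine ⟨K, max N0 (max m m'), fun N hN j => ?_⟩
    obtain ⟨q, rfl⟩ := Nat.exists_eq_add_of_le (show m ≤ N by omega)
    obtain ⟨q', hq'⟩ := Nat.exists_eq_add_of_le (show m' ≤ m + q by omega)
    have hp : (0:ℝ) < 2 ^ (m + q) := by positivity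
    have eu : u = ((a * 2 ^ q : ℤ) : ℝ) / 2 ^ (m + q) := by rw [hu, pow_add]; push_cast; field_simp
    have ev : v = ((b * 2 ^ q' : ℤ) : ℝ) / 2 ^ (m + q) := by rw [hv, hq', pow_add]; push_cast; field_simp
    generalize a * 2 ^ q = A at eu
    generalize b * 2 ^ q' = B at ev
    by_cases hj : A ≤ j ∧ j < B
    · obtain ⟨n, c, h1, h2, h3⟩ := hf (m + q) (by omega) j
      refine ⟨n, c, h1, h2, fun s hs => ?_⟩
      rw [g1, h3 s hs]
      rw [eu, ev]
      have : (A:ℝ) ≤ j := by exact_mod_cast hj.1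
      have : (j:ℝ) + 1 ≤ B := by exact_mod_cast hj.2
      constructor
      · gcongr; linarith [hs.1]
      · gcongr; linarith [hs.2]
    · refine ⟨m + q, j, by omega, by omega, fun s hs => ?_⟩
      by_cases hh : ((j:ℝ) + s) / 2 ^ (m + q) ∈ Set.Icc u v
      · -- an endpoint
        rw [eu, ev] at hh
        obtain ⟨k1, k2⟩ := hh
        rw [div_le_div_iff_of_pos_right hp] at k1 k2
        have : ((j:ℝ) + s) / 2 ^ (m + q) = u ∨ ((j:ℝ) + s) / 2 ^ (m + q) = v := by
          by_cases h' : A ≤ j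
          · right
            have : (B:ℝ) ≤ j := by exact_mod_cast not_lt.mp (not_and.mp hj h')
            rw [ev]; congr 1; linarith [hs.1]
          · left
            have : (j:ℝ) + 1 ≤ A := by exact_mod_cast not_le.mp h'
            rw [eu]; congr 1; linarith [hs.2]
        rcases this with h | h
        · rw [h]
          by_cases h' : u ∈ Set.Icc u v
          · rw [g1 _ h']; assumption
          · rw [g2 _ h']
        · rw [h]
          by_cases h' : v ∈ Set.Icc u v
          · rw [g1 _ h']; assumption
          · rw [g2 _ h']
      · rw [g2 _ hh]

theorem InD_of_pieces {f : ℝ ≃o ℝ} (N1 M K : ℕ) (h : ∀ j : ℤ, ∃ (k : ℤ) (b : ℤ), |k| ≤ K ∧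
    ∀ t ∈ Set.Icc ((j:ℝ) / 2 ^ N1) ((j + 1) / 2 ^ N1), f t = 2 ^ k * t + b / 2 ^ M) : InD f := by
  refine ⟨K, N1 + M + K, fun N hN j => ?_⟩
  obtain ⟨q, rfl⟩ := Nat.exists_eq_add_of_le (show N1 ≤ N by omega)
  obtain ⟨k, b, hk, hf⟩ := h (j / 2 ^ q)
  have hk := abs_le.mp hk
  obtain ⟨n, hn⟩ : ∃ n : ℕ, (n : ℤ) = (N1 + q : ℕ) - k := ⟨((N1 + q : ℕ) - k).toNat, by omega⟩
  obtain ⟨r, hr⟩ : ∃ r : ℕ, n = M + r := ⟨n - M, by omega⟩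
  refine ⟨n, j + b * 2 ^ r, by omega, by omega, fun s hs => ?_⟩
  have d1 := Int.ediv_mul_le j (show (2:ℤ) ^ q ≠ 0 by positivity)
  have d2 := Int.lt_ediv_add_one_mul_self j (show (0:ℤ) < (2:ℤ) ^ q by positivity)
  generalize j / 2 ^ q = i at *
  have d1 : (i:ℝ) * 2 ^ q ≤ j := by exact_mod_cast d1
  have d2 : (j:ℝ) + 1 ≤ (i + 1) * 2 ^ q := by exact_mod_cast d2
  rw [hf]
  · have : (2:ℝ) ^ k = 2 ^ (N1 + q) / 2 ^ n := by
      rw [eq_div_iff (by positivity), ← zpow_natCast, ← zpow_natCast, ← zpow_add₀ (by norm_num)]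
      congr 1; omega
    rw [this, hr]
    push_cast
    rw [pow_add, pow_add]
    field_simp
    ring
  · rw [pow_add]
    have : (0:ℝ) < 2 ^ N1 := by positivity
    have : (0:ℝ) < 2 ^ q := by positivity
    constructor
    · rw [div_le_div_iff₀ (by positivity) (by positivity)]; nlinarith [hs.1]
    · rw [div_le_div_iff₀ (by positivity) (by positivity)]; nlinarith [hs.2]

theorem _root_.IsDyadic.mono {x : ℝ} {a : ℤ} {b : ℕ} (h : x = a / 2 ^ b) {c : ℕ} (hc : b ≤ c) : ∃ a' : ℤ, x = a' / 2 ^ c := by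
  obtain ⟨q, rfl⟩ := Nat.exists_eq_add_of_le hc
  exact ⟨a * 2 ^ q, by rw [h, pow_add]; push_cast; field_simp⟩
theorem _root_.IsDyadic.add {x y : ℝ} (hx : IsDyadic x) (hy : IsDyadic y) : IsDyadic (x + y) := by
  obtain ⟨a, b, h⟩ := hx
  obtain ⟨c, d, h'⟩ := hy
  exact ⟨a * 2 ^ d + c * 2 ^ b, b + d, by rw [h, h', pow_add]; push_cast; field_simp⟩
theorem _root_.IsDyadic.neg {x : ℝ} (hx : IsDyadic x) : IsDyadic (-x) := by
  obtain ⟨a, b, h⟩ := hx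
  exact ⟨-a, b, by rw [h]; push_cast; ring⟩
theorem _root_.IsDyadic.zpow_mul {x : ℝ} (hx : IsDyadic x) (k : ℤ) : IsDyadic (2 ^ k * x) := by
  obtain ⟨a, b, h⟩ := hx
  rcases Int.eq_nat_or_neg k with ⟨n, rfl | rfl⟩
  · exact ⟨a * 2 ^ n, b, by rw [h, zpow_natCast]; push_cast; ring⟩
  · exact ⟨a, b + n, by rw [h, zpow_neg, zpow_natCast, pow_add]; field_simp⟩

theorem _root_.IsDyadic.common {m : ℕ} {x : Fin m → ℝ} (h : ∀ i, IsDyadic (x i)) : ∃ N : ℕ, ∀ i, ∃ a : ℤ, x i = a / 2 ^ N := by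
  choose a b hab using h
  exact ⟨Finset.univ.sup b, fun i => IsDyadic.mono (hab i) (Finset.le_sup (Finset.mem_univ i))⟩

theorem InD_of_Thompson {f : ℝ ≃o ℝ} (hf : InThompsonF f) : InD f := by
  obtain ⟨hout, m, x, x0, x1, xm, xd, hx⟩ := hf
  have f0 : f 0 = 0 := by
    by_contra hne
    rcases lt_or_gt_of_ne hne with h | h
    · have : f (f 0) = f 0 := hout _ (by simp; intro h'; linarith)
      exact hne (f.injective this)
    · obtain ⟨s, hs⟩ := f.surjective (min (f 0 / 2) (1/2))
      have h1 : s < 0 := by rw [← f.lt_iff_lt, hs]; exact (min_le_left _ _).trans_lt (by linarith)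
      have := hout s (by simp; intro h'; linarith)
      rw [hs] at this
      have : 0 < min (f 0 / 2) (1/2) := lt_min (by linarith) (by norm_num)
      linarith
  have f1 : f 1 = 1 := by
    by_contra hne
    rcases lt_or_gt_of_ne hne with h | h
    · obtain ⟨s, hs⟩ := f.surjective ((f 1 + 1)/2)
      have h1 : 1 < s := by rw [← f.lt_iff_lt, hs]; linarith
      have := hout s (by simp; intro h'; linarith)
      rw [hs] at this
      linarith
    · have : f (f 1) = f 1 := hout _ (by simp; intro h'; linarith)
      exact hne (f.injective this)
  choose k c hkc using hx
  have fd : ∀ i, IsDyadic (f (x i)) := by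
    intro i
    induction i using Fin.induction with
    | zero => rw [x0, f0]; exact ⟨0, 0, by simp⟩
    | succ i ih =>
      have hlt : x i.castSucc < x i.succ := xm (Fin.castSucc_lt_succ)
      have e1 := hkc i _ (Set.left_mem_Icc.mpr hlt.le)
      have e2 := hkc i _ (Set.right_mem_Icc.mpr hlt.le)
      have : f (x i.succ) = 2 ^ k i * x i.succ + (f (x i.castSucc) + -(2 ^ k i * x i.castSucc)) := by
        rw [e2, e1]; ring
      rw [this]
      exact ((xd _).zpow_mul _).add (ih.add ((xd _).zpow_mul _).neg)
  have cd : ∀ i, IsDyadic (c i) := by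
    intro i
    have hlt : x i.castSucc < x i.succ := xm (Fin.castSucc_lt_succ)
    have e1 := hkc i _ (Set.left_mem_Icc.mpr hlt.le)
    have : c i = f (x i.castSucc) + -(2 ^ k i * x i.castSucc) := by rw [e1]; ring
    rw [this]
    exact (fd _).add ((xd _).zpow_mul _).neg
  obtain ⟨N1, hN1⟩ := IsDyadic.common xd
  obtain ⟨M, hM⟩ := IsDyadic.common cd
  have hp : (0:ℝ) < 2 ^ N1 := by positivity
  refine InD_of_pieces N1 M (Finset.univ.sup fun i => (k i).natAbs) fun j => ?_
  by_cases hj : 0 ≤ j ∧ j < 2 ^ N1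
  · have hj0 : (0:ℝ) ≤ (j:ℝ) / 2 ^ N1 := div_nonneg (by exact_mod_cast hj.1) hp.le
    have hj1 : (j:ℝ) / 2 ^ N1 < 1 := by rw [div_lt_one hp]; exact_mod_cast hj.2
    -- find the piece
    have : ∀ i : Fin (m+1), (j:ℝ) / 2 ^ N1 < x i → ∃ i' : Fin m, x i'.castSucc ≤ (j:ℝ) / 2 ^ N1 ∧ (j:ℝ) / 2 ^ N1 < x i'.succ := by
      intro i
      induction i using Fin.induction with
      | zero => rw [x0]; intro h; linarith
      | succ i ih =>
        intro h
        by_cases h' : (j:ℝ) / 2 ^ N1 < x i.castSucc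
        · exact ih h'
        · exact ⟨i, not_lt.mp h', h⟩
    obtain ⟨i, i1, i2⟩ := this (Fin.last m) (by rw [x1]; exact hj1)
    obtain ⟨b, hb⟩ := hM i
    refine ⟨k i, b, ?_, fun t ht => ?_⟩
    · have : (k i).natAbs ≤ Finset.univ.sup fun i => (k i).natAbs := Finset.le_sup (f := fun i => (k i).natAbs) (Finset.mem_univ i)
      rw [Int.abs_eq_natAbs]; exact_mod_cast this
    · rw [← hb]
      apply hkc i t
      obtain ⟨A, hA⟩ := hN1 i.succ
      rw [hA] at i2 ⊢
      rw [div_lt_div_iff_of_pos_right hp] at i2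
      refine ⟨i1.trans ht.1, ht.2.trans ?_⟩
      rw [div_le_div_iff_of_pos_right hp]
      exact_mod_cast i2
  · refine ⟨0, 0, by simp, fun t ht => ?_⟩
    simp only [zpow_zero, one_mul, Int.cast_zero, zero_div, add_zero]
    by_cases h0 : 0 ≤ j
    · have : (2:ℝ) ^ N1 ≤ j := by exact_mod_cast not_lt.mp (not_and.mp hj h0)
      have h1 : 1 ≤ t := le_trans (by rw [le_div_iff₀ hp]; linarith) ht.1
      rcases eq_or_lt_of_le h1 with rfl | h1
      · exact f1
      · exact hout t (by simp; intro; exact h1)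
    · have : (j:ℝ) + 1 ≤ 0 := by exact_mod_cast not_le.mp h0
      have h1 : t ≤ 0 := le_trans ht.2 (by rw [div_le_iff₀ hp]; linarith)
      rcases eq_or_lt_of_le h1 with rfl | h1
      · exact f0
      · exact hout t (by simp; intro; linarith)

theorem InH_of_Fc {f : ℝ ≃o ℝ} (hf : f ∈ Fc 0 1) : InH f := by
  refine ⟨⟨fun x hx => Fc_fix hf (fun h => hx ⟨h.1.le, h.2.le⟩), ?_⟩, ?_⟩
  · obtain ⟨⟨K, N, hD⟩, -⟩ := hf
    have hp : (0:ℝ) < 2 ^ N := by positivity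
    refine ⟨2 ^ N, fun i => (i:ℝ) / 2 ^ N, by simp, by simp, ?_, fun i => ⟨i, N, by simp⟩, fun i => ?_⟩
    · intro i j hij
      simp only
      rw [div_lt_div_iff_of_pos_right hp]
      exact_mod_cast hij
    · obtain ⟨n, c, -, -, h⟩ := hD N le_rfl i
      refine ⟨(N:ℤ) - n, (c - i) / 2 ^ n, fun t ht => ?_⟩
      simp only [Fin.val_castSucc, Fin.val_succ] at ht
      push_cast at ht h
      obtain ⟨h1, h2⟩ := ht
      rw [div_le_iff₀ hp] at h1
      rw [le_div_iff₀ hp] at h2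
      have := h (t * 2 ^ N - i) ⟨by linarith, by linarith⟩
      rw [show ((i:ℝ) + (t * 2 ^ N - i)) / 2 ^ N = t by field_simp; ring] at this
      rw [this, zpow_sub₀ (by norm_num), zpow_natCast, zpow_natCast]
      field_simp; ring
  · obtain ⟨-, u, v, hu, hv, h1, h2⟩ := hf
    refine ⟨0, min u (1 - v), lt_min hu (by linarith), fun t ht => ?_, fun t ht => ?_⟩
    · rw [h1 t (ht.2.trans (min_le_left _ _))]; simp
    · rw [h2 t (by linarith [ht.1, min_le_right u (1 - v)])]; simp

end GR

namespace GR

@[ext] structure Fr where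
  n : ℤ
  e : ℤˣ

instance : Mul Fr := ⟨fun x d => ⟨x.n + x.e * d.n, x.e * d.e⟩⟩
instance : One Fr := ⟨⟨0, 1⟩⟩
instance : Inv Fr := ⟨fun x => ⟨-(x.e * x.n), x.e⟩⟩
@[simp] theorem Fr.mul_n (x d : Fr) : (x * d).n = x.n + x.e * d.n := rfl
@[simp] theorem Fr.mul_e (x d : Fr) : (x * d).e = x.e * d.e := rfl
@[simp] theorem Fr.one_n : (1 : Fr).n = 0 := rfl
@[simp] theorem Fr.one_e : (1 : Fr).e = 1 := rfl
@[simp] theorem Fr.inv_n (x : Fr) : (x⁻¹).n = -(x.e * x.n) := rfl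
@[simp] theorem Fr.inv_e (x : Fr) : (x⁻¹).e = x.e := rfl

instance : Group Fr := Group.ofLeftAxioms
  (by intro a b c; ext <;> simp [mul_assoc, mul_add, add_assoc])
  (by intro a; ext <;> simp)
  (by intro a; ext <;> simp)

theorem Fr.cases (x : Fr) : x.e = 1 ∨ x.e = -1 := Int.units_eq_one_or _

/-- the isometry attached to a frame -/
def ph (x : Fr) (t : ℝ) : ℝ := x.n + ((x.e : ℤ) : ℝ) * t

theorem esq (e : ℤˣ) : ((e : ℤ) : ℝ) * ((e : ℤ) : ℝ) = 1 := by
  rcases Int.units_eq_one_or e with h | h <;> simp [h]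

theorem ph_mul (x d : Fr) (t : ℝ) : ph (x * d) t = ph x (ph d t) := by
  simp only [ph, Fr.mul_n, Fr.mul_e]; push_cast; ring
@[simp] theorem ph_one (t : ℝ) : ph 1 t = t := by simp [ph]
@[simp] theorem ph_inv_ph (x : Fr) (t : ℝ) : ph x⁻¹ (ph x t) = t := by rw [← ph_mul]; simp
@[simp] theorem ph_ph_inv (x : Fr) (t : ℝ) : ph x (ph x⁻¹ t) = t := by rw [← ph_mul]; simp
theorem ph_inj (x : Fr) {s t : ℝ} (h : ph x s = ph x t) : s = t := by
  rw [← ph_inv_ph x s, h, ph_inv_ph]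
theorem ph_abs (x : Fr) (s t : ℝ) : |ph x s - ph x t| = |s - t| := by
  rcases x.cases with h | h
  · simp [ph, h]
  · simp only [ph, h]; push_cast; rw [← abs_neg]; congr 1; simp; ring

noncomputable def cj (x : Fr) : (ℝ ≃o ℝ) →* (ℝ ≃o ℝ) where
  toFun g :=
    { toFun := fun t => ph x⁻¹ (g (ph x t))
      invFun := fun t => ph x⁻¹ (g⁻¹ (ph x t))
      left_inv := fun t => by simp
      right_inv := fun t => by simp
      map_rel_iff' := by
        intro a b
        simp only [Equiv.coe_fn_mk]
        rcases x.cases with h | h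
        · simp [ph, h]
        · simp only [ph, h, Fr.inv_n, Fr.inv_e]
          push_cast
          have := g.le_iff_le (x := (x.n:ℝ) + -1 * b) (y := (x.n:ℝ) + -1 * a)
          constructor
          · intro h'
            have := this.1 (by linarith)
            linarith
          · intro h'
            have := this.2 (by linarith)
            linarith }
  map_one' := by ext t; exact ph_inv_ph x t
  map_mul' := by
    intro g h; ext t
    show ph x⁻¹ (g (h (ph x t))) = ph x⁻¹ (g (ph x (ph x⁻¹ (h (ph x t)))))
    rw [ph_ph_inv]

theorem cj_apply (x : Fr) (g : ℝ ≃o ℝ) (t : ℝ) : cj x g t = ph x⁻¹ (g (ph x t)) := rfl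
theorem ph_cj (x : Fr) (g : ℝ ≃o ℝ) (t : ℝ) : ph x (cj x g t) = g (ph x t) := by
  rw [cj_apply, ph_ph_inv]
theorem cj_mul (x d : Fr) (g : ℝ ≃o ℝ) : cj (x * d) g = cj d (cj x g) := by
  ext t; simp only [cj_apply, mul_inv_rev, ph_mul]
theorem cj_mul_apply (x : Fr) (g h : ℝ ≃o ℝ) (t : ℝ) : cj x (g * h) t = cj x g (cj x h t) := by
  rw [map_mul]; rfl
theorem cj_eq {x : Fr} {g : ℝ ≃o ℝ} {t w : ℝ} : cj x g t = w ↔ g (ph x t) = ph x w := by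
  rw [cj_apply]
  constructor
  · rintro rfl; simp
  · intro h; rw [h]; simp
@[simp] theorem cj_one (g : ℝ ≃o ℝ) : cj 1 g = g := by ext t; simp [cj_apply]

theorem InD.cj {g : ℝ ≃o ℝ} (hg : InD g) (x : Fr) : InD (cj x g) := by
  obtain ⟨K, N0, hD⟩ := hg
  refine ⟨K, N0 + K, fun N hN j => ?_⟩
  rcases x.cases with h | h
  · obtain ⟨n, c, h1, h2, h3⟩ := hD N (by omega) (j + x.n * 2 ^ N)
    refine ⟨n, c - x.n * 2 ^ n, h1, h2, fun s hs => ?_⟩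
    rw [cj_eq]
    have := h3 s hs
    simp only [ph, h]
    push_cast at this ⊢
    convert this using 1
    · congr 1; field_simp; ring
    · field_simp; ring
  · obtain ⟨n, c, h1, h2, h3⟩ := hD N (by omega) (x.n * 2 ^ N - j - 1)
    refine ⟨n, x.n * 2 ^ n - c - 1, h1, h2, fun s hs => ?_⟩
    rw [cj_eq]
    have := h3 (1 - s) ⟨by linarith [hs.2], by linarith [hs.1]⟩
    simp only [ph, h]
    push_cast at this ⊢
    convert this using 1
    · congr 1; field_simp; ring
    · field_simp; ring

def V (σ : ℤ → ℤ) (x : Fr) (i : ℤ) : ℤ := x.e * σ (2 * x.n + x.e * i)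
theorem V_mul (σ : ℤ → ℤ) (x d : Fr) (i : ℤ) : V σ (x * d) i = d.e * V σ x (2 * d.n + d.e * i) := by
  simp only [V, Fr.mul_n, Fr.mul_e]; push_cast
  rw [show 2 * (x.n + (x.e:ℤ) * d.n) + (x.e:ℤ) * d.e * i = 2 * x.n + x.e * (2 * d.n + d.e * i) by ring]; ring

def agree (σ : ℤ → ℤ) (R : ℕ) (x y : Fr) : Prop := ∀ i : ℤ, |i| ≤ R → V σ x i = V σ y i

theorem agree.mono {σ R R' x y} (h : agree σ R' x y) (hR : R ≤ R') : agree σ R x y :=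
  fun i hi => h i (by omega)
theorem agree.symm {σ R x y} (h : agree σ R x y) : agree σ R y x := fun i hi => (h i hi).symm
theorem agree.trans {σ R x y z} (h : agree σ R x y) (h' : agree σ R y z) : agree σ R x z :=
  fun i hi => (h i hi).trans (h' i hi)
theorem agree.refl {σ R} (x) : agree σ R x x := fun i hi => rfl
theorem agree.mul {σ R x y} (d : Fr) (h : agree σ (R + 2 * d.n.natAbs) x y) : agree σ R (x * d) (y * d) := by
  intro i hi
  rw [V_mul, V_mul, h]
  rw [abs_le] at hi ⊢
  rcases d.cases with h | h <;> rw [h] <;> push_cast at hi ⊢ <;>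
    (have := neg_abs_le d.n; have := le_abs_self d.n; constructor <;> linarith)

def IsZ (σ : ℤ → ℤ) (f g : ℝ ≃o ℝ) : Prop := ∀ x, V σ x 1 = 1 → ∀ t ∈ Set.Icc (0:ℝ) 1, cj x g t = f t
def IsC (σ : ℤ → ℤ) (f g : ℝ ≃o ℝ) : Prop :=
  ∀ x, V σ x 0 = 1 → ∀ t ∈ Set.Icc (-1/2:ℝ) (1/2), cj x g t = f (t + 1/2) - 1/2

structure Setup (σ : ℤ → ℤ) (G : Subgroup (ℝ ≃o ℝ)) : Prop where
  sgn : ∀ i, σ i = 1 ∨ σ i = -1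
  zeta : ∀ f, InH f → ∃ g ∈ G, IsZ σ f g
  chi : ∀ f, InH f → ∃ g ∈ G, IsC σ f g
  gen : G ≤ Subgroup.closure {g | g ∈ G ∧ ∃ f, InH f ∧ (IsZ σ f g ∨ IsC σ f g)}
  recur : ∀ (R : ℕ) (x0 : Fr), ∃ B : ℕ, ∀ m : ℤ, ∃ x : Fr, agree σ R x x0 ∧ |x.n - m| ≤ B
  aper : ∀ x y : Fr, (∀ i, V σ x i = V σ y i) → x = y

def lsgn : Letter → ℤ
  | .a => 1
  | .b => 1
  | .A => -1
  | .B => -1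

theorem _root_.InH.fix {f : ℝ ≃o ℝ} (h : InH f) : f 0 = 0 ∧ f 1 = 1 := by
  obtain ⟨-, k, ε, hε, h0, h1⟩ := h
  constructor
  · rw [h0 0 ⟨le_rfl, hε.le⟩]; simp
  · rw [h1 1 ⟨by linarith, le_rfl⟩]; simp

theorem bw_eq (ρ : ℤ → Letter) (k : ℤ) (n : ℕ) :
    blockWord ρ k n = (List.range (n+1)).map (fun i : ℕ => ρ (k + (i:ℤ))) := by
  unfold blockWord
  generalize List.range (n+1) = l
  induction l with
  | nil => rfl
  | cons a l ih => simpa using ih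

theorem word_inf {ρ : ℤ → Letter} {k k' : ℤ} {n n' : ℕ} (h : blockWord ρ k n <:+: blockWord ρ k' n') :
    ∃ o : ℕ, o ≤ n' ∧ ∀ i : ℕ, i ≤ n → ρ (k' + o + i) = ρ (k + i) := by
  obtain ⟨s, t, hst⟩ := h
  have hl := congrArg List.length hst
  simp only [bw_eq, List.length_append, List.length_map, List.length_range] at hl
  refine ⟨s.length, by omega, fun i hi => ?_⟩
  have h1 : (blockWord ρ k' n')[s.length + i]? = some (ρ (k' + (s.length + i : ℕ))) := by
    rw [bw_eq]
    rw [List.getElem?_map, List.getElem?_range (by omega)]; rfl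
  rw [← hst, List.append_assoc, List.getElem?_append_right (by omega), Nat.add_sub_cancel_left, 
    List.getElem?_append_left (by simp [bw_eq]; omega)] at h1
  rw [bw_eq] at h1
  rw [List.getElem?_map, List.getElem?_range (by omega)] at h1
  simp at h1
  rw [h1]; congr 1; ring

theorem word_inv {ρ : ℤ → Letter} {k k' : ℤ} {n : ℕ} (h : blockWord ρ k' n = wordInv (blockWord ρ k n)) 
    (i : ℕ) (hi : i ≤ n) : ρ (k' + i) = (ρ (k + (n - i))).inv := by
  have h1 : (blockWord ρ k' n)[i]? = some (ρ (k' + i)) := by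
    rw [bw_eq]
    rw [List.getElem?_map, List.getElem?_range (by omega)]; rfl
  rw [h, wordInv, List.getElem?_reverse (by simp [bw_eq]; omega)] at h1
  simp only [bw_eq, List.length_map, List.length_range] at h1
  rw [List.getElem?_map, List.getElem?_map, List.getElem?_range (by omega)] at h1
  simp at h1
  rw [← h1]; congr 3; omega

theorem lab_even {ρ : ℤ → Letter} (h : IsLabelling ρ) {m m' : ℤ} (hm : ρ m = ρ m') : m % 2 = m' % 2 := by
  have h1 := h m
  have h2 := h m'
  rcases Int.even_or_odd m with e | e <;> rcases Int.even_or_odd m' with e' | e'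
  · rw [Int.even_iff] at *; omega
  · rcases h1.1 e with a | a <;> rcases h2.2 e' with b | b <;> rw [a, b] at hm <;> simp at hm
  · rcases h1.2 e with a | a <;> rcases h2.1 e' with b | b <;> rw [a, b] at hm <;> simp at hm
  · rw [Int.odd_iff] at *; omega

theorem lab_even_inv {ρ : ℤ → Letter} (h : IsLabelling ρ) {m m' : ℤ} (hm : ρ m = (ρ m').inv) : m % 2 = m' % 2 := by
  have h1 := h m
  have h2 := h m'
  rcases Int.even_or_odd m with e | e <;> rcases Int.even_or_odd m' with e' | e'
  · rw [Int.even_iff] at *; omega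
  · rcases h1.1 e with a | a <;> rcases h2.2 e' with b | b <;> rw [a, b] at hm <;> simp [Letter.inv] at hm
  · rcases h1.2 e with a | a <;> rcases h2.1 e' with b | b <;> rw [a, b] at hm <;> simp [Letter.inv] at hm
  · rw [Int.odd_iff] at *; omega

theorem IsZeta.isZ {ρ : ℤ → Letter} (hl : IsLabelling ρ) {f g : ℝ ≃o ℝ} (h : IsZeta ρ f g) :
    IsZ (fun i => lsgn (ρ i)) f g := by
  intro x hx t ht
  rw [cj_eq]
  rcases x.cases with he | he
  · simp only [V, he] at hx
    have : ρ (2 * x.n + 1) = .b := by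
      rcases (hl (2 * x.n + 1)).2 (by simp) with h' | h' <;> simp [h', lsgn] at hx ⊢
    have := (h x.n (x.n + t) ⟨by linarith [ht.1], by linarith [ht.2]⟩).1 this
    simp [ph, he, this]
  · simp only [V, he] at hx
    have e : 2 * x.n + (-1) = 2 * (x.n - 1) + 1 := by ring
    have : ρ (2 * (x.n - 1) + 1) = .B := by
      rcases (hl (2 * (x.n - 1) + 1)).2 (by simp) with h' | h' <;> simp [e, h', lsgn] at hx ⊢
    have := (h (x.n - 1) (x.n - t) ⟨by push_cast; linarith [ht.2], by push_cast; linarith [ht.1]⟩).2 this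
    simp [ph, he]
    rw [← sub_eq_add_neg, this]; push_cast; ring_nf

theorem IsChi.isC {ρ : ℤ → Letter} (hl : IsLabelling ρ) {f g : ℝ ≃o ℝ} (h : IsChi ρ f g) :
    IsC (fun i => lsgn (ρ i)) f g := by
  intro x hx t ht
  rw [cj_eq]
  rcases x.cases with he | he
  · simp only [V, he] at hx
    have : ρ (2 * x.n) = .a := by
      rcases (hl (2 * x.n)).1 (by simp) with h' | h' <;> simp [h', lsgn] at hx ⊢
    have := (h x.n (x.n + t) ⟨by linarith [ht.1], by linarith [ht.2]⟩).1 this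
    simp only [ph, he]
    push_cast
    rw [one_mul, this]; ring_nf
  · simp only [V, he] at hx
    have : ρ (2 * x.n) = .A := by
      rcases (hl (2 * x.n)).1 (by simp) with h' | h' <;> simp [h', lsgn] at hx ⊢
    have := (h x.n (x.n - t) ⟨by linarith [ht.2], by linarith [ht.1]⟩).2 this
    simp only [ph, he]
    push_cast
    rw [show (x.n:ℝ) + -1 * t = x.n - t by ring, this]; ring_nf

theorem IsZ.one {σ} : IsZ σ 1 1 := fun x _ t _ => by rw [map_one]
theorem IsZ.mul {σ f f' g g'} (h : IsZ σ f g) (h' : IsZ σ f' g') (h0 : f' 0 = 0) (h1 : f' 1 = 1) : IsZ σ (f * f') (g * g') := by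
  intro x hx t ht
  rw [cj_mul_apply, h' x hx t ht, h x hx _ ((maps_Icc h0 h1).2 ht)]; rfl
theorem IsZ.inv {σ f g} (h : IsZ σ f g) (h0 : f 0 = 0) (h1 : f 1 = 1) : IsZ σ f⁻¹ g⁻¹ := by
  intro x hx t ht
  have := h x hx _ ((maps_Icc (inv_fix h0) (inv_fix h1)).2 ht)
  rw [RelIso.apply_inv_self] at this
  rw [map_inv]
  apply (cj x g).injective
  rw [RelIso.apply_inv_self, this]
theorem IsC.one {σ} : IsC σ 1 1 := fun x _ t _ => by rw [map_one]; simp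
theorem IsC.mul {σ f f' g g'} (h : IsC σ f g) (h' : IsC σ f' g') (h0 : f' 0 = 0) (h1 : f' 1 = 1) : IsC σ (f * f') (g * g') := by
  intro x hx t ht
  have m : f' (t + 1/2) ∈ Set.Icc (0:ℝ) 1 := (maps_Icc h0 h1).2 ⟨by linarith [ht.1], by linarith [ht.2]⟩
  rw [cj_mul_apply, h' x hx t ht, h x hx _ ⟨by linarith [m.1], by linarith [m.2]⟩]
  simp
theorem IsC.inv {σ f g} (h : IsC σ f g) (h0 : f 0 = 0) (h1 : f 1 = 1) : IsC σ f⁻¹ g⁻¹ := by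
  intro x hx t ht
  have m : f⁻¹ (t + 1/2) ∈ Set.Icc (0:ℝ) 1 := (maps_Icc (inv_fix h0) (inv_fix h1)).2 ⟨by linarith [ht.1], by linarith [ht.2]⟩
  have := h x hx (f⁻¹ (t + 1/2) - 1/2) ⟨by linarith [m.1], by linarith [m.2]⟩
  rw [sub_add_cancel, RelIso.apply_inv_self] at this
  rw [map_inv]
  apply (cj x g).injective
  rw [RelIso.apply_inv_self, this]; ring

theorem lsgn_inv (l : Letter) : lsgn l.inv = - lsgn l := by cases l <;> rfl

theorem aper_of {ρ : ℤ → Letter} (hρ : IsQuasiPeriodic ρ) (p : ℕ) (hp : 0 < p)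
    (h : ∀ i, lsgn (ρ (i + 2 * p)) = lsgn (ρ i)) : False := by
  obtain ⟨hl, -, h2⟩ := hρ
  have per : ∀ (m i : ℤ), lsgn (ρ (i + 2 * p * m)) = lsgn (ρ i) := by
    intro m
    induction m using Int.induction_on with
    | zero => intro i; simp
    | succ m ih => intro i; rw [← ih i, ← h (i + 2 * p * m)]; congr 2; ring
    | pred m ih => intro i; rw [← ih i, ← h (i + 2 * p * (-m - 1))]; congr 2; ring
  obtain ⟨k', hk'⟩ := h2 0 (2 * p)
  have hw := word_inv hk'
  have par := lab_even_inv hl (hw 0 (by omega))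
  simp only [CharP.cast_eq_zero, add_zero, sub_zero, zero_add] at par
  push_cast at par
  -- even index
  obtain ⟨q, hq⟩ : ∃ q, k' = 2 * q := ⟨k' / 2, by omega⟩
  set c2 : ℤ := q + p with hc2
  -- congruent index
  have hpp : (0:ℤ) < 2 * p := by omega
  have e1 := Int.emod_nonneg (c2 - k') hpp.ne'
  have e2 := Int.emod_lt_of_pos (c2 - k') hpp
  have e3 := Int.mul_ediv_add_emod (c2 - k') (2 * p)
  set r := (c2 - k') % (2 * p)
  set m := (c2 - k') / (2 * p)
  obtain ⟨i, hi⟩ : ∃ i : ℕ, (i:ℤ) = r := ⟨r.toNat, by omega⟩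
  have := congrArg lsgn (hw i (by omega))
  rw [lsgn_inv] at this
  have a1 : lsgn (ρ (k' + i)) = lsgn (ρ c2) := by
    rw [← per m (k' + i)]; congr 2; rw [hi]; linarith
  have a2 : lsgn (ρ (0 + (((2 * p : ℕ) : ℤ) - i))) = lsgn (ρ c2) := by
    rw [← per m c2]; congr 2; rw [hi]; push_cast; linarith
  rw [a1, a2] at this
  cases hh : ρ c2 <;> rw [hh] at this <;> simp [lsgn] at this

theorem setup_of {ρ : ℤ → Letter} (hρ : IsQuasiPeriodic ρ)
    {H : Subgroup (ℝ ≃o ℝ)} (hH : ∀ f : ℝ ≃o ℝ, f ∈ H ↔ InH f)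
    {ν₁ ν₂ ν₃ : ℝ ≃o ℝ} (hgen : Subgroup.closure {ν₁, ν₂, ν₃} = H)
    {ζ₁ ζ₂ ζ₃ χ₁ χ₂ χ₃ : ℝ ≃o ℝ}
    (hζ₁ : IsZeta ρ ν₁ ζ₁) (hζ₂ : IsZeta ρ ν₂ ζ₂) (hζ₃ : IsZeta ρ ν₃ ζ₃)
    (hχ₁ : IsChi ρ ν₁ χ₁) (hχ₂ : IsChi ρ ν₂ χ₂) (hχ₃ : IsChi ρ ν₃ χ₃)
    {G : Subgroup (ℝ ≃o ℝ)}
    (hG : G = Subgroup.closure {ζ₁, ζ₂, ζ₃, χ₁, χ₂, χ₃}) : Setup (fun i => lsgn (ρ i)) G := by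
  have hl := hρ.1
  have gG : ∀ g ∈ ({ζ₁, ζ₂, ζ₃, χ₁, χ₂, χ₃} : Set (ℝ ≃o ℝ)), g ∈ G := by
    intro g hg; rw [hG]; exact Subgroup.subset_closure hg
  have νH : ∀ f ∈ ({ν₁, ν₂, ν₃} : Set (ℝ ≃o ℝ)), InH f := by
    intro f hf; rw [← hH, ← hgen]; exact Subgroup.subset_closure hf
  refine ⟨fun i => ?_, fun f hf => ?_, fun f hf => ?_, ?_, ?_, ?_⟩
  · show lsgn (ρ i) = 1 ∨ lsgn (ρ i) = -1; cases ρ i <;> simp [lsgn]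
  · rw [← hH, ← hgen] at hf
    have key : ∀ f ∈ Subgroup.closure ({ν₁, ν₂, ν₃} : Set (ℝ ≃o ℝ)), (f 0 = 0 ∧ f 1 = 1) := by
      intro f hf; rw [hgen, hH] at hf; exact hf.fix
    induction hf using Subgroup.closure_induction with
    | mem f hf =>
      rcases hf with rfl | rfl | rfl
      · exact ⟨ζ₁, gG _ (by simp), IsZeta.isZ hl hζ₁⟩
      · exact ⟨ζ₂, gG _ (by simp), IsZeta.isZ hl hζ₂⟩
      · exact ⟨ζ₃, gG _ (by simp), IsZeta.isZ hl hζ₃⟩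
    | one => exact ⟨1, G.one_mem, IsZ.one⟩
    | mul f f' hf hf' h h' =>
      obtain ⟨g, hg, h⟩ := h
      obtain ⟨g', hg', h'⟩ := h'
      exact ⟨g * g', G.mul_mem hg hg', h.mul h' (key _ hf').1 (key _ hf').2⟩
    | inv f hf h =>
      obtain ⟨g, hg, h⟩ := h
      exact ⟨g⁻¹, G.inv_mem hg, h.inv (key _ hf).1 (key _ hf).2⟩
  · rw [← hH, ← hgen] at hf
    have key : ∀ f ∈ Subgroup.closure ({ν₁, ν₂, ν₃} : Set (ℝ ≃o ℝ)), (f 0 = 0 ∧ f 1 = 1) := by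
      intro f hf; rw [hgen, hH] at hf; exact hf.fix
    induction hf using Subgroup.closure_induction with
    | mem f hf =>
      rcases hf with rfl | rfl | rfl
      · exact ⟨χ₁, gG _ (by simp), IsChi.isC hl hχ₁⟩
      · exact ⟨χ₂, gG _ (by simp), IsChi.isC hl hχ₂⟩
      · exact ⟨χ₃, gG _ (by simp), IsChi.isC hl hχ₃⟩
    | one => exact ⟨1, G.one_mem, IsC.one⟩
    | mul f f' hf hf' h h' =>
      obtain ⟨g, hg, h⟩ := h
      obtain ⟨g', hg', h'⟩ := h'
      exact ⟨g * g', G.mul_mem hg hg', h.mul h' (key _ hf').1 (key _ hf').2⟩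
    | inv f hf h =>
      obtain ⟨g, hg, h⟩ := h
      exact ⟨g⁻¹, G.inv_mem hg, h.inv (key _ hf).1 (key _ hf).2⟩
  · conv_lhs => rw [hG]
    apply Subgroup.closure_mono
    intro g hg
    refine ⟨gG g hg, ?_⟩
    rcases hg with rfl | rfl | rfl | rfl | rfl | rfl
    · exact ⟨ν₁, νH _ (by simp), .inl (IsZeta.isZ hl hζ₁)⟩
    · exact ⟨ν₂, νH _ (by simp), .inl (IsZeta.isZ hl hζ₂)⟩
    · exact ⟨ν₃, νH _ (by simp), .inl (IsZeta.isZ hl hζ₃)⟩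
    · exact ⟨ν₁, νH _ (by simp), .inr (IsChi.isC hl hχ₁)⟩
    · exact ⟨ν₂, νH _ (by simp), .inr (IsChi.isC hl hχ₂)⟩
    · exact ⟨ν₃, νH _ (by simp), .inr (IsChi.isC hl hχ₃)⟩
  · intro R x0
    obtain ⟨N, hN⟩ := hρ.2.1 (2 * x0.n - R) (2 * R)
    refine ⟨N + R + 2, fun m => ?_⟩
    obtain ⟨o, ho, hw⟩ := word_inf (hN (2 * m) N (by omega))
    have par := lab_even hl (hw 0 (by omega))
    simp only [CharP.cast_eq_zero, add_zero] at par
    refine ⟨⟨(2 * m + o + R) / 2, x0.e⟩, fun i hi => ?_, ?_⟩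
    · simp only [V]
      congr 2
      have h2 : 2 * ((2 * m + o + R) / 2) = 2 * m + o + R := by omega
      have hi := abs_le.mp hi
      rcases x0.cases with h | h
      · have := hw (R + i).toNat (by omega)
        rw [h, h2]; push_cast
        convert this using 2 <;> omega
      · have := hw (R - i).toNat (by omega)
        rw [h, h2]; push_cast
        convert this using 2 <;> omega
    · simp only; rw [abs_le]; push_cast; omega
  · intro x y hxy
    have ne : ∀ m, lsgn (ρ m) ≠ - lsgn (ρ m) := by
      intro m; cases ρ m <;> simp [lsgn]
    have mixed : ∀ x y : Fr, (∀ i, V (fun i => lsgn (ρ i)) x i = V (fun i => lsgn (ρ i)) y i) → x.e = 1 → y.e = -1 → False := by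
      intro x y hxy hx hy
      have := hxy (y.n - x.n)
      simp only [V, hx, hy] at this
      push_cast at this
      rw [show 2 * x.n + 1 * (y.n - x.n) = x.n + y.n by ring, show 2 * y.n + -1 * (y.n - x.n) = x.n + y.n by ring] at this
      exact ne (x.n + y.n) (by linarith)
    have same : ∀ x y : Fr, (∀ i, V (fun i => lsgn (ρ i)) x i = V (fun i => lsgn (ρ i)) y i) → x.e = y.e → x.n < y.n → False := by
      intro x y hxy he hlt
      refine aper_of hρ (y.n - x.n).toNat (by omega) fun i => ?_
      have := hxy (y.e * (i - 2 * x.n))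
      simp only [V, he] at this
      rw [← mul_assoc, Int.units_coe_mul_self, one_mul] at this
      have := mul_left_cancel₀ (Units.ne_zero _) this
      rw [show 2 * x.n + (i - 2 * x.n) = i by ring] at this
      rw [this]; congr 2; omega
    rcases x.cases with hx | hx <;> rcases y.cases with hy | hy
    · rcases lt_trichotomy x.n y.n with h | h | h
      · exact (same x y hxy (hx.trans hy.symm) h).elim
      · ext; exact h; rw [hx, hy]
      · exact (same y x (fun i => (hxy i).symm) (hy.trans hx.symm) h).elim
    · exact (mixed x y hxy hx hy).elim
    · exact (mixed y x (fun i => (hxy i).symm) hy hx).elim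
    · rcases lt_trichotomy x.n y.n with h | h | h
      · exact (same x y hxy (hx.trans hy.symm) h).elim
      · ext; exact h; rw [hx, hy]
      · exact (same y x (fun i => (hxy i).symm) (hy.trans hx.symm) h).elim

end GR

namespace GR
open Set

def IsT (W : Set Fr) (u v : ℝ) (φ : Fr → (ℝ ≃o ℝ)) (g : ℝ ≃o ℝ) : Prop :=
  (∀ x ∈ W, ∀ t ∈ Ioo u v, cj x g t = φ x t) ∧ ∀ y, (∀ x ∈ W, ∀ t ∈ Ioo u v, y ≠ ph x t) → g y = y

open Classical in
noncomputable def ind (P : Set Fr) (f : ℝ ≃o ℝ) (x : Fr) : ℝ ≃o ℝ := if x ∈ P then f else 1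

theorem ind_mem {P : Set Fr} {f x} (h : x ∈ P) : ind P f x = f := by simp [ind, h]
theorem ind_not {P : Set Fr} {f x} (h : x ∉ P) : ind P f x = 1 := by simp [ind, h]
theorem ind_Fc {P : Set Fr} {f u v} (h : f ∈ Fc u v) (x) : ind P f x ∈ Fc u v := by
  unfold ind; split_ifs; exact h; exact one_mem _

theorem IsT.congr {W u v φ φ' g} (h : IsT W u v φ g) (hh : ∀ x ∈ W, φ x = φ' x) : IsT W u v φ' g :=
  ⟨fun x hx t ht => by rw [h.1 x hx t ht, hh x hx], h.2⟩

theorem IsT.one {W u v} : IsT W u v (fun _ => 1) 1 := ⟨fun x _ t _ => by rw [map_one], fun _ _ => rfl⟩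

theorem IsT.mul {W u v φ φ' g g'} (h : IsT W u v φ g) (h' : IsT W u v φ' g')
    (hF : ∀ x, φ' x ∈ Fc u v) : IsT W u v (fun x => φ x * φ' x) (g * g') := by
  refine ⟨fun x hx t ht => ?_, fun y hy => ?_⟩
  · rw [cj_mul_apply, h'.1 x hx t ht, h.1 x hx _ ((maps_Ioo (Fc_left (hF x)) (Fc_right (hF x))).2 ht)]; rfl
  · rw [RelIso.mul_apply, h'.2 y hy, h.2 y hy]

theorem IsT.inv {W u v φ g} (h : IsT W u v φ g) (hF : ∀ x, φ x ∈ Fc u v) :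
    IsT W u v (fun x => (φ x)⁻¹) g⁻¹ := by
  refine ⟨fun x hx t ht => ?_, fun y hy => inv_fix (h.2 y hy)⟩
  have := h.1 x hx _ ((maps_Ioo (inv_fix (Fc_left (hF x))) (inv_fix (Fc_right (hF x)))).2 ht)
  rw [RelIso.apply_inv_self] at this
  rw [map_inv]
  apply (cj x g).injective
  rw [RelIso.apply_inv_self, this]

theorem IsT.restr {W P : Set Fr} {u v f g} (h : IsT W u v (ind P f) g) (hP : P ⊆ W) :
    IsT P u v (fun _ => f) g := by
  refine ⟨fun x hx t ht => by rw [h.1 x (hP hx) t ht, ind_mem hx], fun y hy => ?_⟩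
  by_cases hh : ∀ x ∈ W, ∀ t ∈ Ioo u v, y ≠ ph x t
  · exact h.2 y hh
  · push Not at hh
    obtain ⟨x, hx, t, ht, rfl⟩ := hh
    have : x ∉ P := fun h' => hy x h' t ht rfl
    have h1 := h.1 x hx t ht
    rw [ind_not this, cj_eq] at h1
    exact h1

theorem IsT.narrow {P : Set Fr} {u v c d f g} (h : IsT P u v (fun _ => f) g) (hf : f ∈ Fc c d) (hu : u ≤ c) (hv : d ≤ v) :
    IsT P c d (fun _ => f) g := by
  refine ⟨fun x hx t ht => h.1 x hx t ⟨by linarith [ht.1], by linarith [ht.2]⟩, fun y hy => ?_⟩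
  by_cases hh : ∀ x ∈ P, ∀ t ∈ Ioo u v, y ≠ ph x t
  · exact h.2 y hh
  · push Not at hh
    obtain ⟨x, hx, t, ht, rfl⟩ := hh
    have h1 := h.1 x hx t ht
    rw [Fc_fix hf (fun h' => hy x hx t h' rfl), cj_eq] at h1
    exact h1

def Disj (W : Set Fr) (u v : ℝ) : Prop := ∀ x ∈ W, ∀ y ∈ W, ∀ s ∈ Ioo u v, ∀ t ∈ Ioo u v, ph x s = ph y t → x = y

theorem IsT.extend {P W : Set Fr} {u v c d f g} (h : IsT P c d (fun _ => f) g) (hf : f ∈ Fc c d) (hu : u ≤ c) (hv : d ≤ v)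
    (hP : P ⊆ W) (hD : Disj W u v) : IsT W u v (ind P f) g := by
  have sub : Ioo c d ⊆ Ioo u v := Ioo_subset_Ioo hu hv
  refine ⟨fun x hx t ht => ?_, fun y hy => h.2 y fun x hx t ht => hy x (hP hx) t (sub ht)⟩
  by_cases hxP : x ∈ P
  · rw [ind_mem hxP]
    by_cases htc : t ∈ Ioo c d
    · exact h.1 x hxP t htc
    · rw [Fc_fix hf htc, cj_eq]
      apply h.2
      intro x' hx' t' ht' e
      obtain rfl := hD x hx x' (hP hx') t ht t' (sub ht') e
      exact htc (ph_inj _ e ▸ ht')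
  · rw [ind_not hxP, cj_eq]
    apply h.2
    intro x' hx' t' ht' e
    obtain rfl := hD x hx x' (hP hx') t ht t' (sub ht') e
    exact hxP hx'

def Fit (δ : Fr) (u' v' u v : ℝ) : Prop :=
  (δ.e = 1 ∧ u = δ.n + u' ∧ v = δ.n + v') ∨ (δ.e = -1 ∧ u = δ.n - v' ∧ v = δ.n - u')

theorem Fit.mem {δ u' v' u v} (h : Fit δ u' v' u v) {t : ℝ} : ph δ t ∈ Ioo u v ↔ t ∈ Ioo u' v' := by
  rcases h with ⟨e, rfl, rfl⟩ | ⟨e, rfl, rfl⟩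
  · simp [ph, e]
  · simp only [ph, e, mem_Ioo]; push_cast
    constructor <;> rintro ⟨h1, h2⟩ <;> constructor <;> linarith

theorem Fc_cj {δ u' v' u v} (h : Fit δ u' v' u v) {f} (hf : f ∈ Fc u v) : cj δ f ∈ Fc u' v' := by
  obtain ⟨hD, a, b, ha, hb, h1, h2⟩ := hf
  refine ⟨hD.cj δ, ?_⟩
  rcases h with ⟨e, rfl, rfl⟩ | ⟨e, rfl, rfl⟩
  · refine ⟨a - δ.n, b - δ.n, by linarith, by linarith, fun t ht => ?_, fun t ht => ?_⟩
    · rw [cj_eq]; apply h1; simp [ph, e]; linarith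
    · rw [cj_eq]; apply h2; simp [ph, e]; linarith
  · refine ⟨δ.n - b, δ.n - a, by linarith, by linarith, fun t ht => ?_, fun t ht => ?_⟩
    · rw [cj_eq]; apply h2; simp [ph, e]; linarith
    · rw [cj_eq]; apply h1; simp [ph, e]; linarith

theorem Fit.inv {δ u' v' u v} (h : Fit δ u' v' u v) : Fit δ⁻¹ u v u' v' := by
  rcases h with ⟨e, rfl, rfl⟩ | ⟨e, rfl, rfl⟩
  · left; simp [e]
  · right; simp [e]

/-- right translate of a set of frames -/
def tr (P : Set Fr) (δ : Fr) : Set Fr := {y | y * δ⁻¹ ∈ P}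

theorem IsT.frame {P : Set Fr} {δ u' v' u v f g} (hδ : Fit δ u' v' u v) (h : IsT P u v (fun _ => f) g) :
    IsT (tr P δ) u' v' (fun _ => cj δ f) g := by
  refine ⟨fun y hy t ht => ?_, fun y hy => h.2 y fun x hx t ht e => ?_⟩
  · have := h.1 _ hy (ph δ t) (hδ.mem.2 ht)
    conv_lhs => rw [← inv_mul_cancel_right y δ]
    rw [cj_mul, cj_apply, this, cj_apply]
  · refine hy (x * δ) (by simpa [tr] using hx) (ph δ⁻¹ t) (hδ.mem.1 (by simpa using ht)) ?_
    rw [ph_mul]; simpa using e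

noncomputable def lo (i : ℤ) : ℝ := ((i:ℝ) - 1) / 2
noncomputable def hi (i : ℤ) : ℝ := ((i:ℝ) + 1) / 2
def gam (i : ℤ) : Fr := ⟨i, -1⟩
@[simp] theorem gam_inv (i : ℤ) : (gam i)⁻¹ = gam i := by ext <;> simp [gam]
theorem gam_mul (i : ℤ) : gam i * gam i = 1 := by ext <;> simp [gam]
theorem gam_fit (i : ℤ) : Fit (gam i) (lo i) (hi i) (lo i) (hi i) := by
  right; refine ⟨rfl, ?_, ?_⟩ <;> simp [gam, lo, hi] <;> ring
def VS (σ : ℤ → ℤ) (i s : ℤ) : Set Fr := {x | V σ x i = s}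

theorem disj_VS (σ : ℤ → ℤ) (hσ : ∀ i, σ i = 1 ∨ σ i = -1) (i s : ℤ) : Disj (VS σ i s) (lo i) (hi i) := by
  intro x hx y hy a ha b hb e
  have key : 2 * x.n + x.e * i = 2 * y.n + y.e * i := by
    have h1 : |(2 * x.n + x.e * i : ℝ) - (2 * y.n + y.e * i)| < 2 := by
      have a1 : |2 * ph x a - (2 * x.n + ((x.e:ℤ):ℝ) * i)| < 1 := by
        have : 2 * ph x a - (2 * x.n + ((x.e:ℤ):ℝ) * i) = ((x.e:ℤ):ℝ) * (2 * a - i) := by simp only [ph]; ring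
        rw [this, abs_mul]
        simp only [lo, hi, mem_Ioo] at ha
        have : |((x.e:ℤ):ℝ)| = 1 := by rcases x.cases with h | h <;> simp [h]
        rw [this, one_mul, abs_lt]; constructor <;> linarith
      have a2 : |2 * ph y b - (2 * y.n + ((y.e:ℤ):ℝ) * i)| < 1 := by
        have : 2 * ph y b - (2 * y.n + ((y.e:ℤ):ℝ) * i) = ((y.e:ℤ):ℝ) * (2 * b - i) := by simp only [ph]; ring
        rw [this, abs_mul]
        simp only [lo, hi, mem_Ioo] at hb
        have : |((y.e:ℤ):ℝ)| = 1 := by rcases y.cases with h | h <;> simp [h]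
        rw [this, one_mul, abs_lt]; constructor <;> linarith
      rw [e] at a1
      rw [abs_lt] at a1 a2 ⊢; constructor <;> linarith
    have h2 : |(2 * x.n + x.e * i) - (2 * y.n + y.e * i)| < 2 := by exact_mod_cast h1
    rw [abs_lt] at h2
    rcases x.cases with h | h <;> rcases y.cases with h' | h' <;> rw [h, h'] at h2 ⊢ <;> push_cast at h2 ⊢ <;> omega
  have he : x.e = y.e := by
    have hxy : V σ x i = V σ y i := Eq.trans hx (Eq.symm hy)
    simp only [V, key] at hxy
    have : σ (2 * y.n + y.e * i) ≠ 0 := by rcases hσ (2 * y.n + y.e * i) with h | h <;> rw [h] <;> norm_num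
    exact Units.ext (mul_right_cancel₀ this hxy)
  rw [he] at key
  ext
  · omega
  · exact congrArg _ he

theorem disj_cell : Disj univ 0 (1/2) := by
  intro x _ y _ a ha b hb e
  have h0 := ha.1; have h1 := ha.2; have h2 := hb.1; have h3 := hb.2
  rcases x.cases with h | h <;> rcases y.cases with h' | h' <;> simp only [ph, h, h'] at e <;> push_cast at e
  · have : |x.n - y.n| < 1 := by
      have : |((x.n - y.n : ℤ):ℝ)| < 1 := by rw [abs_lt]; push_cast; constructor <;> linarith
      exact_mod_cast this
    rw [Int.abs_lt_one_iff] at this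
    ext; omega; rw [h, h']
  · exfalso
    have A : ((x.n - y.n : ℤ):ℝ) < 0 := by push_cast; linarith
    have B : ((-1:ℤ):ℝ) < ((x.n - y.n : ℤ):ℝ) := by push_cast; linarith
    have A := Int.cast_lt_zero.1 A; have B := Int.cast_lt.1 B; omega
  · exfalso
    have A : ((y.n - x.n : ℤ):ℝ) < 0 := by push_cast; linarith
    have B : ((-1:ℤ):ℝ) < ((y.n - x.n : ℤ):ℝ) := by push_cast; linarith
    have A := Int.cast_lt_zero.1 A; have B := Int.cast_lt.1 B; omega
  · have : |x.n - y.n| < 1 := by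
      have : |((x.n - y.n : ℤ):ℝ)| < 1 := by rw [abs_lt]; push_cast; constructor <;> linarith
      exact_mod_cast this
    rw [Int.abs_lt_one_iff] at this
    ext; omega; rw [h, h']

end GR

namespace GR
open Set

/-- every `f` supported in the interval is realised on the set `P` -/
def SS (G : Subgroup (ℝ ≃o ℝ)) (P : Set Fr) (u v : ℝ) : Prop := ∀ f ∈ Fc u v, ∃ g ∈ G, IsT P u v (fun _ => f) g

theorem SS.frame {G : Subgroup (ℝ ≃o ℝ)} {P : Set Fr} {δ u' v' u v} (hδ : Fit δ u' v' u v) (h : SS G P u v) :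
    SS G (tr P δ) u' v' := by
  intro f hf
  obtain ⟨g, hg, h⟩ := h (cj δ⁻¹ f) (Fc_cj hδ.inv hf)
  refine ⟨g, hg, ?_⟩
  have := h.frame hδ
  rwa [← cj_mul, inv_mul_cancel, cj_one] at this

theorem SS.narrow {G : Subgroup (ℝ ≃o ℝ)} {P : Set Fr} {c d u v} (h : SS G P u v) (hu : u ≤ c) (hv : d ≤ v) :
    SS G P c d := by
  intro f hf
  obtain ⟨g, hg, h⟩ := h f (Fc_mono hu hv hf)
  exact ⟨g, hg, h.narrow hf hu hv⟩

theorem tr_VS_gam (σ i j s) : tr (VS σ i s) (gam j) = VS σ (2 * j - i) (-s) := by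
  ext y; simp only [tr, VS, mem_ofPred_eq, gam_inv, V_mul]
  simp only [gam]; push_cast
  rw [neg_one_mul, neg_eq_iff_eq_neg, neg_one_mul, sub_eq_add_neg]

section
variable {σ : ℤ → ℤ} {G : Subgroup (ℝ ≃o ℝ)}

theorem base1 (S : Setup σ G) : SS G (VS σ 1 1) (lo 1) (hi 1) := by
  have e0 : lo 1 = 0 := by norm_num [lo]
  have e1 : hi 1 = 1 := by norm_num [hi]
  rw [e0, e1]
  intro f hf
  obtain ⟨g, hg, h⟩ := S.zeta f (InH_of_Fc hf)
  refine ⟨g, hg, fun x hx t ht => h x hx t ⟨ht.1.le, ht.2.le⟩, fun y hy => ?_⟩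
  have : ∃ x, V σ x 1 = 1 ∧ ∃ t ∈ Icc (0:ℝ) 1, y = ph x t := by
    have f1 := Int.floor_le y
    have f2 := (Int.lt_floor_add_one y).le
    rcases S.sgn (2 * ⌊y⌋ + 1) with h | h
    · exact ⟨⟨⌊y⌋, 1⟩, by simp [V, h], y - ⌊y⌋, ⟨by linarith, by linarith⟩, by simp [ph]⟩
    · refine ⟨⟨⌊y⌋ + 1, -1⟩, ?_, ⌊y⌋ + 1 - y, ⟨by linarith, by linarith⟩, by simp [ph]⟩
      simp only [V]; push_cast; rw [show 2 * (⌊y⌋ + 1) + -1 = 2 * ⌊y⌋ + 1 by ring, h]; norm_num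
  obtain ⟨x, hx, t, ht, rfl⟩ := this
  have h1 := h x hx t ht
  rw [Fc_fix hf (fun h' => hy x hx t h' rfl), cj_eq] at h1
  exact h1

theorem base0 (S : Setup σ G) : SS G (VS σ 0 1) (lo 0) (hi 0) := by
  have e0 : lo 0 = -1/2 := by norm_num [lo]
  have e1 : hi 0 = 1/2 := by norm_num [hi]
  rw [e0, e1]
  intro f hf
  have hf0 : trl (1/2) * f * (trl (1/2))⁻¹ ∈ Fc 0 1 := by
    obtain ⟨hD, a, b, ha, hb, h1, h2⟩ := hf
    have hT : InD (trl (1/2)) := by simpa using trl_mem 1 1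
    refine ⟨(hT.mul hD).mul hT.inv, a + 1/2, b + 1/2, by linarith, by linarith, fun t ht => ?_, fun t ht => ?_⟩
    · simp only [RelIso.mul_apply, trl_inv_apply, trl_apply]; rw [h1 _ (by linarith)]; ring
    · simp only [RelIso.mul_apply, trl_inv_apply, trl_apply]; rw [h2 _ (by linarith)]; ring
  obtain ⟨g, hg, h⟩ := S.chi _ (InH_of_Fc hf0)
  have h : ∀ x, V σ x 0 = 1 → ∀ t ∈ Set.Icc (-1/2:ℝ) (1/2), cj x g t = f t := by
    intro x hx t ht
    rw [h x hx t ht]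
    simp only [RelIso.mul_apply, trl_inv_apply, trl_apply]; simp
  refine ⟨g, hg, fun x hx t ht => h x hx t ⟨ht.1.le, ht.2.le⟩, fun y hy => ?_⟩
  have : ∃ x, V σ x 0 = 1 ∧ ∃ t ∈ Icc (-1/2:ℝ) (1/2), y = ph x t := by
    have f1 := Int.floor_le (y + 1/2)
    have f2 := (Int.lt_floor_add_one (y + 1/2)).le
    rcases S.sgn (2 * ⌊y + 1/2⌋) with h | h
    · exact ⟨⟨⌊y + 1/2⌋, 1⟩, by simpa [V] using h, y - ⌊y + 1/2⌋, ⟨by linarith, by linarith⟩, by simp [ph]⟩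
    · refine ⟨⟨⌊y + 1/2⌋, -1⟩, ?_, ⌊y + 1/2⌋ - y, ⟨by linarith, by linarith⟩, by simp [ph]⟩
      simp only [V]; push_cast; rw [add_zero, h]; norm_num
  obtain ⟨x, hx, t, ht, rfl⟩ := this
  have h1 := h x hx t ht
  rw [Fc_fix hf (fun h' => hy x hx t h' rfl), cj_eq] at h1
  exact h1

theorem base_neg {i : ℤ} (h : SS G (VS σ i 1) (lo i) (hi i)) : SS G (VS σ i (-1)) (lo i) (hi i) := by
  have := h.frame (gam_fit i)
  rw [tr_VS_gam] at this
  rwa [show 2 * i - i = i by ring] at this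

theorem base01 (S : Setup σ G) {i : ℤ} (h : i = 0 ∨ i = 1) {s : ℤ} (hs : s = 1 ∨ s = -1) :
    SS G (VS σ i s) (lo i) (hi i) := by
  rcases h with rfl | rfl <;> rcases hs with rfl | rfl
  · exact base0 S
  · exact base_neg (base0 S)
  · exact base1 S
  · exact base_neg (base1 S)

/-- sets of frames whose cells are controlled -/
def PP (G : Subgroup (ℝ ≃o ℝ)) (P : Set Fr) : Prop := SS G P 0 (1/2)

theorem PP.get {P : Set Fr} (h : PP G P) {f} (hf : f ∈ Fc 0 (1/2)) : ∃ g ∈ G, IsT univ 0 (1/2) (ind P f) g := by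
  obtain ⟨g, hg, h⟩ := h f hf
  exact ⟨g, hg, h.extend hf le_rfl le_rfl (subset_univ _) disj_cell⟩

theorem PP.union {P Q : Set Fr} (h : PP G P) (h' : PP G Q) (hd : Disjoint P Q) : PP G (P ∪ Q) := by
  intro f hf
  obtain ⟨g, hg, h⟩ := h.get hf
  obtain ⟨g', hg', h'⟩ := h'.get hf
  refine ⟨g * g', G.mul_mem hg hg', IsT.restr (W := univ) ?_ (subset_univ _)⟩
  refine (h.mul h' (ind_Fc hf)).congr fun x _ => ?_
  have := Set.disjoint_left.1 hd
  by_cases h1 : x ∈ P <;> by_cases h2 : x ∈ Q <;> simp [ind, h1, h2]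
  exact (this h1 h2).elim

theorem PP.diff {P Q : Set Fr} (h : PP G P) (h' : PP G Q) (hd : Q ⊆ P) : PP G (P \ Q) := by
  intro f hf
  obtain ⟨g, hg, h⟩ := h.get hf
  obtain ⟨g', hg', h'⟩ := h'.get hf
  refine ⟨g * g'⁻¹, G.mul_mem hg (G.inv_mem hg'), IsT.restr (W := univ) ?_ (subset_univ _)⟩
  refine (h.mul (h'.inv (ind_Fc hf)) (fun x => inv_mem (ind_Fc hf x))).congr fun x _ => ?_
  by_cases h1 : x ∈ P <;> by_cases h2 : x ∈ Q <;> simp [ind, h1, h2]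
  exact absurd (hd h2) h1

open scoped commutatorElement in
theorem PP.inter {P Q : Set Fr} (h : PP G P) (h' : PP G Q) : PP G (P ∩ Q) := by
  intro f hf
  have hf' := Fc_perfect _ _ hf
  rw [Subgroup.commutator_def] at hf'
  suffices H : f ∈ Fc 0 (1/2) ∧ ∃ g ∈ G, IsT univ 0 (1/2) (ind (P ∩ Q) f) g by
    obtain ⟨-, g, hg, H⟩ := H; exact ⟨g, hg, H.restr (subset_univ _)⟩
  clear hf
  induction hf' using Subgroup.closure_induction with
  | mem f hf =>
    obtain ⟨a, ha, b, hb, rfl⟩ := hf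
    refine ⟨mul_mem (mul_mem (mul_mem ha hb) (inv_mem ha)) (inv_mem hb), ?_⟩
    obtain ⟨g, hg, h⟩ := h.get ha
    obtain ⟨g', hg', h'⟩ := h'.get hb
    refine ⟨⁅g, g'⁆, mul_mem (mul_mem (mul_mem hg hg') (inv_mem hg)) (inv_mem hg'), ?_⟩
    have := ((h.mul h' (ind_Fc hb)).mul (h.inv (ind_Fc ha)) (fun x => inv_mem (ind_Fc ha x))).mul 
      (h'.inv (ind_Fc hb)) (fun x => inv_mem (ind_Fc hb x))
    refine this.congr fun x _ => ?_
    by_cases h1 : x ∈ P <;> by_cases h2 : x ∈ Q <;> simp [ind, h1, h2, commutatorElement_def]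
  | one => exact ⟨one_mem _, 1, G.one_mem, IsT.one.congr fun x _ => by simp [ind]⟩
  | mul a b _ _ h h' =>
    obtain ⟨ha, g, hg, h⟩ := h
    obtain ⟨hb, g', hg', h'⟩ := h'
    refine ⟨mul_mem ha hb, g * g', mul_mem hg hg', (h.mul h' (ind_Fc hb)).congr fun x _ => ?_⟩
    simp only [ind]; split_ifs <;> simp
  | inv a _ h =>
    obtain ⟨ha, g, hg, h⟩ := h
    refine ⟨inv_mem ha, g⁻¹, inv_mem hg, (h.inv (ind_Fc ha)).congr fun x _ => ?_⟩
    simp only [ind]; split_ifs <;> simp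

theorem lo_le {i : ℤ} (h : i = 0 ∨ i = 1) : lo i ≤ 0 := by rcases h with rfl | rfl <;> norm_num [lo]
theorem le_hi {i : ℤ} (h : i = 0 ∨ i = 1) : 1/2 ≤ hi i := by rcases h with rfl | rfl <;> norm_num [hi]

theorem PP_VS01 (S : Setup σ G) {i : ℤ} (h : i = 0 ∨ i = 1) {s : ℤ} (hs : s = 1 ∨ s = -1) : PP G (VS σ i s) :=
  (base01 S h hs).narrow (lo_le h) (le_hi h)

theorem VS_cup (S : Setup σ G) (i : ℤ) (P : Set Fr) : P = (P ∩ VS σ i 1) ∪ (P ∩ VS σ i (-1)) := by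
  ext x
  have : V σ x i = 1 ∨ V σ x i = -1 := by
    unfold V
    rcases x.cases with h | h <;> rcases S.sgn (2 * x.n + x.e * i) with h' | h' <;> rw [h'] <;> simp [h]
  simp only [mem_union, mem_inter_iff, VS, mem_ofPred_eq]; tauto

theorem VS_disj (i : ℤ) (P Q : Set Fr) : Disjoint (P ∩ VS σ i 1) (Q ∩ VS σ i (-1)) := by
  rw [Set.disjoint_left]; rintro x ⟨-, h⟩ ⟨-, h'⟩
  have h : V σ x i = 1 := h
  have h' : V σ x i = -1 := h'
  omega

theorem PP_univ (S : Setup σ G) : PP G univ := by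
  have := (PP_VS01 S (.inl rfl) (.inl rfl)).union (PP_VS01 S (.inl rfl) (.inr rfl)) 
    (by simpa using VS_disj (σ := σ) 0 univ univ)
  have h := VS_cup S 0 univ
  simp only [univ_inter] at h
  rwa [← h] at this

/-- local form on unit intervals -/
theorem PP.unit (S : Setup σ G) {i : ℤ} (h : i = 0 ∨ i = 1) {s : ℤ} (hs : s = 1 ∨ s = -1) {Q : Set Fr} (hQ : PP G Q)
    (hQs : Q ⊆ VS σ i s) : SS G Q (lo i) (hi i) := by
  intro f hf
  obtain ⟨k, hk, hkf, -, -⟩ := push_conj (LM_Fc (lo i) (hi i)) (fun f hf => hf.1) (lo_le h) (by norm_num : (0:ℝ) < 1/2) (le_hi h) hf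
  obtain ⟨g, hg, H⟩ := hQ _ hkf
  obtain ⟨g', hg', H'⟩ := base01 S h hs k hk
  have hkf' := Fc_mono (lo_le h) (le_hi h) hkf
  have H1 := H.extend hkf (lo_le h) (le_hi h) hQs (disj_VS σ S.sgn i s)
  have := ((H'.inv (fun _ => hk)).mul H1 (ind_Fc hkf')).mul H' (fun _ => hk)
  refine ⟨_, mul_mem (mul_mem (inv_mem hg') hg) hg', IsT.restr (this.congr fun x hx => ?_) hQs⟩
  unfold ind
  split_ifs <;> group

theorem PP.gam' (S : Setup σ G) {i : ℤ} (h : i = 0 ∨ i = 1) {s : ℤ} (hs : s = 1 ∨ s = -1) {Q : Set Fr} (hQ : PP G Q)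
    (hQs : Q ⊆ VS σ i s) : PP G (tr Q (gam i)) :=
  ((hQ.unit S h hs hQs).frame (gam_fit i)).narrow (lo_le h) (le_hi h)

theorem PP.gam (S : Setup σ G) {i : ℤ} (h : i = 0 ∨ i = 1) {Q : Set Fr} (hQ : PP G Q) : PP G (tr Q (gam i)) := by
  have h1 := PP.gam' S h (.inl rfl) (hQ.inter (PP_VS01 S h (.inl rfl))) inter_subset_right
  have h2 := PP.gam' S h (.inr rfl) (hQ.inter (PP_VS01 S h (.inr rfl))) inter_subset_right
  have := h1.union h2 (by
    have := VS_disj (σ := σ) i Q Q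
    rw [Set.disjoint_left] at this ⊢
    exact fun x hx => this hx)
  have e := VS_cup S i Q
  conv => enter [2, 1]; rw [e]
  exact this

theorem PP_VS (S : Setup σ G) (i : ℤ) {s : ℤ} (hs : s = 1 ∨ s = -1) : PP G (VS σ i s) := by
  have up : ∀ i s, PP G (VS σ i s) → PP G (VS σ (i + 2) s) := by
    intro i s h
    have := (h.gam S (.inl rfl)).gam S (.inr rfl)
    rw [tr_VS_gam, tr_VS_gam, neg_neg] at this
    rwa [show 2 * 1 - (2 * 0 - i) = i + 2 by ring] at this
  have dn : ∀ i s, PP G (VS σ i s) → PP G (VS σ (i - 2) s) := by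
    intro i s h
    have := (h.gam S (.inr rfl)).gam S (.inl rfl)
    rw [tr_VS_gam, tr_VS_gam, neg_neg] at this
    rwa [show 2 * 0 - (2 * 1 - i) = i - 2 by ring] at this
  have all : ∀ m : ℤ, ∀ j, PP G (VS σ j s) → PP G (VS σ (j + 2 * m) s) := by
    intro m j hj
    induction m using Int.induction_on with
    | zero => simpa using hj
    | succ m ih => have := up _ _ ih; rwa [show j + 2 * (m:ℤ) + 2 = j + 2 * (m + 1) by ring] at this
    | pred m ih => have := dn _ _ ih; rwa [show j + 2 * (-m:ℤ) - 2 = j + 2 * (-m - 1) by ring] at this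
  have h := all (i / 2) (i % 2) (PP_VS01 S (Int.emod_two_eq_zero_or_one i) hs)
  rwa [Int.emod_add_mul_ediv] at h

theorem PP_fin (S : Setup σ G) (F : Finset ℤ) : ∀ P : Set Fr, (∀ x y, (∀ i ∈ F, V σ x i = V σ y i) → x ∈ P → y ∈ P) → PP G P := by
  induction F using Finset.induction_on with
  | empty =>
    intro P hP
    rcases P.eq_empty_or_nonempty with rfl | ⟨x, hx⟩
    · have := (PP_univ S).diff (PP_univ S) subset_rfl
      rwa [sdiff_self] at this
    · rw [show P = univ from eq_univ_of_forall fun y => hP x y (by simp) hx]; exact PP_univ S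
  | insert i F hi ih =>
    intro P hP
    have key : ∀ s, (s = 1 ∨ s = -1) → PP G (P ∩ VS σ i s) := by
      intro s hs
      have h1 := ih {x | ∃ y ∈ P, V σ y i = s ∧ ∀ j ∈ F, V σ x j = V σ y j} (by
        rintro x x' hxx ⟨y, hy, hys, h⟩
        exact ⟨y, hy, hys, fun j hj => (hxx j hj).symm.trans (h j hj)⟩)
      convert h1.inter (PP_VS S i hs) using 1
      ext x
      constructor
      · rintro ⟨h, h'⟩; exact ⟨⟨x, h, h', fun _ _ => rfl⟩, h'⟩
      · rintro ⟨⟨y, hy, hys, h⟩, h'⟩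
        refine ⟨hP y x ?_ hy, h'⟩
        intro j hj
        rcases Finset.mem_insert.1 hj with rfl | hj
        · exact hys.trans (Eq.symm h')
        · exact (h j hj).symm
    rw [VS_cup S i P]
    exact (key 1 (.inl rfl)).union (key (-1) (.inr rfl)) (VS_disj i P P)

def Clopen (σ : ℤ → ℤ) (P : Set Fr) : Prop := ∃ R : ℕ, ∀ x y, agree σ R x y → x ∈ P → y ∈ P

theorem Clopen.PP (S : Setup σ G) {P} (h : Clopen σ P) : PP G P := by
  obtain ⟨R, h⟩ := h
  refine PP_fin S (Finset.Icc (-R) R) P fun x y hxy => h x y fun i hi => hxy i ?_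
  rw [abs_le] at hi; simp [hi.1, hi.2]

theorem Clopen.tr {P} (h : Clopen σ P) (δ : Fr) : Clopen σ (tr P δ) := by
  obtain ⟨R, h⟩ := h
  exact ⟨R + 2 * δ⁻¹.n.natAbs, fun x y hxy hx => h (x * δ⁻¹) _ (hxy.mul _) hx⟩

theorem Clopen.inter {P Q} (h : Clopen σ P) (h' : Clopen σ Q) : Clopen σ (P ∩ Q) := by
  obtain ⟨R, h⟩ := h
  obtain ⟨R', h'⟩ := h'
  exact ⟨max R R', fun x y hxy hx => ⟨h x y (hxy.mono (by omega)) hx.1, h' x y (hxy.mono (by omega)) hx.2⟩⟩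

theorem clopen_VS (i s : ℤ) : Clopen σ (VS σ i s) := 
  ⟨i.natAbs, fun x y h hx => by have := h i (by simp); rw [VS, mem_ofPred_eq, ← this]; exact hx⟩

theorem Clopen.unit (S : Setup σ G) (i : ℤ) {s : ℤ} (hs : s = 1 ∨ s = -1) {Q : Set Fr} (hQ : Clopen σ Q)
    (hQs : Q ⊆ VS σ i s) : SS G Q (lo i) (hi i) := by
  set δ : Fr := ⟨i / 2, 1⟩
  have hm := Int.emod_two_eq_zero_or_one i
  have he := Int.emod_add_mul_ediv i 2
  have h1 := (((hQ.tr δ).PP S).unit S hm hs (by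
    intro x hx
    have := hQs hx
    simp only [VS, mem_ofPred_eq, V_mul] at this ⊢
    simp only [δ, Fr.inv_n, Fr.inv_e] at this
    rw [← this]; push_cast; rw [one_mul]; congr 1; linarith)).frame (δ := δ⁻¹) (u' := lo i) (v' := hi i) (by
      have : (i:ℝ) = (i % 2 : ℤ) + 2 * (i / 2 : ℤ) := by exact_mod_cast he.symm
      left; refine ⟨rfl, ?_, ?_⟩ <;> simp [δ, lo, hi] <;> linarith)
  have e : GR.tr (GR.tr Q δ) δ⁻¹ = Q := by
    ext x
    show x * δ⁻¹⁻¹ * δ⁻¹ ∈ Q ↔ _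
    simp
  rwa [e] at h1

theorem thmD (S : Setup σ G) {Q : Set Fr} (hQ : Clopen σ Q) {u v : ℝ} (huv : u < v) (hD : Disj Q u v) : SS G Q u v := by
  let M : Subgroup (ℝ ≃o ℝ) :=
    { carrier := {h | h ∈ Fc u v ∧ ∃ k ∈ G, IsT Q u v (fun _ => h) k}
      one_mem' := ⟨one_mem _, 1, one_mem _, IsT.one⟩
      mul_mem' := by
        rintro a b ⟨ha, k, hk, h⟩ ⟨hb, k', hk', h'⟩
        exact ⟨mul_mem ha hb, k * k', mul_mem hk hk', h.mul h' fun _ => hb⟩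
      inv_mem' := by
        rintro a ⟨ha, k, hk, h⟩
        exact ⟨inv_mem ha, k⁻¹, inv_mem hk, h.inv fun _ => ha⟩ }
  have key : ∀ (i : ℤ) (c d : ℝ), u ≤ c → lo i ≤ c → d ≤ v → d ≤ hi i → ∀ h ∈ Fc c d, h ∈ M := by
    intro i c d huc hic hdv hdi h hh
    have hh' := Fc_mono huc hdv hh
    refine ⟨hh', ?_⟩
    have A : ∀ s, (s = 1 ∨ s = -1) → ∃ g ∈ G, IsT Q u v (ind (Q ∩ VS σ i s) h) g := by
      intro s hs
      obtain ⟨g, hg, H⟩ := ((hQ.inter (clopen_VS i s)).unit S i hs inter_subset_right).narrow hic hdi h hh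
      exact ⟨g, hg, H.extend hh huc hdv inter_subset_left hD⟩
    obtain ⟨g, hg, H⟩ := A 1 (.inl rfl)
    obtain ⟨g', hg', H'⟩ := A (-1) (.inr rfl)
    refine ⟨g * g', mul_mem hg hg', (H.mul H' (ind_Fc hh')).congr fun x hx => ?_⟩
    have h1 := VS_cup S i Q
    have h2 := fun hx => Set.disjoint_left.1 (VS_disj (σ := σ) i Q Q) (show x ∈ _ from hx)
    rw [h1] at hx
    rcases hx with hx | hx
    · rw [ind_mem hx, ind_not (h2 hx), mul_one]
    · rw [ind_mem hx, ind_not (fun h => h2 h hx), one_mul]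
  have near : ∀ y : ℝ, ∃ i : ℤ, lo i < y ∧ y < hi i := by
    intro y
    have f1 := Int.floor_le (2 * y)
    have f2 := (Int.lt_floor_add_one (2 * y))
    exact ⟨⌊2 * y⌋, by simp only [lo]; linarith, by simp only [hi]; linarith⟩
  have hLM : LM M u v := by
    intro y hy ε hε
    obtain ⟨i, h1, h2⟩ := near y
    obtain ⟨g, hg, hgy⟩ := bump_Fc (u := max u (lo i)) (v := min v (hi i)) (y := y) 
      ⟨max_lt hy.1 h1, lt_min hy.2 h2⟩ ε hε
    exact ⟨g, key i _ _ (le_max_left _ _) (le_max_right _ _) (min_le_left _ _) (min_le_right _ _) g hg, hgy⟩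
  intro f hf
  obtain ⟨i, h1, h2⟩ := near ((u + v) / 2)
  have hm1 : max u (lo i) < (u + v) / 2 := max_lt (by linarith) h1
  have hm2 : (u + v) / 2 < min v (hi i) := lt_min (by linarith) h2
  obtain ⟨k, hk, hkf, -, -⟩ := push_conj hLM (fun f hf => hf.1.1) (le_max_left u (lo i)) (hm1.trans hm2) (min_le_left _ _) hf
  have := key i _ _ (le_max_left _ _) (le_max_right _ _) (min_le_left _ _) (min_le_right _ _) _ hkf
  have : f ∈ M := by
    have h := M.mul_mem (M.mul_mem (M.inv_mem hk) this) hk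
    convert h using 1; group
  exact this.2
end
end GR

namespace GR
open Set

def InDc (K N0 : ℕ) (f : ℝ ≃o ℝ) : Prop :=
  ∀ N : ℕ, N0 ≤ N → ∀ j : ℤ, ∃ (n : ℕ) (c : ℤ), N ≤ n + K ∧ n ≤ N + K ∧
    ∀ s ∈ Set.Icc (0:ℝ) 1, f ((j + s) / 2 ^ N) = (c + s) / 2 ^ n

theorem InDc.cj {K N0 : ℕ} {g : ℝ ≃o ℝ} (hD : InDc K N0 g) (x : Fr) : InDc K N0 (cj x g) := by
  intro N hN j
  rcases x.cases with h | h
  · obtain ⟨n, c, h1, h2, h3⟩ := hD N (by omega) (j + x.n * 2 ^ N)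
    refine ⟨n, c - x.n * 2 ^ n, h1, h2, fun s hs => ?_⟩
    rw [cj_eq]
    have := h3 s hs
    simp only [ph, h]
    push_cast at this ⊢
    convert this using 1
    · congr 1; field_simp; ring
    · field_simp; ring
  · obtain ⟨n, c, h1, h2, h3⟩ := hD N (by omega) (x.n * 2 ^ N - j - 1)
    refine ⟨n, x.n * 2 ^ n - c - 1, h1, h2, fun s hs => ?_⟩
    rw [cj_eq]
    have := h3 (1 - s) ⟨by linarith [hs.2], by linarith [hs.1]⟩
    simp only [ph, h]
    push_cast at this ⊢
    convert this using 1
    · congr 1; field_simp; ring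
    · field_simp; ring

theorem InD_local {g : ℝ ≃o ℝ} (K N0 N1 : ℕ) (h : ∀ N, N1 ≤ N → ∀ j : ℤ, ∃ f, InDc K N0 f ∧
    ∀ t ∈ Icc ((j:ℝ) / 2 ^ N) ((j + 1) / 2 ^ N), g t = f t) : InD g := by
  refine ⟨K, max N0 N1, fun N hN j => ?_⟩
  obtain ⟨f, hf, hgf⟩ := h N (by omega) j
  obtain ⟨n, c, h1, h2, h3⟩ := hf N (by omega) j
  refine ⟨n, c, h1, h2, fun s hs => ?_⟩
  rw [hgf _ ⟨?_, ?_⟩, h3 s hs]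
  · gcongr; linarith [hs.1]
  · gcongr; exact hs.2

section
variable {σ : ℤ → ℤ} {G : Subgroup (ℝ ≃o ℝ)}

theorem exists_fr (S : Setup σ G) (i m : ℤ) : ∃ x ∈ VS σ i 1, ∀ y ∈ Icc (m + lo i) (m + hi i), 
    ph x⁻¹ y ∈ Icc (lo i) (hi i) := by
  rcases S.sgn (2 * m + i) with h | h
  · refine ⟨⟨m, 1⟩, by simp [VS, V, h], fun y hy => ?_⟩
    simp [ph]; exact ⟨by linarith [hy.1], by linarith [hy.2]⟩
  · refine ⟨⟨m + i, -1⟩, ?_, fun y hy => ?_⟩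
    · show V σ _ _ = 1
      simp only [V]; push_cast; rw [show 2 * (m + i) + -1 * i = 2 * m + i by ring, h]; norm_num
    · have h1 := hy.1; have h2 := hy.2
      simp only [lo, hi] at h1 h2
      simp [ph, lo, hi]; exact ⟨by linarith, by linarith⟩

def IsU (σ : ℤ → ℤ) (i : ℤ) (f g : ℝ ≃o ℝ) : Prop := ∀ x ∈ VS σ i 1, ∀ t ∈ Icc (lo i) (hi i), cj x g t = f t

theorem IsU.inD (S : Setup σ G) {i : ℤ} {f g : ℝ ≃o ℝ} (h : IsU σ i f g) (hf : InD f) : InD g := by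
  obtain ⟨K, N0, hD⟩ := hf
  refine InD_local K N0 1 fun N hN j => ?_
  obtain ⟨N', rfl⟩ : ∃ N', N = N' + 1 := ⟨N - 1, by omega⟩
  set m := (j - (i - 1) * 2 ^ N') / 2 ^ (N' + 1) with hm
  obtain ⟨x, hx, hxy⟩ := exists_fr S i m
  refine ⟨cj x⁻¹ f, InDc.cj hD _, fun t ht => ?_⟩
  have p0 : (0:ℤ) < 2 ^ (N' + 1) := by positivity
  have m1 : m * 2 ^ (N' + 1) ≤ j - (i - 1) * 2 ^ N' := Int.ediv_mul_le _ p0.ne'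
  have m2 : j - (i - 1) * 2 ^ N' < (m + 1) * 2 ^ (N' + 1) := Int.lt_ediv_add_one_mul_self _ p0
  have m2 : j - (i - 1) * 2 ^ N' + 1 ≤ (m + 1) * 2 ^ (N' + 1) := m2
  have p : (0:ℝ) < 2 ^ (N' + 1) := by positivity
  have m1' : (m:ℝ) * 2 ^ (N' + 1) ≤ j - (i - 1) * 2 ^ N' := by exact_mod_cast m1
  have m2' : (j:ℝ) - (i - 1) * 2 ^ N' + 1 ≤ (m + 1) * 2 ^ (N' + 1) := by exact_mod_cast m2
  have := h x hx (ph x⁻¹ t) (hxy t ⟨?_, ?_⟩)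
  · rw [cj_eq, ph_ph_inv] at this
    rw [this, cj_apply, inv_inv]
  · refine le_trans ?_ ht.1
    rw [le_div_iff₀ p, lo]
    rw [pow_succ] at m1' ⊢; linarith
  · refine ht.2.trans ?_
    rw [div_le_iff₀ p, hi]
    rw [pow_succ] at m2' ⊢; linarith

structure HU (i : ℤ) (f : ℝ ≃o ℝ) : Prop where
  inD : InD f
  lo : f (lo i) = lo i
  hi : f (hi i) = hi i
  germ : ∃ (k : ℤ) (ε : ℝ), 0 < ε ∧ (∀ t ∈ Icc (GR.lo i) (GR.lo i + ε), f t = GR.lo i + 2 ^ k * (t - GR.lo i)) ∧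
    (∀ t ∈ Icc (GR.hi i - ε) (GR.hi i), f t = GR.hi i + 2 ^ k * (t - GR.hi i))

theorem gen_U (S : Setup σ G) : G ≤ Subgroup.closure {g | g ∈ G ∧ ∃ i f, (i = 0 ∨ i = 1) ∧ HU i f ∧ IsU σ i f g} := by
  refine S.gen.trans (Subgroup.closure_mono ?_)
  rintro g ⟨hg, f, hf, h⟩
  refine ⟨hg, ?_⟩
  have e0 : lo 1 = 0 := by norm_num [lo]
  have e1 : hi 1 = 1 := by norm_num [hi]
  have e0' : lo 0 = -1/2 := by norm_num [lo]
  have e1' : hi 0 = 1/2 := by norm_num [hi]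
  have fx := hf.fix
  obtain ⟨k, ε, hε, h1, h2⟩ := hf.2
  rcases h with h | h
  · refine ⟨1, f, .inr rfl, ⟨InD_of_Thompson hf.1, by rw [e0, fx.1], by rw [e1, fx.2], k, ε, hε, ?_, ?_⟩, ?_⟩
    · intro t ht; rw [e0] at *; rw [h1 t (by simpa using ht)]; ring
    · intro t ht; rw [e1] at *; rw [h2 t (by simpa using ht)]
    · intro x hx t ht; rw [e0, e1] at ht; exact h x hx t ht
  · have hT : InD (trl (1/2)) := by simpa using trl_mem 1 1
    refine ⟨0, (trl (1/2))⁻¹ * f * trl (1/2), .inl rfl, ⟨(hT.inv.mul (InD_of_Thompson hf.1)).mul hT, ?_, ?_, k, ε, hε, ?_, ?_⟩, ?_⟩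
    · rw [e0']; simp only [RelIso.mul_apply, trl_inv_apply, trl_apply]; norm_num [fx.1]
    · rw [e1']; simp only [RelIso.mul_apply, trl_inv_apply, trl_apply]; norm_num [fx.2]
    · intro t ht; rw [e0'] at *; simp only [RelIso.mul_apply, trl_inv_apply, trl_apply]; 
      rw [h1 _ ⟨by linarith [ht.1], by linarith [ht.2]⟩]; ring
    · intro t ht; rw [e1'] at *; simp only [RelIso.mul_apply, trl_inv_apply, trl_apply]; 
      rw [h2 _ ⟨by linarith [ht.1], by linarith [ht.2]⟩]; ring
    · intro x hx t ht; rw [e0', e1'] at ht; rw [h x hx t ht]; simp only [RelIso.mul_apply, trl_inv_apply, trl_apply]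

theorem G_inD (S : Setup σ G) : G ≤ DGrp := by
  refine (gen_U S).trans ((Subgroup.closure_le _).2 ?_)
  rintro g ⟨hg, i, f, hi, hf, h⟩
  exact h.inD S hf.inD

/-- germs at zero -/
def Germ (k : ℤ) (f : ℝ ≃o ℝ) : Prop := ∃ ε > 0, ∀ t, |t| ≤ ε → f t = 2 ^ k * t

theorem Germ.mul {k k' f f'} (h : Germ k f) (h' : Germ k' f') : Germ (k + k') (f * f') := by
  obtain ⟨ε, hε, h⟩ := h
  obtain ⟨ε', hε', h'⟩ := h'
  have p : (0:ℝ) < 2 ^ k' := by positivity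
  refine ⟨min ε' (ε / 2 ^ k'), lt_min hε' (div_pos hε p), fun t ht => ?_⟩
  rw [RelIso.mul_apply, h' t (ht.trans (min_le_left _ _)), h, zpow_add₀ (by norm_num)]; ring
  rw [abs_mul, abs_of_pos p]
  have := ht.trans (min_le_right _ _)
  rw [le_div_iff₀ p] at this; linarith

theorem Germ.inv {k f} (h : Germ k f) : Germ (-k) f⁻¹ := by
  obtain ⟨ε, hε, h⟩ := h
  have p : (0:ℝ) < 2 ^ k := by positivity
  refine ⟨ε * 2 ^ k, mul_pos hε p, fun t ht => ?_⟩
  apply f.injective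
  rw [RelIso.apply_inv_self, h, zpow_neg]
  · field_simp
  · rw [zpow_neg, abs_mul, abs_of_pos (by positivity)]
    rw [inv_mul_le_iff₀ p]; linarith

theorem Germ.one : Germ 0 1 := ⟨1, one_pos, fun t _ => by simp⟩

theorem Germ.zpow {f} (h : Germ 1 f) (k : ℤ) : Germ k (f ^ k) := by
  induction k using Int.induction_on with
  | zero => simpa using Germ.one
  | succ m ih => rw [zpow_add_one]; exact ih.mul h
  | pred m ih => rw [zpow_sub_one]; exact ih.mul h.inv

theorem exists_sym0 (k : ℤ) : ∃ w, w ∈ Fc (-1/2) (1/2) ∧ cj (gam 0) w = w ∧ Germ k w := by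
  set a := scl 2 * theta * (scl 2)⁻¹ with ha
  have haD : InD a := ((scl_mem 2).mul theta_mem).mul (scl_mem 2).inv
  have a_app : ∀ t, a t = theta (4 * t) / 4 := by
    intro t; simp only [ha, RelIso.mul_apply, scl_apply, scl_inv_apply]; norm_num [mul_comm]
  have a_neg : ∀ t ≤ 0, a t = t := by
    intro t ht; rw [a_app, theta_le (by linarith)]; ring
  have a_big : ∀ t ≥ 1/4, a t = t := by
    intro t ht; rw [a_app, theta_ge (by linarith)]; ring
  have a_pos : ∀ t ≥ 0, 0 ≤ a t := by
    intro t ht; rw [← a_neg 0 le_rfl]; exact a.monotone ht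
  have a_sm : ∀ t, 0 ≤ t → t ≤ 1/16 → a t = 2 * t := by
    intro t ht ht'; rw [a_app, theta_1 (by linarith) (by linarith)]; ring
  have b_app : ∀ t, cj (gam 0) a t = - a (-t) := by
    intro t; simp [cj_apply, ph, gam]
  set w := a * cj (gam 0) a with hw
  have w1 : ∀ t ≥ 0, w t = a t := by
    intro t ht; rw [hw, RelIso.mul_apply, b_app, a_neg (-t) (by linarith), neg_neg]
  have w2 : ∀ t ≤ 0, w t = - a (-t) := by
    intro t ht; rw [hw, RelIso.mul_apply, b_app, a_neg]
    have := a_pos (-t) (by linarith); linarith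
  have wF : w ∈ Fc (-1/2) (1/2) := by
    refine ⟨haD.mul (haD.cj _), -1/4, 1/4, by norm_num, by norm_num, fun t ht => ?_, fun t ht => ?_⟩
    · rw [w2 t (by linarith), a_big _ (by linarith), neg_neg]
    · rw [w1 t (by linarith), a_big _ ht]
  have wS : cj (gam 0) w = w := by
    ext t
    have : cj (gam 0) w t = - w (-t) := by simp [cj_apply, ph, gam]
    rw [this]
    rcases le_total 0 t with h | h
    · rw [w1 t h, w2 (-t) (by linarith), neg_neg, neg_neg]
    · rw [w2 t h, w1 (-t) (by linarith)]
  have wG : Germ 1 w := by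
    refine ⟨1/16, by norm_num, fun t ht => ?_⟩
    rw [abs_le] at ht
    rcases le_total 0 t with h | h
    · rw [w1 t h, a_sm t h ht.2]; norm_num
    · rw [w2 t h, a_sm (-t) (by linarith) (by linarith)]; norm_num
  exact ⟨w ^ k, zpow_mem wF k, by rw [map_zpow, wS], wG.zpow k⟩

theorem exists_sym {j : ℤ} (hj : j = 0 ∨ j = 1) (k : ℤ) : ∃ w, w ∈ Fc (lo j) (hi j) ∧ cj (gam j) w = w ∧
    ∃ ε > (0:ℝ), ∀ t : ℝ, |t - j / 2| ≤ ε → w t = j / 2 + 2 ^ k * (t - j / 2) := by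
  obtain ⟨w, hw, hs, ε, hε, hg⟩ := exists_sym0 k
  rcases hj with rfl | rfl
  · refine ⟨w, by simpa [lo, hi, neg_div] using hw, hs, ε, hε, fun t ht => by simpa using hg t (by simpa using ht)⟩
  · have hT : InD (trl (1/2)) := by simpa using trl_mem 1 1
    have app : ∀ t, (trl (1/2) * w * (trl (1/2))⁻¹) t = w (t - 1/2) + 1/2 := by
      intro t; simp only [RelIso.mul_apply, trl_inv_apply, trl_apply]
    refine ⟨trl (1/2) * w * (trl (1/2))⁻¹, ?_, ?_, ε, hε, fun t ht => ?_⟩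
    · obtain ⟨hD, a, b, ha, hb, h1, h2⟩ := hw
      refine ⟨(hT.mul hD).mul hT.inv, a + 1/2, b + 1/2, by norm_num [lo]; linarith, by norm_num [hi]; linarith, fun t ht => ?_, fun t ht => ?_⟩
      · rw [app, h1 _ (by linarith)]; ring
      · rw [app, h2 _ (by linarith)]; ring
    · ext t
      have : cj (gam 0) w (t - 1/2) = w (t - 1/2) := by rw [hs]
      rw [cj_eq] at this ⊢
      rw [app, app]
      simp only [ph, gam] at this ⊢
      push_cast at this ⊢
      rw [show (1:ℝ) + -1 * t - 1/2 = 0 + -1 * (t - 1/2) by ring, this]; ring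
    · rw [app, hg _ (by simpa using ht)]; push_cast; ring

theorem V_pm (S : Setup σ G) (x i) : V σ x i = 1 ∨ V σ x i = -1 := by
  unfold V
  rcases x.cases with h | h <;> rcases S.sgn (2 * x.n + x.e * i) with h' | h' <;> rw [h'] <;> simp [h]

def genF (σ : ℤ → ℤ) (G : Subgroup (ℝ ≃o ℝ)) : Set (ℝ ≃o ℝ) :=
  {g | g ∈ G ∧ ∃ i f, (i = 0 ∨ i = 1) ∧ f ∈ Fc (lo i) (hi i) ∧ IsT (VS σ i 1) (lo i) (hi i) (fun _ => f) g}

theorem exists_inv_elt (S : Setup σ G) {j : ℤ} (hj : j = 0 ∨ j = 1) (k : ℤ) : ∃ c ∈ genF σ G, (∀ x, cj x c = c) ∧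
    ∃ ε > (0:ℝ), ∀ t : ℝ, |t - j / 2| ≤ ε → c t = j / 2 + 2 ^ k * (t - j / 2) := by
  obtain ⟨w, hw, hs, ε, hε, hg⟩ := exists_sym hj k
  obtain ⟨c, hc, h⟩ := base01 S hj (.inl rfl) w hw
  have A : ∀ x, ∀ t ∈ Ioo (lo j) (hi j), cj x c t = w t := by
    intro x t ht
    rcases V_pm S x j with hx | hx
    · exact h.1 x hx t ht
    · have h1 : tr (VS σ j 1) (gam j) = VS σ j (-1) := by
        rw [tr_VS_gam]; congr 1; ring
      have := (h.frame (gam_fit j)).1 x (by rw [h1]; exact hx) t ht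
      rwa [hs] at this
  refine ⟨c, ⟨hc, j, w, hj, hw, h⟩, fun x => ?_, min ε (1/4), by positivity, fun t ht => ?_⟩
  · ext s
    rw [cj_eq]
    by_cases hh : ∃ y, ∃ t ∈ Ioo (lo j) (hi j), s = ph y t
    · obtain ⟨y, t, ht, rfl⟩ := hh
      have h1 := A y t ht
      have h2 := A (x * y) t ht
      rw [cj_eq] at h1 h2
      rw [h1, ← ph_mul, ← ph_mul, h2]
    · push Not at hh
      rw [h.2 s fun y _ t ht => hh y t ht, h.2]
      intro y _ t ht e
      apply hh (x⁻¹ * y) t ht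
      rw [ph_mul, ← e, ph_inv_ph]
  · rw [← hg t (ht.trans (min_le_left _ _)), ← A 1 t, cj_one]
    have := abs_le.1 (ht.trans (min_le_right _ _))
    constructor
    · simp only [lo]; linarith
    · simp only [hi]; linarith

end
end GR

namespace GR
open Set
section
variable {σ : ℤ → ℤ} {G : Subgroup (ℝ ≃o ℝ)}

theorem dyadic_lo (i : ℤ) : IsDyadic (lo i) := ⟨i - 1, 1, by simp [lo]⟩
theorem dyadic_hi (i : ℤ) : IsDyadic (hi i) := ⟨i + 1, 1, by simp [hi]⟩

theorem gen_F (S : Setup σ G) : G ≤ Subgroup.closure (genF σ G) := by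
  refine (gen_U S).trans ((Subgroup.closure_le _).2 ?_)
  rintro g ⟨hg, i, f, hi01, hf, h⟩
  obtain ⟨k, ε, hε, hg1, hg2⟩ := hf.germ
  have hj : 1 - i = 0 ∨ 1 - i = 1 := by omega
  obtain ⟨c, hc, cinv, ε', hε', cg⟩ := exists_inv_elt S hj k
  have hcD : InD c := G_inD S hc.1
  have cper : ∀ (m : ℤ) (t : ℝ), c (m + t) = m + c t := by
    intro m t
    have : cj ⟨m, 1⟩ c t = c t := by rw [cinv]
    rw [cj_eq] at this
    simpa [ph] using this
  have cgerm : ∀ (p : ℝ) (m : ℤ), p = m + ((1 - i : ℤ):ℝ) / 2 → ∀ t, |t - p| ≤ ε' → c t = p + 2 ^ k * (t - p) := by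
    intro p m hp t ht
    have := cg (t - m) (by rw [hp] at ht; convert ht using 2; ring)
    have h2 := cper m (t - m)
    rw [add_sub_cancel] at h2
    rw [h2, this, hp]; ring
  have clo : ∀ t, |t - lo i| ≤ ε' → c t = lo i + 2 ^ k * (t - lo i) := cgerm _ (i - 1) (by simp [lo]; ring)
  have chi : ∀ t, |t - hi i| ≤ ε' → c t = hi i + 2 ^ k * (t - hi i) := cgerm _ i (by simp [hi]; ring)
  have lohi : hi i = lo i + 1 := by simp [hi, lo]; ring
  obtain ⟨x0, hx0, -⟩ := exists_fr S i 0
  have hg' : c⁻¹ * g ∈ G := mul_mem (inv_mem hc.1) hg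
  set F := cj x0 (c⁻¹ * g) with hF
  have key : ∀ x ∈ VS σ i 1, ∀ t ∈ Icc (lo i) (hi i), cj x (c⁻¹ * g) t = c⁻¹ (f t) := by
    intro x hx t ht
    rw [cj_mul_apply, h x hx t ht, map_inv, cinv]
  have cil : c⁻¹ (lo i) = lo i := inv_fix (by rw [clo _ (by simpa using hε'.le)]; simp)
  have cih : c⁻¹ (hi i) = hi i := inv_fix (by rw [chi _ (by simpa using hε'.le)]; simp)
  have Fl : F (lo i) = lo i := by rw [hF, key x0 hx0 _ ⟨le_rfl, by linarith⟩, hf.lo, cil]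
  have Fh : F (hi i) = hi i := by rw [hF, key x0 hx0 _ ⟨by linarith, le_rfl⟩, hf.hi, cih]
  obtain ⟨f', h1, h2, h3⟩ := exists_trunc Fl Fh
  have f'in : ∀ t ∈ Icc (lo i) (hi i), f' t = c⁻¹ (f t) := by
    intro t ht; rw [h1 t ht, hF, key x0 hx0 t ht]
  set η := min (min ε ε') 1 with hη
  have η0 : 0 < η := by positivity
  have η1 : η ≤ ε := (min_le_left _ _).trans (min_le_left _ _)
  have η2 : η ≤ ε' := (min_le_left _ _).trans (min_le_right _ _)
  have η3 : η ≤ 1 := min_le_right _ _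
  have hf' : f' ∈ Fc (lo i) (hi i) := by
    refine ⟨h3 ((G_inD S hg' : InD _).cj x0) (dyadic_lo i) (dyadic_hi i), lo i + η, hi i - η, by linarith, by linarith, fun t ht => ?_, fun t ht => ?_⟩
    · by_cases h : lo i ≤ t
      · rw [f'in t ⟨h, by linarith⟩, hg1 t ⟨h, by linarith⟩, ← clo t (by rw [abs_le]; constructor <;> linarith), RelIso.inv_apply_self]
      · exact h2 t (fun h' => h h'.1.le)
    · by_cases h : t ≤ hi i
      · rw [f'in t ⟨by linarith, h⟩, hg2 t ⟨by linarith, h⟩, ← chi t (by rw [abs_le]; constructor <;> linarith), RelIso.inv_apply_self]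
      · exact h2 t (fun h' => h h'.2.le)
  have : c⁻¹ * g ∈ genF σ G := by
    refine ⟨hg', i, f', hi01, hf', fun x hx t ht => ?_, fun y hy => ?_⟩
    · have ht' : t ∈ Icc (lo i) (hi i) := ⟨ht.1.le, ht.2.le⟩
      rw [key x hx t ht', f'in t ht']
    · obtain ⟨x, hx, hxy⟩ := exists_fr S i ⌊y - lo i⌋
      have f1 := Int.floor_le (y - lo i)
      have f2 := (Int.lt_floor_add_one (y - lo i)).le
      have hm := hxy y ⟨by linarith, by linarith⟩
      have hn : ph x⁻¹ y ∉ Ioo (lo i) (hi i) := fun h => hy x hx _ h (by simp)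
      have := key x hx _ hm
      rw [← f'in _ hm, h2 _ hn, cj_eq, ph_ph_inv] at this
      exact this
  have e : g = c * (c⁻¹ * g) := by group
  rw [e]
  exact mul_mem (Subgroup.subset_closure hc) (Subgroup.subset_closure this)

theorem IsT.unique {W u v φ g g'} (h : IsT W u v φ g) (h' : IsT W u v φ g') : g = g' := by
  ext y
  by_cases hh : ∀ x ∈ W, ∀ t ∈ Ioo u v, y ≠ ph x t
  · rw [h.2 y hh, h'.2 y hh]
  · push Not at hh
    obtain ⟨x, hx, t, ht, rfl⟩ := hh
    have h1 := h.1 x hx t ht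
    have h2 := h'.1 x hx t ht
    rw [cj_eq] at h1 h2; rw [h1, h2]

noncomputable def SS.hom {P : Set Fr} {u v : ℝ} (h : SS G P u v) : Fc u v →* G where
  toFun f := ⟨(h f f.2).choose, (h f f.2).choose_spec.1⟩
  map_one' := by
    ext1
    exact (h _ (one_mem _)).choose_spec.2.unique IsT.one
  map_mul' a b := by
    ext1
    exact (h _ (mul_mem a.2 b.2)).choose_spec.2.unique ((h _ a.2).choose_spec.2.mul (h _ b.2).choose_spec.2 (fun _ => b.2))

theorem SS.hom_spec {P : Set Fr} {u v : ℝ} (h : SS G P u v) (f : Fc u v) : IsT P u v (fun _ => (f : ℝ ≃o ℝ)) (h.hom f : ℝ ≃o ℝ) :=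
  (h f f.2).choose_spec.2

theorem Fc_perf (u v : ℝ) (f : Fc u v) : f ∈ commutator (Fc u v) := by
  have := Fc_perfect u v f.2
  have h : (commutator (Fc u v)).map (Fc u v).subtype = ⁅Fc u v, Fc u v⁆ := by
    rw [commutator_def, Subgroup.map_commutator]
    simp [← MonoidHom.range_eq_map]
  rw [← h] at this
  obtain ⟨f', hf', e⟩ := this
  have : f' = f := Subtype.ext e
  exact this ▸ hf'

theorem G_perf (S : Setup σ G) (g : G) : g ∈ commutator G := by
  obtain ⟨g, hg⟩ := g
  suffices h : ∀ g, g ∈ G → ∃ g' ∈ commutator G, (g' : ℝ ≃o ℝ) = g by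
    obtain ⟨g', h1, h2⟩ := h g hg
    rwa [show (⟨g, hg⟩ : G) = g' from Subtype.ext h2.symm]
  intro g hg
  have := gen_F S hg
  clear hg
  induction this using Subgroup.closure_induction with
  | mem g hg =>
    obtain ⟨hg, i, f, hi, hf, h⟩ := hg
    let hom := (base01 S hi (.inl rfl)).hom
    have sp := (base01 S hi (.inl rfl)).hom_spec ⟨f, hf⟩
    refine ⟨hom ⟨f, hf⟩, ?_, sp.unique h⟩
    have h1 : (commutator _).map hom ≤ commutator G := by
      rw [commutator_def, Subgroup.map_commutator, commutator_def]
      exact Subgroup.commutator_mono le_top le_top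
    exact h1 ⟨_, Fc_perf _ _ _, rfl⟩
  | one => exact ⟨1, one_mem _, rfl⟩
  | mul a b _ _ ha hb =>
    obtain ⟨a', h1, rfl⟩ := ha
    obtain ⟨b', h2, rfl⟩ := hb
    exact ⟨a' * b', mul_mem h1 h2, rfl⟩
  | inv a _ ha =>
    obtain ⟨a', h1, rfl⟩ := ha
    exact ⟨a'⁻¹, inv_mem h1, rfl⟩

/-- locality -/
def Loc (σ : ℤ → ℤ) (g : ℝ ≃o ℝ) : Prop := ∃ r : ℕ, (∀ t : ℝ, |g t - t| ≤ r) ∧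
  ∀ (L : ℕ) (x y : Fr), agree σ (2 * L + r) x y → ∀ t : ℝ, |t| ≤ L → cj x g t = cj y g t

theorem cj_disp {g : ℝ ≃o ℝ} {r : ℝ} (h : ∀ t, |g t - t| ≤ r) (x : Fr) (t : ℝ) : |cj x g t - t| ≤ r := by
  rw [← ph_abs x, ph_cj]; exact h _

theorem Loc.mul {g g'} (h : Loc σ g) (h' : Loc σ g') : Loc σ (g * g') := by
  obtain ⟨r, hd, h⟩ := h
  obtain ⟨r', hd', h'⟩ := h'
  refine ⟨2 * r + 2 * r', fun t => ?_, fun L x y hxy t ht => ?_⟩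
  · have h1 := abs_le.1 (hd (g' t))
    have h2 := abs_le.1 (hd' t)
    have r0 : (0:ℝ) ≤ r := by positivity
    have r0' : (0:ℝ) ≤ r' := by positivity
    rw [RelIso.mul_apply, abs_le]; push_cast
    constructor <;> linarith
  · rw [cj_mul_apply, cj_mul_apply, ← h' L x y (hxy.mono (by omega)) t ht]
    apply h (L + r') x y (hxy.mono (by omega))
    have h1 := abs_le.1 (cj_disp hd' x t)
    have h2 := abs_le.1 ht
    rw [abs_le]; push_cast; constructor <;> linarith

theorem Loc.inv {g} (h : Loc σ g) : Loc σ g⁻¹ := by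
  obtain ⟨r, hd, h⟩ := h
  have hd' : ∀ t, |g⁻¹ t - t| ≤ r := by
    intro t
    have := hd (g⁻¹ t)
    rwa [RelIso.apply_inv_self, abs_sub_comm] at this
  refine ⟨3 * r, fun t => (hd' t).trans ?_, fun L x y hxy t ht => ?_⟩
  · push_cast; have : (0:ℝ) ≤ r := by positivity
    linarith
  · have h1 := abs_le.1 (cj_disp hd' x t)
    have h2 := abs_le.1 ht
    have := h (L + r) x y (hxy.mono (by omega)) (cj x g⁻¹ t) (by rw [abs_le]; push_cast; constructor <;> linarith)
    apply (cj y g).injective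
    rw [← this, map_inv, map_inv, RelIso.apply_inv_self, RelIso.apply_inv_self]

theorem G_loc (S : Setup σ G) {g} (hg : g ∈ G) : Loc σ g := by
  have := gen_F S hg
  clear hg
  induction this using Subgroup.closure_induction with
  | mem g hg =>
    obtain ⟨hg, i, f, hi01, hf, h⟩ := hg
    have bd : ∀ s ∈ Ioo (lo i) (hi i), |s| ≤ 1 := by
      intro s hs
      have h1 := hs.1
      have h2 := hs.2
      rcases hi01 with rfl | rfl <;> norm_num [lo, hi] at h1 h2 <;> rw [abs_le] <;> constructor <;> linarith
    refine ⟨4, fun t => ?_, fun L x y hxy t ht => ?_⟩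
    · by_cases hh : ∀ x ∈ VS σ i 1, ∀ s ∈ Ioo (lo i) (hi i), t ≠ ph x s
      · rw [h.2 t hh]; simp
      · push Not at hh
        obtain ⟨x, hx, s, hs, rfl⟩ := hh
        have h1 := h.1 x hx s hs
        rw [cj_eq] at h1
        rw [h1, ph_abs]
        have h1 := abs_le.1 (bd s hs)
        have h2 := abs_le.1 (bd (f s) ((maps_Ioo (Fc_left hf) (Fc_right hf)).2 hs))
        rw [abs_le]; push_cast; constructor <;> linarith
    · have aux : ∀ x y, agree σ (2 * L + 4) x y → ∀ δ, ∀ s ∈ Ioo (lo i) (hi i), t = ph δ s → x * δ ∈ VS σ i 1 → y * δ ∈ VS σ i 1 := by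
        intro x y hxy δ s hs hts hx
        have hx : V σ (x * δ) i = 1 := hx
        show V σ (y * δ) i = 1
        rw [V_mul] at hx ⊢
        rw [← hxy _ _, hx]
        have h1 := abs_le.1 (bd s hs)
        have h2 := abs_le.1 ht
        have h3 : |δ.n| ≤ L + 1 := by
          have : |(δ.n:ℝ)| ≤ L + 1 := by
            rw [hts] at h2
            rcases δ.cases with e | e <;> simp [ph, e] at h2 <;> rw [abs_le] <;> constructor <;> linarith
          exact_mod_cast this
        rw [abs_le] at h3 ⊢
        push_cast
        rcases δ.cases with e | e <;> rw [e] <;> push_cast <;> constructor <;> omega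
      by_cases hh : ∃ δ, x * δ ∈ VS σ i 1 ∧ ∃ s ∈ Ioo (lo i) (hi i), t = ph δ s
      · obtain ⟨δ, hx, s, hs, rfl⟩ := hh
        have hy := aux x y hxy δ s hs rfl hx
        have h1 := h.1 _ hx s hs
        have h2 := h.1 _ hy s hs
        rw [cj_eq, ph_mul, ph_mul, ← cj_eq] at h1 h2
        rw [h1, h2]
      · have triv : ∀ z, (∀ δ, z * δ ∈ VS σ i 1 → ∀ s ∈ Ioo (lo i) (hi i), t ≠ ph δ s) → cj z g t = t := by
          intro z hz
          rw [cj_eq]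
          apply h.2
          intro w hw s hs e
          refine hz (z⁻¹ * w) (by simpa using hw) s hs ?_
          rw [ph_mul, ← e, ph_inv_ph]
        push Not at hh
        rw [triv x hh, triv y fun δ hδ s hs e => hh δ (aux y x hxy.symm δ s hs e hδ) s hs e]
  | one => exact ⟨0, fun t => by simp, fun L x y _ t _ => by rw [map_one, map_one]⟩
  | mul a b _ _ ha hb => exact ha.mul hb
  | inv a _ ha => exact ha.inv

theorem sep (S : Setup σ G) (B : ℕ) : ∃ T : ℕ, ∀ x y : Fr, |x.n| ≤ B → |y.n| ≤ B → agree σ T x y → x = y := by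
  have h1 : ∀ x y : Fr, ∃ T : ℕ, agree σ T x y → x = y := by
    intro x y
    by_cases h : x = y
    · exact ⟨0, fun _ => h⟩
    · have : ¬ ∀ i, V σ x i = V σ y i := fun h' => h (S.aper x y h')
      push Not at this
      obtain ⟨i, hi⟩ := this
      exact ⟨i.natAbs, fun h' => absurd (h' i (by simp)) hi⟩
  choose T hT using h1
  have hfin : Set.Finite {x : Fr | |x.n| ≤ B} := by
    refine ((Set.finite_Icc (-(B:ℤ)) B).prod (Set.toFinite (univ : Set ℤˣ))).preimage (f := fun x : Fr => (x.n, x.e)) ?_ |>.subset ?_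
    · intro x _ y _ e; simp at e; ext; exact e.1; exact congrArg _ e.2
    · intro x hx; simpa using abs_le.1 hx
  obtain ⟨M, hM⟩ := ((hfin.prod hfin).image (fun p => T p.1 p.2)).bddAbove
  exact ⟨M, fun x y hx hy h => hT x y (h.mono (hM ⟨(x, y), ⟨hx, hy⟩, rfl⟩))⟩

theorem R2 (S : Setup σ G) {g} (hg : g ∈ G) : ∀ R : ℝ, ∃ M : ℝ, ∀ M' : ℝ, ∃ h ∈ G, (∀ t, |t| ≤ R → h t = g t) ∧ ∀ t ∈ Icc M M', h t = t := by
  have := gen_F S hg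
  clear hg
  induction this using Subgroup.closure_induction with
  | mem g hg =>
    obtain ⟨hg, i, f, hi01, hf, h⟩ := hg
    have bd : ∀ s ∈ Ioo (lo i) (hi i), |s| ≤ 1 := by
      intro s hs
      have h1 := hs.1
      have h2 := hs.2
      rcases hi01 with rfl | rfl <;> norm_num [lo, hi] at h1 h2 <;> rw [abs_le] <;> constructor <;> linarith
    have bd2 : ∀ x, ∀ s ∈ Ioo (lo i) (hi i), |(x.n : ℝ) - ph x s| ≤ 1 := by
      intro x s hs
      have := bd s hs
      rcases x.cases with e | e <;> simpa [ph, e] using this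
    intro R
    set B : ℕ := ⌈R⌉₊ + 1 with hB
    refine ⟨B + 2, fun M' => ?_⟩
    set B' : ℕ := max B (⌈M'⌉₊ + 1) with hB'
    obtain ⟨T, hT⟩ := sep S B'
    let Q : Set Fr := VS σ i 1 ∩ {x | ∃ x' : Fr, |x'.n| ≤ (B:ℤ) ∧ agree σ T x x'}
    have hQ : Clopen σ Q := (clopen_VS i 1).inter ⟨T, fun x y hxy ⟨x', h1, h2⟩ => ⟨x', h1, hxy.symm.trans h2⟩⟩
    have hD := disj_VS σ S.sgn i 1
    have lohi : lo i < hi i := by simp only [lo, hi]; linarith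
    obtain ⟨k, hk, hh⟩ := thmD S hQ lohi (fun x hx y hy => hD x hx.1 y hy.1) f hf
    refine ⟨k, hk, fun t ht => ?_, fun t ht => ?_⟩
    · by_cases h' : ∀ x ∈ VS σ i 1, ∀ s ∈ Ioo (lo i) (hi i), t ≠ ph x s
      · rw [h.2 t h', hh.2 t fun x hx => h' x hx.1]
      · push Not at h'
        obtain ⟨x, hx, s, hs, rfl⟩ := h'
        have : x ∈ Q := by
          refine ⟨hx, x, ?_, agree.refl x⟩
          have : |(x.n:ℝ)| ≤ B := by
            have h1 := abs_le.1 (bd2 x s hs)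
            have h2 := abs_le.1 ht
            have h3 := Nat.le_ceil R
            rw [abs_le, hB]; push_cast; constructor <;> linarith
          exact_mod_cast this
        have h1 := h.1 x hx s hs
        have h2 := hh.1 x this s hs
        rw [cj_eq] at h1 h2; rw [h1, h2]
    · apply hh.2
      rintro x ⟨hx, x', hx', hag⟩ s hs rfl
      have h1 := abs_le.1 (bd2 x s hs)
      have h2 := ht.1; have h4 := ht.2
      have h3 := Nat.le_ceil M'
      have x1 : (B:ℤ) < x.n := by
        have : (B:ℝ) < x.n := by linarith
        exact_mod_cast this
      have x2 : x.n ≤ (⌈M'⌉₊ + 1 : ℕ) := by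
        have : (x.n:ℝ) ≤ (⌈M'⌉₊ + 1 : ℕ) := by push_cast; linarith
        exact_mod_cast this
      have e1 : B ≤ B' := le_max_left _ _
      have e2 : ⌈M'⌉₊ + 1 ≤ B' := le_max_right _ _
      have := hT x x' (by rw [abs_le]; omega) (by omega) hag
      rw [this] at x1
      rw [abs_le] at hx'; omega
  | one => exact fun R => ⟨0, fun M' => ⟨1, one_mem _, fun _ _ => rfl, fun _ _ => rfl⟩⟩
  | mul a b ha hb iha ihb =>
    have ha : a ∈ G := (Subgroup.closure_le G).2 (fun g hg => hg.1) ha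
    have hb : b ∈ G := (Subgroup.closure_le G).2 (fun g hg => hg.1) hb
    intro R
    obtain ⟨r, hr, -⟩ := G_loc S hb
    obtain ⟨M1, h1⟩ := iha (R + r)
    obtain ⟨M2, h2⟩ := ihb R
    refine ⟨max M1 M2, fun M' => ?_⟩
    obtain ⟨k1, hk1, A1, B1⟩ := h1 M'
    obtain ⟨k2, hk2, A2, B2⟩ := h2 M'
    refine ⟨k1 * k2, mul_mem hk1 hk2, fun t ht => ?_, fun t ht => ?_⟩
    · rw [RelIso.mul_apply, RelIso.mul_apply, A2 t ht, A1]
      have h1 := abs_le.1 (hr t)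
      have h2 := abs_le.1 ht
      rw [abs_le]; constructor <;> linarith
    · rw [RelIso.mul_apply, B2 t ⟨(le_max_right _ _).trans ht.1, ht.2⟩, B1 t ⟨(le_max_left _ _).trans ht.1, ht.2⟩]
  | inv a ha iha =>
    have ha : a ∈ G := (Subgroup.closure_le G).2 (fun g hg => hg.1) ha
    intro R
    obtain ⟨r, hr, -⟩ := (G_loc S ha).inv
    obtain ⟨M1, h1⟩ := iha (R + r)
    refine ⟨M1, fun M' => ?_⟩
    obtain ⟨k1, hk1, A1, B1⟩ := h1 M'
    refine ⟨k1⁻¹, inv_mem hk1, fun t ht => ?_, fun t ht => inv_fix (B1 t ht)⟩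
    apply k1.injective
    rw [RelIso.apply_inv_self, A1, RelIso.apply_inv_self]
    have h1 := abs_le.1 (hr t)
    have h2 := abs_le.1 ht
    rw [abs_le]; constructor <;> linarith
end
end GR

namespace GR
open Set
open scoped commutatorElement

abbrev UL := CircleDeg1Liftˣ

theorem coe_iff (x y : ℝ) : (x : Circle') = y ↔ ∃ n : ℤ, x = y + n := by
  rw [← sub_eq_zero, ← AddCircle.coe_sub, AddCircle.coe_eq_zero_iff]
  simp only [zsmul_eq_mul, mul_one]
  exact exists_congr fun n => ⟨fun h => by linarith, fun h => by linarith⟩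

theorem coe_surj (z : Circle') : ∃ x : ℝ, (x : Circle') = z := QuotientAddGroup.mk_surjective z

def IsLift (u : UL) (φ : Circle' ≃ₜ Circle') : Prop := ∀ t : ℝ, φ (t : Circle') = ((u : CircleDeg1Lift) t : ℝ)

@[simp] theorem ul_mul (u v : UL) (t : ℝ) : ((u * v : UL) : CircleDeg1Lift) t = (u : CircleDeg1Lift) ((v : CircleDeg1Lift) t) := rfl

theorem ul_mono (u : UL) {s t : ℝ} (h : s ≤ t) : (u : CircleDeg1Lift) s ≤ (u : CircleDeg1Lift) t := (u : CircleDeg1Lift).monotone h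

theorem ul_ext {u v : UL} (h : ∀ t, (u : CircleDeg1Lift) t = (v : CircleDeg1Lift) t) : u = v := by
  ext t; exact h t

theorem IsLift.one : IsLift 1 1 := fun t => rfl
theorem IsLift.mul {u v φ ψ} (h : IsLift u φ) (h' : IsLift v ψ) : IsLift (u * v) (φ * ψ) := by
  intro t
  show φ (ψ t) = _
  rw [h', h]; rfl
theorem IsLift.inv {u φ} (h : IsLift u φ) : IsLift u⁻¹ φ⁻¹ := by
  intro t
  apply φ.injective
  show φ (φ.symm t) = _
  rw [h, φ.apply_symm_apply]; simp

theorem IsLift.pow {u φ} (h : IsLift u φ) (n : ℕ) : IsLift (u ^ n) (φ ^ n) := by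
  induction n with
  | zero => simpa using IsLift.one
  | succ n ih => rw [pow_succ, pow_succ]; exact ih.mul h

/-- Two lifts differ by an integer translation. -/
theorem IsLift.diff {u v φ} (h : IsLift u φ) (h' : IsLift v φ) : ∃ m : ℤ, ∀ t, (u : CircleDeg1Lift) t = (v : CircleDeg1Lift) t + m := by
  have hw : IsLift (v⁻¹ * u) 1 := by simpa using h'.inv.mul h
  have : ∀ t : ℝ, ∃ n : ℤ, ((v⁻¹ * u : UL) : CircleDeg1Lift) t = t + n := fun t => (coe_iff _ _).1 (hw t).symm
  set w := v⁻¹ * u with hwd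
  choose n hn using this
  have loc : ∀ s t : ℝ, s ≤ t → t < s + 1 → n s = n t := by
    intro s t h1 h2
    rcases h1.eq_or_lt with rfl | h1'
    · rfl
    have a1 := ul_mono w h1
    have a2 := ul_mono w h2.le
    rw [(w : CircleDeg1Lift).map_add_one] at a2
    rw [hn, hn] at a1 a2
    have b1 : n s < n t + 1 := by
      have : (n s : ℝ) < n t + 1 := by linarith
      exact_mod_cast this
    have b2 : n t < n s + 1 := by
      have : (n t : ℝ) < n s + 1 := by linarith
      exact_mod_cast this
    omega
  have per : ∀ s, n s = n 0 := by
    intro s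
    have e : n s = n (Int.fract s) := by
      have := (w : CircleDeg1Lift).map_add_int (Int.fract s) ⌊s⌋
      rw [Int.fract_add_floor, hn, hn] at this
      have h2 := Int.fract_add_floor s
      have : (n s : ℝ) = n (Int.fract s) := by linarith
      exact_mod_cast this
    rw [e]
    exact (loc 0 _ (Int.fract_nonneg s) (by simpa using Int.fract_lt_one s)).symm
  refine ⟨n 0, fun t => ?_⟩
  have e : u = v * w := by simp [hwd]
  rw [e, ul_mul, hn, per, (v : CircleDeg1Lift).map_add_int]

noncomputable def tau (u : UL) : ℝ := (u : CircleDeg1Lift).translationNumber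

theorem tau_add_int {u v : UL} {m : ℤ} (h : ∀ t, (u : CircleDeg1Lift) t = (v : CircleDeg1Lift) t + m) : tau u = tau v + m := by
  have e : (u : CircleDeg1Lift) = ((CircleDeg1Lift.translate (Multiplicative.ofAdd (m:ℝ)) : UL) : CircleDeg1Lift) * (v : CircleDeg1Lift) := by
    ext t; rw [h t]; simp [add_comm]
  rw [tau, e, CircleDeg1Lift.translationNumber_mul_of_commute, CircleDeg1Lift.translationNumber_translate, add_comm]; rfl
  apply CircleDeg1Lift.ext
  intro t; simp [add_comm]

theorem tau_conj (u v : UL) : tau (u * v * u⁻¹) = tau v := by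
  simp [tau]
theorem tau_comm {u v : UL} (h : Commute u v) : tau (u * v) = tau u + tau v := by
  have : Commute (u : CircleDeg1Lift) v := by
    have := congrArg (Units.val) h.eq
    exact this
  simpa [tau] using CircleDeg1Lift.translationNumber_mul_of_commute this
theorem tau_one : tau 1 = 0 := by simp [tau]
theorem tau_inv (u : UL) : tau u⁻¹ = - tau u := CircleDeg1Lift.translationNumber_units_inv u
theorem tau_fix {u : UL} {x : ℝ} (h : (u : CircleDeg1Lift) x = x) : tau u = 0 := by
  simpa [tau] using CircleDeg1Lift.translationNumber_of_eq_add_int (u : CircleDeg1Lift) (x := x) (m := 0) (by simpa using h)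
theorem tau_defect (u v : UL) : |tau (u * v) - tau u - tau v| ≤ 4 := by
  have h1 := CircleDeg1Lift.dist_map_map_zero_lt (u : CircleDeg1Lift) v
  have h2 := CircleDeg1Lift.dist_map_zero_translationNumber_le (u : CircleDeg1Lift)
  have h3 := CircleDeg1Lift.dist_map_zero_translationNumber_le (v : CircleDeg1Lift)
  have h4 := CircleDeg1Lift.dist_map_zero_translationNumber_le ((u * v : UL) : CircleDeg1Lift)
  rw [ul_mul] at h4
  simp only [Real.dist_eq] at h1 h2 h3 h4
  change |_ - tau _| ≤ 1 at h2 h3 h4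
  rw [abs_lt] at h1
  rw [abs_le] at h2 h3 h4 ⊢
  constructor <;> linarith

/-- lifts of commuting homeos commute -/
theorem IsLift.commute {u v φ ψ} (h : IsLift u φ) (h' : IsLift v ψ) (hc : Commute φ ψ) : Commute u v := by
  have h1 : IsLift (u * v * u⁻¹) ψ := by
    have := (h.mul h').mul h.inv
    rwa [hc.eq, mul_inv_cancel_right] at this
  obtain ⟨m, hm⟩ := h1.diff h'
  have := tau_add_int hm
  rw [tau_conj] at this
  have m0 : (m:ℝ) = 0 := by linarith
  have e : u * v * u⁻¹ = v := ul_ext fun t => by rw [hm t, m0, add_zero]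
  rw [mul_inv_eq_iff_eq_mul] at e
  exact e

theorem l0_unique {u v φ} (h : IsLift u φ) (h' : IsLift v φ) (e : tau u = tau v) : u = v := by
  obtain ⟨m, hm⟩ := h.diff h'
  have := tau_add_int hm
  have m0 : (m:ℝ) = 0 := by linarith
  exact ul_ext fun t => by rw [hm t, m0, add_zero]

theorem IsLift.shift {u φ} (h : IsLift u φ) (m : ℤ) : ∃ v, IsLift v φ ∧ ∀ t, (v : CircleDeg1Lift) t = (u : CircleDeg1Lift) t + m := by
  have key : ∀ t, ((CircleDeg1Lift.translate (Multiplicative.ofAdd (m:ℝ)) * u : UL) : CircleDeg1Lift) t = (u : CircleDeg1Lift) t + m := by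
    intro t; simp [add_comm]
  refine ⟨CircleDeg1Lift.translate (Multiplicative.ofAdd (m:ℝ)) * u, fun t => ?_, key⟩
  rw [key, h t, coe_iff]; exact ⟨-m, by push_cast; ring⟩

theorem exists_lift_at {u φ} (h : IsLift u φ) {x y : ℝ} (e : φ x = y) : ∃ v, IsLift v φ ∧ (v : CircleDeg1Lift) x = y := by
  rw [h x, coe_iff] at e
  obtain ⟨n, hn⟩ := e
  obtain ⟨v, h1, h2⟩ := h.shift (-n)
  exact ⟨v, h1, by rw [h2, hn]; push_cast; ring⟩

theorem l0_fix {u φ} (h : IsLift u φ) (e : tau u = 0) {x : ℝ} (hx : φ x = x) : (u : CircleDeg1Lift) x = x := by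
  obtain ⟨v, h1, h2⟩ := exists_lift_at h hx
  rw [l0_unique h h1 (by rw [e, tau_fix h2]), h2]

/-- sup of a bounded orbit is fixed -/
theorem sup_fix {O : Set ℝ} (hne : O.Nonempty) (hb : BddAbove O) (u : UL)
    (h : ∀ y ∈ O, (u : CircleDeg1Lift) y ∈ O) (h' : ∀ y ∈ O, ((u⁻¹ : UL) : CircleDeg1Lift) y ∈ O) :
    (u : CircleDeg1Lift) (sSup O) = sSup O := by
  have key : ∀ w : UL, (∀ y ∈ O, ((w⁻¹ : UL) : CircleDeg1Lift) y ∈ O) → sSup O ≤ (w : CircleDeg1Lift) (sSup O) := by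
    intro w hw
    apply csSup_le hne
    intro y hy
    have := ul_mono w (le_csSup hb (hw y hy))
    simpa using this
  refine le_antisymm ?_ (key u h')
  have := ul_mono u (key u⁻¹ (by simpa using h))
  simpa using this

section FCsec
variable {Γ : Type*} [Group Γ]

/-- products of conjugates -/
def PC {M : Type*} [Group M] (H X : M) : ℕ → M
  | 0 => 1
  | n+1 => PC H X n * (H ^ n * X * (H ^ n)⁻¹)

theorem PC_comm {M : Type*} [Group M] {H X Y : M} (h : ∀ n, 1 ≤ n → Commute X (H ^ n * Y * (H ^ n)⁻¹)) (n : ℕ) :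
    ∀ m, n ≤ m → Commute (PC H X n) (H ^ m * Y * (H ^ m)⁻¹) := by
  induction n with
  | zero => exact fun m _ => Commute.one_left _
  | succ n ih =>
    intro m hm
    refine (ih m (by omega)).mul_left ?_
    obtain ⟨k, rfl⟩ : ∃ k, m = n + k := ⟨m - n, by omega⟩
    have := (h k (by omega)).map (MulAut.conj (H ^ n))
    simp only [MulAut.conj_apply] at this
    have e : H ^ (n + k) * Y * (H ^ (n + k))⁻¹ = H ^ n * (H ^ k * Y * (H ^ k)⁻¹) * (H ^ n)⁻¹ := by
      rw [pow_add]; group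
    rw [e]; exact this

theorem PC_mul {M : Type*} [Group M] {H X Y : M} (h : ∀ n, 1 ≤ n → Commute Y (H ^ n * X * (H ^ n)⁻¹)) (n : ℕ) :
    PC H (X * Y) n = PC H X n * PC H Y n := by
  induction n with
  | zero => simp [PC]
  | succ n ih =>
    have := PC_comm h n n le_rfl
    rw [PC, PC, PC, ih]
    calc _ = PC H X n * (PC H Y n * (H ^ n * X * (H ^ n)⁻¹)) * (H ^ n * Y * (H ^ n)⁻¹) := by group
      _ = PC H X n * ((H ^ n * X * (H ^ n)⁻¹) * PC H Y n) * (H ^ n * Y * (H ^ n)⁻¹) := by rw [this.eq]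
      _ = _ := by group

theorem PC_tau {H X : UL} (h : ∀ n, 1 ≤ n → Commute X (H ^ n * X * (H ^ n)⁻¹)) (n : ℕ) :
    tau (PC H X n) = n * tau X := by
  induction n with
  | zero => simp [PC, tau_one]
  | succ n ih =>
    rw [PC, tau_comm (PC_comm h n n le_rfl), ih, tau_conj]; push_cast; ring

theorem tau_add {A B H : UL} (haa : ∀ n, 1 ≤ n → Commute A (H ^ n * A * (H ^ n)⁻¹))
    (hab : ∀ n, 1 ≤ n → Commute A (H ^ n * B * (H ^ n)⁻¹)) (hba : ∀ n, 1 ≤ n → Commute B (H ^ n * A * (H ^ n)⁻¹))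
    (hbb : ∀ n, 1 ≤ n → Commute B (H ^ n * B * (H ^ n)⁻¹)) : tau (A * B) = tau A + tau B := by
  have hc : ∀ n, 1 ≤ n → Commute (A * B) (H ^ n * (A * B) * (H ^ n)⁻¹) := by
    intro n hn
    have e : H ^ n * (A * B) * (H ^ n)⁻¹ = (H ^ n * A * (H ^ n)⁻¹) * (H ^ n * B * (H ^ n)⁻¹) := by group
    rw [e]
    exact ((haa n hn).mul_right (hab n hn)).mul_left ((hba n hn).mul_right (hbb n hn))
  have key : ∀ n : ℕ, n * |tau (A * B) - tau A - tau B| ≤ 4 := by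
    intro n
    have := tau_defect (PC H A n) (PC H B n)
    rw [← PC_mul hba, PC_tau hc, PC_tau haa, PC_tau hbb] at this
    rw [← mul_sub, ← mul_sub, abs_mul] at this
    simpa using this
  have : |tau (A * B) - tau A - tau B| = 0 := by
    by_contra h
    have pos : 0 < |tau (A * B) - tau A - tau B| := lt_of_le_of_ne (abs_nonneg _) (Ne.symm h)
    obtain ⟨n, hn⟩ := exists_nat_gt (4 / |tau (A * B) - tau A - tau B|)
    rw [div_lt_iff₀ pos] at hn
    linarith [key n]
  rw [abs_eq_zero] at this
  linarith

def FixS (Ψ : Γ →* (Circle' ≃ₜ Circle')) (x : Circle') : Subgroup Γ where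
  carrier := {γ | Ψ γ x = x}
  one_mem' := by simp only [mem_ofPred_eq, map_one]; rfl
  mul_mem' := by
    intro a b ha hb
    simp only [mem_ofPred_eq] at *
    rw [map_mul]; show Ψ a (Ψ b x) = x; rw [hb, ha]
  inv_mem' := by
    intro a ha
    simp only [mem_ofPred_eq] at *
    rw [map_inv]; show (Ψ a).symm x = x; rw [Homeomorph.symm_apply_eq, ha]

theorem FC {Ψ : Γ →* (Circle' ≃ₜ Circle')} (hΨ : ∀ γ, ∃ u, IsLift u (Ψ γ)) (hp : ∀ γ : Γ, γ ∈ commutator Γ)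
    (hd : ∀ a b : Γ, ∃ h : Γ, ∀ n : ℕ, 1 ≤ n → ∀ x ∈ ({a, b} : Set Γ), ∀ y ∈ ({a, b} : Set Γ), Commute x (h ^ n * y * (h ^ n)⁻¹)) :
    ∃ x, ∀ γ, γ ∈ FixS Ψ x := by
  have tadd : ∀ a b A B, IsLift A (Ψ a) → IsLift B (Ψ b) → tau (A * B) = tau A + tau B := by
    intro a b A B hA hB
    obtain ⟨h, hh⟩ := hd a b
    obtain ⟨H, hH⟩ := hΨ h
    have key : ∀ x ∈ ({a, b} : Set Γ), ∀ y ∈ ({a, b} : Set Γ), ∀ X Y, IsLift X (Ψ x) → IsLift Y (Ψ y) → ∀ n, 1 ≤ n → Commute X (H ^ n * Y * (H ^ n)⁻¹) := by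
      intro x hx y hy X Y hX hY n hn
      refine hX.commute (((hH.pow n).mul hY).mul (hH.pow n).inv) ?_
      have := (hh n hn x hx y hy).map Ψ
      simpa using this
    exact tau_add (key a (by simp) a (by simp) A A hA hA) (key a (by simp) b (by simp) A B hA hB)
      (key b (by simp) a (by simp) B A hB hA) (key b (by simp) b (by simp) B B hB hB)
  let Z : Subgroup Γ :=
    { carrier := {γ | ∃ u, IsLift u (Ψ γ) ∧ tau u = 0}
      one_mem' := ⟨1, by rw [map_one]; exact IsLift.one, tau_one⟩
      mul_mem' := by
        rintro a b ⟨u, hu, tu⟩ ⟨v, hv, tv⟩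
        exact ⟨u * v, by rw [map_mul]; exact hu.mul hv, by rw [tadd a b u v hu hv, tu, tv, add_zero]⟩
      inv_mem' := by
        rintro a ⟨u, hu, tu⟩
        exact ⟨u⁻¹, by rw [map_inv]; exact hu.inv, by rw [tau_inv, tu, neg_zero]⟩ }
  have hZ : ∀ γ, γ ∈ Z := by
    intro γ
    suffices h : commutator Γ ≤ Z from h (hp γ)
    rw [commutator_def, Subgroup.commutator_le]
    intro a _ b _
    obtain ⟨A, hA⟩ := hΨ a
    obtain ⟨B, hB⟩ := hΨ b
    have i1 : IsLift A⁻¹ (Ψ a⁻¹) := by rw [map_inv]; exact hA.inv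
    have i2 : IsLift B⁻¹ (Ψ b⁻¹) := by rw [map_inv]; exact hB.inv
    have j1 : IsLift (A * B) (Ψ (a * b)) := by rw [map_mul]; exact hA.mul hB
    have j2 : IsLift (A * B * A⁻¹) (Ψ (a * b * a⁻¹)) := by rw [map_mul]; exact j1.mul i1
    refine ⟨A * B * A⁻¹ * B⁻¹, by rw [commutatorElement_def, map_mul]; exact j2.mul i2, ?_⟩
    rw [tadd _ _ _ _ j2 i2, tau_conj, tau_inv]; ring
  let O : Set ℝ := {y | ∃ γ u, IsLift u (Ψ γ) ∧ tau u = 0 ∧ (u : CircleDeg1Lift) 0 = y}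
  have hO : O.Nonempty := ⟨0, 1, 1, by rw [map_one]; exact IsLift.one, tau_one, rfl⟩
  have hb : BddAbove O := by
    refine ⟨1, ?_⟩
    rintro _ ⟨γ, u, hu, tu, rfl⟩
    have h2 := CircleDeg1Lift.dist_map_zero_translationNumber_le (u : CircleDeg1Lift)
    change dist _ (tau u) ≤ 1 at h2
    rw [tu, Real.dist_eq, abs_le] at h2
    linarith
  have inv : ∀ γ u, IsLift u (Ψ γ) → tau u = 0 → ∀ y ∈ O, (u : CircleDeg1Lift) y ∈ O := by
    rintro γ u hu tu _ ⟨γ', v, hv, tv, rfl⟩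
    exact ⟨γ * γ', u * v, by rw [map_mul]; exact hu.mul hv, by rw [tadd _ _ _ _ hu hv, tu, tv, add_zero], rfl⟩
  refine ⟨(sSup O : ℝ), fun γ => ?_⟩
  obtain ⟨u, hu, tu⟩ := hZ γ
  show Ψ γ _ = _
  rw [hu, sup_fix hO hb u (inv γ u hu tu) (inv γ⁻¹ u⁻¹ (by rw [map_inv]; exact hu.inv) (by rw [tau_inv, tu, neg_zero]))]

theorem fix_commuting {Ψ : Γ →* (Circle' ≃ₜ Circle')} (hΨ : ∀ γ, ∃ u, IsLift u (Ψ γ)) {K1 K2 : Subgroup Γ}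
    (hc : ∀ a ∈ K1, ∀ b ∈ K2, Commute a b) {x1 x2 : Circle'} (h1 : K1 ≤ FixS Ψ x1) (h2 : K2 ≤ FixS Ψ x2) :
    ∃ x, K1 ⊔ K2 ≤ FixS Ψ x := by
  obtain ⟨z1, rfl⟩ := coe_surj x1
  obtain ⟨z2', rfl⟩ := coe_surj x2
  obtain ⟨z2, e2, hz⟩ : ∃ z2 : ℝ, (z2 : Circle') = z2' ∧ z1 ≤ z2 := by
    obtain ⟨n, hn⟩ := exists_nat_ge (z1 - z2')
    exact ⟨z2' + n, (coe_iff _ _).2 ⟨n, by push_cast; ring⟩, by linarith⟩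
  rw [← e2] at h2
  let O : Set ℝ := {y | ∃ b ∈ K2, ∃ u, IsLift u (Ψ b) ∧ (u : CircleDeg1Lift) z2 = z2 ∧ (u : CircleDeg1Lift) z1 = y}
  have hO : O.Nonempty := ⟨z1, 1, one_mem _, 1, by rw [map_one]; exact IsLift.one, rfl, rfl⟩
  have hb : BddAbove O := by
    refine ⟨z2, ?_⟩
    rintro _ ⟨b, hb, u, hu, hu2, rfl⟩
    rw [← hu2]; exact ul_mono u hz
  have inv : ∀ b ∈ K2, ∀ u, IsLift u (Ψ b) → (u : CircleDeg1Lift) z2 = z2 → ∀ y ∈ O, (u : CircleDeg1Lift) y ∈ O := by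
    rintro b hb u hu tu _ ⟨b', hb', v, hv, tv, rfl⟩
    exact ⟨b * b', mul_mem hb hb', u * v, by rw [map_mul]; exact hu.mul hv, by rw [ul_mul, tv, tu], rfl⟩
  refine ⟨(sSup O : ℝ), sup_le ?_ ?_⟩
  · intro a ha
    obtain ⟨w, hw⟩ := hΨ a
    obtain ⟨u, hu, hu1⟩ := exists_lift_at hw (h1 ha)
    have triv : ∀ y ∈ O, (u : CircleDeg1Lift) y = y := by
      rintro _ ⟨b, hb, v, hv, tv, rfl⟩
      have := hu.commute hv ((hc a ha b hb).map Ψ)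
      rw [← ul_mul, this.eq, ul_mul, hu1]
    show Ψ a _ = _
    rw [hu, sup_fix hO hb u (fun y hy => by rwa [triv y hy]) (fun y hy => ?_)]
    have : ((u⁻¹ : UL) : CircleDeg1Lift) y = y := by
      conv_lhs => rw [← triv y hy]
      simp
    rwa [this]
  · intro b hbK
    obtain ⟨w, hw⟩ := hΨ b
    obtain ⟨u, hu, hu1⟩ := exists_lift_at hw (h2 hbK)
    show Ψ b _ = _
    rw [hu, sup_fix hO hb u (inv b hbK u hu hu1) (inv b⁻¹ (inv_mem hbK) u⁻¹ (by rw [map_inv]; exact hu.inv) ?_)]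
    conv_lhs => rw [← hu1]
    simp

theorem fix_family {Ψ : Γ →* (Circle' ≃ₜ Circle')} (hΨ : ∀ γ, ∃ u, IsLift u (Ψ γ)) {ι : Type*} (K : ι → Subgroup Γ) (s : Finset ι)
    (hc : ∀ i ∈ s, ∀ j ∈ s, i ≠ j → ∀ a ∈ K i, ∀ b ∈ K j, Commute a b) (hf : ∀ i ∈ s, ∃ x, K i ≤ FixS Ψ x) :
    ∃ x, ∀ i ∈ s, K i ≤ FixS Ψ x := by
  classical
  suffices h : ∃ x, (⨆ i ∈ s, K i) ≤ FixS Ψ x by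
    obtain ⟨x, hx⟩ := h
    exact ⟨x, fun i hi => (le_iSup₂ (f := fun i (_ : i ∈ s) => K i) i hi).trans hx⟩
  induction s using Finset.induction_on with
  | empty => exact ⟨0, by simp⟩
  | insert i s hi ih =>
    obtain ⟨x2, h2⟩ := ih (fun a ha b hb => hc a (by simp [ha]) b (by simp [hb])) (fun a ha => hf a (by simp [ha]))
    obtain ⟨x1, h1⟩ := hf i (by simp)
    rw [Finset.iSup_insert]
    refine fix_commuting hΨ (fun a ha b hb => ?_) h1 h2
    have : (⨆ j ∈ s, K j) ≤ Subgroup.centralizer {a} := by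
      refine iSup₂_le fun j hj b hb => ?_
      rw [Subgroup.mem_centralizer_singleton_iff]
      exact (hc i (by simp) j (by simp [hj]) (fun e => hi (e ▸ hj)) a ha b hb).symm.eq
    have := this hb
    rw [Subgroup.mem_centralizer_singleton_iff] at this
    exact this.symm

end FCsec
end GR

namespace GR
open Set
open scoped commutatorElement

theorem comm_supp {f g : ℝ ≃o ℝ} {c : ℝ} (hf : ∀ t, c ≤ t → f t = t) (hg : ∀ t, t ≤ c → g t = t) : Commute f g := by
  ext t
  rw [RelIso.mul_apply, RelIso.mul_apply]
  rcases le_total t c with h | h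
  · rw [hg t h, hg (f t)]
    have := f.monotone h
    rwa [hf c le_rfl] at this
  · rw [hf t h, hf (g t)]
    have := g.monotone h
    rwa [hg c le_rfl] at this

theorem Fc_disp {u v : ℝ} (a b : Fc u v) : ∃ h : Fc u v, ∀ n : ℕ, 1 ≤ n → ∀ x ∈ ({a, b} : Set (Fc u v)), ∀ y ∈ ({a, b} : Set (Fc u v)),
    Commute x (h ^ n * y * (h ^ n)⁻¹) := by
  rcases lt_or_ge u v with huv | huv
  · obtain ⟨ha, ua, va, a1, a2, a3, a4⟩ := a.2
    obtain ⟨hb, ub, vb, b1, b2, b3, b4⟩ := b.2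
    set c := min (min ua ub) ((u + v) / 2) with hc
    set d := max va vb with hd
    have c1 : u < c := lt_min (lt_min a1 b1) (by linarith)
    have c2 : c < v := (min_le_right _ _).trans_lt (by linarith)
    have d1 : d < v := max_lt a2 b2
    obtain ⟨g, hg, h1, -⟩ := push_up (LM_Fc u v) le_rfl le_rfl (y := c) ⟨c1, c2⟩ (c := max c d) (max_lt c2 d1)
    have lows : ∀ y ∈ ({a, b} : Set (Fc u v)), ∀ t ≤ c, (y : ℝ ≃o ℝ) t = t := by
      rintro y (rfl | rfl) t ht
      · exact a3 t (ht.trans ((min_le_left _ _).trans (min_le_left _ _)))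
      · exact b3 t (ht.trans ((min_le_left _ _).trans (min_le_right _ _)))
    have highs : ∀ y ∈ ({a, b} : Set (Fc u v)), ∀ t, d ≤ t → (y : ℝ ≃o ℝ) t = t := by
      rintro y (rfl | rfl) t ht
      · exact a4 t ((le_max_left _ _).trans ht)
      · exact b4 t ((le_max_right _ _).trans ht)
    have gn : ∀ n : ℕ, g c ≤ (g ^ (n + 1)) c := by
      intro n
      induction n with
      | zero => simp
      | succ n ih =>
        rw [pow_succ', RelIso.mul_apply]
        apply g.monotone
        exact ((le_max_left _ _).trans h1.le).trans ih
    refine ⟨⟨g, hg⟩, fun n hn x hx y hy => ?_⟩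
    obtain ⟨m, rfl⟩ : ∃ m, n = m + 1 := ⟨n - 1, by omega⟩
    have : Commute (x : ℝ ≃o ℝ) (g ^ (m+1) * y * (g ^ (m+1))⁻¹) := by
      refine comm_supp (c := d) (highs x hx) fun t ht => ?_
      have hle : (g ^ (m+1))⁻¹ t ≤ c := by
        have : t ≤ (g ^ (m+1)) c := ht.trans (((le_max_right _ _).trans h1.le).trans (gn m))
        have := ((g ^ (m+1))⁻¹).monotone this
        rwa [RelIso.inv_apply_self] at this
      rw [RelIso.mul_apply, RelIso.mul_apply, lows y hy _ hle, RelIso.apply_inv_self]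
    exact Subtype.ext this.eq
  · have triv : ∀ y : Fc u v, y = 1 := by
      intro y
      ext t
      exact Fc_fix y.2 (fun h => by have := h.1.trans h.2; linarith)
    exact ⟨1, fun n _ x _ y _ => by rw [triv x]; exact Commute.one_left _⟩

theorem range_fix {G : Subgroup (ℝ ≃o ℝ)} {Φ : G →* (Circle' ≃ₜ Circle')} (hΦ : ∀ γ, ∃ u, IsLift u (Φ γ)) {P : Set Fr} {u v : ℝ}
    (h : SS G P u v) : ∃ x, h.hom.range ≤ FixS Φ x := by
  obtain ⟨x, hx⟩ := FC (Ψ := Φ.comp h.hom) (fun γ => hΦ _) (Fc_perf u v) Fc_disp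
  refine ⟨x, ?_⟩
  rintro _ ⟨f, rfl⟩
  exact hx f

/-! lifts of circle homeomorphisms -/
theorem exists_clift (φ : Circle' ≃ₜ Circle') : ∃ F : C(ℝ, ℝ), ∀ t : ℝ, φ (t : Circle') = (F t : ℝ) := by
  let f : C(ℝ, Circle') := ⟨fun t => φ (t : Circle'), φ.continuous.comp (AddCircle.continuous_mk' 1)⟩
  obtain ⟨e, he⟩ := coe_surj (f 0)
  obtain ⟨F, ⟨-, hF⟩, -⟩ := (AddCircle.isCoveringMap_coe (1:ℝ)).existsUnique_continuousMap_lifts f 0 e he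
  exact ⟨F, fun t => (congrFun hF t).symm⟩

theorem int_const {f : ℝ → ℝ} (hf : Continuous f) (h : ∀ t, ∃ n : ℤ, f t = n) : ∃ n : ℤ, ∀ t, f t = n := by
  obtain ⟨n, hn⟩ := h 0
  refine ⟨n, fun t => ?_⟩
  choose N hN using h
  have hc : Continuous N := by
    have e : Topology.IsClosedEmbedding ((↑) : ℤ → ℝ) := Int.isClosedEmbedding_coe_real
    rw [e.isEmbedding.continuous_iff]
    have : ((↑) : ℤ → ℝ) ∘ N = f := by ext t; simp [hN]
    rwa [this]
  have := PreconnectedSpace.constant (f := N) inferInstance hc (x := t) (y := 0)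
  rw [hN, this, ← hN, hn]

theorem clift_inv {φ : Circle' ≃ₜ Circle'} {F G : C(ℝ, ℝ)} (hF : ∀ t : ℝ, φ (t : Circle') = (F t : ℝ)) (hG : ∀ t : ℝ, φ.symm (t : Circle') = (G t : ℝ)) :
    ∃ n : ℤ, ∀ t, G (F t) = t + n := by
  obtain ⟨n, hn⟩ := int_const (f := fun t => G (F t) - t) (by fun_prop) (fun t => by
    have : ((G (F t) : ℝ) : Circle') = t := by rw [← hG, ← hF, φ.symm_apply_apply]
    obtain ⟨n, hn⟩ := (coe_iff _ _).1 this
    exact ⟨n, by linarith⟩)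
  exact ⟨n, fun t => by linarith [hn t]⟩

theorem clift_deg {φ : Circle' ≃ₜ Circle'} {F : C(ℝ, ℝ)} (hF : ∀ t : ℝ, φ (t : Circle') = (F t : ℝ)) :
    ∃ n : ℤ, ∀ t, F (t + 1) = F t + n := by
  obtain ⟨n, hn⟩ := int_const (f := fun t => F (t + 1) - F t) (by fun_prop) (fun t => by
    have : ((F (t + 1) : ℝ) : Circle') = F t := by
      rw [← hF, ← hF]; congr 1; exact (coe_iff _ _).2 ⟨1, by simp⟩
    obtain ⟨n, hn⟩ := (coe_iff _ _).1 this
    exact ⟨n, by linarith⟩)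
  exact ⟨n, fun t => by linarith [hn t]⟩

theorem per_int {F : ℝ → ℝ} {n : ℤ} (h : ∀ t, F (t + 1) = F t + n) (m : ℤ) : ∀ t, F (t + m) = F t + m * n := by
  induction m using Int.induction_on with
  | zero => simp
  | succ k ih => intro t; push_cast at *; rw [← add_assoc, h, ih]; ring
  | pred k ih =>
    intro t
    have := h (t + ((-(k:ℤ) - 1 : ℤ) : ℝ))
    have h2 := ih t
    push_cast at *
    rw [show t + (-(k:ℝ) - 1) + 1 = t + -(k:ℝ) by ring] at this
    linarith

def negC : Circle' ≃ₜ Circle' := Homeomorph.neg Circle'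

theorem lift_or (φ : Circle' ≃ₜ Circle') : (∃ u, IsLift u φ) ∨ ∃ u, IsLift u (negC * φ) := by
  have main : ∀ (φ : Circle' ≃ₜ Circle') (F : C(ℝ, ℝ)), (∀ t : ℝ, φ (t : Circle') = (F t : ℝ)) → StrictMono F → ∃ u, IsLift u φ := by
    intro φ F hF hm
    obtain ⟨G, hG⟩ := exists_clift φ.symm
    obtain ⟨c, hc⟩ := clift_inv hF hG
    obtain ⟨c', hc'⟩ := clift_inv (φ := φ.symm) hG hF
    obtain ⟨d, hd⟩ := clift_deg hF
    obtain ⟨d', hd'⟩ := clift_deg hG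
    have dd : d * d' = 1 := by
      have h1 := hc (0 + 1)
      rw [hd, per_int (F := G) hd', hc] at h1
      have : (d * d' : ℝ) = 1 := by linarith
      exact_mod_cast this
    have d0 : 0 < d := by
      have h1 := hm (show (0:ℝ) < 0 + 1 by norm_num)
      rw [hd] at h1
      have : (0:ℝ) < d := by linarith
      exact_mod_cast this
    have d1 : d = 1 := by
      rcases Int.eq_one_or_neg_one_of_mul_eq_one dd with h | h <;> omega
    have d1' : d' = 1 := by rw [d1, one_mul] at dd; exact dd
    have hFG : ∀ t, F (G t - c) = t := by
      intro t
      have h1 : F (G t) = t + c' := hc' t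
      have h2 := per_int (F := F) hd (-c) (G t)
      rw [h1, d1] at h2
      push_cast at h2
      rw [← sub_eq_add_neg] at h2
      have cc : (c:ℝ) = c' := by
        have e1 := hc (G t)
        rw [h1, per_int (F := G) hd' c', d1'] at e1
        push_cast at e1; linarith
      rw [h2, cc]; ring
    have gm : Monotone fun t => G t - c := by
      intro s t hst
      by_contra hlt
      push Not at hlt
      have := hm hlt
      rw [hFG, hFG] at this
      linarith
    let A : CircleDeg1Lift := ⟨⟨F, hm.monotone⟩, fun t => by simpa [d1] using hd t⟩
    let B : CircleDeg1Lift := ⟨⟨fun t => G t - c, gm⟩, fun t => by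
      show G (t + 1) - c = G t - c + 1
      rw [hd', d1']; push_cast; ring⟩
    refine ⟨⟨A, B, ?_, ?_⟩, fun t => hF t⟩
    · ext t; exact hFG t
    · ext t; show G (F t) - c = t; rw [hc]; ring
  obtain ⟨F, hF⟩ := exists_clift φ
  obtain ⟨G, hG⟩ := exists_clift φ.symm
  obtain ⟨c, hc⟩ := clift_inv hF hG
  have inj : Function.Injective F := by
    intro s t h
    have h1 := hc s
    rw [h, hc] at h1
    linarith
  rcases F.continuous.strictMono_of_inj inj with h | h
  · exact Or.inl (main φ F hF h)
  · refine Or.inr (main (negC * φ) (-F) (fun t => ?_) (fun s t hst => by simpa using h hst))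
    show - φ t = _
    rw [hF]; simp

def OPG : Subgroup (Circle' ≃ₜ Circle') where
  carrier := {φ | ∃ u, IsLift u φ}
  one_mem' := ⟨1, IsLift.one⟩
  mul_mem' := fun ⟨u, hu⟩ ⟨v, hv⟩ => ⟨u * v, hu.mul hv⟩
  inv_mem' := fun ⟨u, hu⟩ => ⟨u⁻¹, hu.inv⟩

theorem neg_neg' : negC * negC = 1 := by
  ext x; show - - x = x; simp

theorem OPG_neg {φ} (h : φ ∈ OPG) : negC * φ * negC ∈ OPG := by
  obtain ⟨u, hu⟩ := h
  let cn : CircleDeg1Lift → CircleDeg1Lift := fun A => ⟨⟨fun t => - A (-t), fun s t hst => neg_le_neg (A.monotone (neg_le_neg hst))⟩, fun t => by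
    show - A (-(t + 1)) = - A (-t) + 1
    have := A.map_add_one (-(t+1))
    rw [show -(t + 1) + 1 = -t by ring] at this
    rw [this]; ring⟩
  refine ⟨⟨cn u, cn (u⁻¹ : UL), ?_, ?_⟩, fun t => ?_⟩
  · ext t; show - (u : CircleDeg1Lift) (- - ((u⁻¹ : UL) : CircleDeg1Lift) (-t)) = t; simp
  · ext t; show - ((u⁻¹ : UL) : CircleDeg1Lift) (- - (u : CircleDeg1Lift) (-t)) = t; simp
  · show - φ (- (t : Circle')) = ((- (u : CircleDeg1Lift) (-t) : ℝ) : Circle')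
    rw [← AddCircle.coe_neg, hu]; simp

theorem OPG_comm (a b : Circle' ≃ₜ Circle') : ⁅a, b⁆ ∈ OPG := by
  have nor : OPG.Normal := by
    refine ⟨fun n hn g => ?_⟩
    rcases lift_or g with h | h
    · exact mul_mem (mul_mem (show g ∈ OPG from h) hn) (inv_mem h)
    · have h : negC * g ∈ OPG := h
      have := OPG_neg (mul_mem (mul_mem h hn) (inv_mem h))
      have e : negC * (negC * g * n * (negC * g)⁻¹) * negC = (negC * negC) * (g * n * g⁻¹) := by group
      rwa [e, neg_neg', one_mul] at this
  have q : ∀ g : Circle' ≃ₜ Circle', (QuotientGroup.mk g : _ ⧸ OPG) = 1 ∨ (QuotientGroup.mk g : _ ⧸ OPG) = QuotientGroup.mk negC⁻¹ := by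
    intro g
    rcases lift_or g with h | h
    · left; exact (QuotientGroup.eq_one_iff g).2 h
    · right
      have h := (QuotientGroup.eq_one_iff _).2 (show negC * g ∈ OPG from h)
      rw [QuotientGroup.mk_mul] at h
      rw [QuotientGroup.mk_inv]
      exact (inv_eq_of_mul_eq_one_right h).symm
  rw [← QuotientGroup.eq_one_iff]
  show (QuotientGroup.mk' OPG) ⁅a, b⁆ = 1
  rw [map_commutatorElement, commutatorElement_eq_one_iff_mul_comm]
  rcases q a with h | h <;> rcases q b with h' | h' <;> simp only [QuotientGroup.mk'_apply, h, h', one_mul, mul_one]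

theorem lifts_of_perf {Γ : Type*} [Group Γ] (Φ : Γ →* (Circle' ≃ₜ Circle')) (hp : ∀ γ : Γ, γ ∈ commutator Γ) (γ : Γ) : ∃ u, IsLift u (Φ γ) := by
  suffices h : commutator Γ ≤ OPG.comap Φ from h (hp γ)
  rw [commutator_def, Subgroup.commutator_le]
  intro a _ b _
  rw [Subgroup.mem_comap, map_commutatorElement]
  exact OPG_comm _ _
end GR

namespace GR
open Set
section
variable {σ : ℤ → ℤ} {G : Subgroup (ℝ ≃o ℝ)}

theorem fin_fr (B : ℕ) : Set.Finite {x : Fr | |x.n| ≤ B} := by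
  refine ((Set.finite_Icc (-(B:ℤ)) B).prod (Set.toFinite (univ : Set ℤˣ))).preimage (f := fun x : Fr => (x.n, x.e)) ?_ |>.subset ?_
  · intro x _ y _ e; simp at e; ext; exact e.1; exact congrArg _ e.2
  · intro x hx; simpa using abs_le.1 hx

theorem exists_q (p ε : ℝ) (hε : 0 < ε) : ∃ q : ℝ, IsDyadic q ∧ |q - p| < ε ∧ ∀ x y : Fr, ph x q = ph y q → x = y := by
  obtain ⟨N, hN⟩ := exists_pow_lt_of_lt_one hε (by norm_num : (1/2:ℝ) < 1)
  set j := ⌊p * 2 ^ (N + 1)⌋ with hj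
  have j1 : (j:ℝ) ≤ p * 2 ^ (N + 1) := Int.floor_le _
  have j2 : p * 2 ^ (N + 1) < j + 1 := Int.lt_floor_add_one _
  have pos : (0:ℝ) < 2 ^ N := by positivity
  refine ⟨((2 * j + 1 : ℤ) : ℝ) / 2 ^ (N + 2), ⟨_, _, rfl⟩, ?_, ?_⟩
  · have h1 : |((2 * j + 1 : ℤ) : ℝ) / 2 ^ (N + 2) - p| ≤ (1/2) ^ N := by
      rw [div_pow, one_pow, abs_le, le_sub_iff_add_le, sub_le_iff_le_add]
      rw [pow_succ] at j1 j2
      rw [pow_add]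
      constructor
      · rw [← sub_nonneg]
        have : ((2 * j + 1 : ℤ) : ℝ) / (2 ^ N * 2 ^ 2) - (-(1 / 2 ^ N) + p) = (2 * j + 1 + 4 - 4 * (p * 2 ^ N)) / (2 ^ N * 4) := by
          field_simp; push_cast; ring
        rw [this]; apply div_nonneg _ (by positivity); linarith
      · rw [← sub_nonneg]
        have : (1 / 2 ^ N + p) - ((2 * j + 1 : ℤ) : ℝ) / (2 ^ N * 2 ^ 2) = (4 + 4 * (p * 2 ^ N) - (2 * j + 1)) / (2 ^ N * 4) := by
          field_simp; push_cast; ring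
        rw [this]; apply div_nonneg _ (by positivity); linarith
    linarith
  · have key : ∀ m : ℤ, 2 * (((2 * j + 1 : ℤ) : ℝ) / 2 ^ (N + 2)) ≠ m := by
      intro m h
      have : ((2 * j + 1 : ℤ) : ℝ) = m * 2 ^ (N + 1) := by
        rw [← h, pow_succ _ (N+1)]; field_simp
      have : 2 * j + 1 = m * 2 ^ (N + 1) := by exact_mod_cast this
      rw [pow_succ, ← mul_assoc] at this
      omega
    generalize ((2 * j + 1 : ℤ) : ℝ) / 2 ^ (N + 2) = q at key
    intro x y h
    rcases x.cases with e | e <;> rcases y.cases with e' | e' <;> simp [ph, e, e'] at h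
    · exact Fr.ext h (by rw [e, e'])
    · exact absurd (show 2 * q = ((y.n - x.n : ℤ) : ℝ) by push_cast; linarith) (key _)
    · exact absurd (show 2 * q = ((x.n - y.n : ℤ) : ℝ) by push_cast; linarith) (key _)
    · exact Fr.ext h (by rw [e, e'])

def bt (a b t : ℝ) : Prop := (a < t ∧ t < b) ∨ (b < t ∧ t < a)

theorem bt_iff {a b t : ℝ} : t ∈ Ioo (min a b) (max a b) ↔ bt a b t := by
  rcases le_total a b with h | h <;> simp [h, bt] <;> intro h1 h2 <;> linarith

theorem bt_ph (x : Fr) {a b t : ℝ} : bt (ph x a) (ph x b) (ph x t) ↔ bt a b t := by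
  rcases x.cases with e | e <;> simp only [ph, e, bt] <;> push_cast <;> constructor <;> rintro (⟨h1, h2⟩ | ⟨h1, h2⟩) <;>
    first
    | exact Or.inl ⟨by linarith, by linarith⟩
    | exact Or.inr ⟨by linarith, by linarith⟩

theorem gap_eq {a b c d y : ℝ} (h1 : bt a b y) (h2 : bt c d y) (h3 : ¬ bt a b c) (h4 : ¬ bt a b d) (h5 : ¬ bt c d a) (h6 : ¬ bt c d b) :
    (a = c ∧ b = d) ∨ (a = d ∧ b = c) := by
  unfold bt at *
  push Not at *
  grind

def ZZ (σ : ℤ → ℤ) (T : ℕ) : Set Fr := {x | agree σ T x 1}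

noncomputable def wd (σ : ℤ → ℤ) (R : ℕ) (x : Fr) : Finset ℤ := (Finset.Icc (-(R:ℤ)) R).filter (fun i => V σ x i = 1)

theorem wd_of_agree {R : ℕ} {x y : Fr} (h : agree σ R x y) : wd σ R x = wd σ R y := by
  apply Finset.filter_congr
  intro i hi
  rw [Finset.mem_Icc] at hi
  rw [h i (abs_le.2 hi)]

theorem V_sgn (S : Setup σ G) (x : Fr) (i : ℤ) : V σ x i = 1 ∨ V σ x i = -1 := by
  unfold V
  rcases x.cases with e | e <;> rcases S.sgn (2 * x.n + x.e * i) with h | h <;> rw [h, e] <;> simp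

theorem agree_of_wd (S : Setup σ G) {R : ℕ} {x y : Fr} (h : wd σ R x = wd σ R y) : agree σ R x y := by
  intro i hi
  have := congrArg (fun s => i ∈ s) h
  simp only [wd, Finset.mem_filter, Finset.mem_Icc, abs_le.1 hi, true_and, and_self, eq_iff_iff] at this
  rcases V_sgn S x i with h1 | h1 <;> rcases V_sgn S y i with h2 | h2 <;> rw [h1, h2] at this ⊢ <;> simp at this

def QQ (σ : ℤ → ℤ) (T R : ℕ) (q : ℝ) (k : Fr × Finset ℤ) : Set Fr :=
  {x | x ∈ ZZ σ T ∧ x * k.1 ∈ ZZ σ T ∧ (∀ w, x * w ∈ ZZ σ T → ¬ bt q (ph k.1 q) (ph w q)) ∧ wd σ R x = k.2 ∧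
    WellOrderingRel k (k.1⁻¹, wd σ R (x * k.1))}

theorem QQ_gap {T R : ℕ} {q : ℝ} (hq : ∀ x y : Fr, ph x q = ph y q → x = y) {k k' x y s t}
    (hx : x ∈ QQ σ T R q k) (hy : y ∈ QQ σ T R q k') (hs : bt q (ph k.1 q) s) (ht : bt q (ph k'.1 q) t) (e : ph x s = ph y t) :
    k = k' ∧ x = y := by
  obtain ⟨x1, x2, x3, x4, x5⟩ := hx
  obtain ⟨y1, y2, y3, y4, y5⟩ := hy
  have nx : ∀ w ∈ ZZ σ T, ¬ bt (ph x q) (ph (x * k.1) q) (ph w q) := by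
    intro w hw h
    refine x3 (x⁻¹ * w) (by simpa using hw) ?_
    rw [← bt_ph x, ← ph_mul, ← ph_mul]; simpa using h
  have ny : ∀ w ∈ ZZ σ T, ¬ bt (ph y q) (ph (y * k'.1) q) (ph w q) := by
    intro w hw h
    refine y3 (y⁻¹ * w) (by simpa using hw) ?_
    rw [← bt_ph y, ← ph_mul, ← ph_mul]; simpa using h
  rw [← bt_ph x, ← ph_mul] at hs
  rw [← bt_ph y, ← ph_mul, ← e] at ht
  rcases gap_eq hs ht (nx y y1) (nx _ y2) (ny x x1) (ny _ x2) with ⟨h1, h2⟩ | ⟨h1, h2⟩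
  · have h1 := hq _ _ h1
    have h2 := hq _ _ h2
    subst h1
    refine ⟨Prod.ext (mul_left_cancel h2) (x4.symm.trans y4), rfl⟩
  · have h1 := hq _ _ h1
    have h2 := hq _ _ h2
    exfalso
    have e1 : k'.1 = k.1⁻¹ := by
      rw [h1, mul_assoc] at h2
      have := mul_eq_left.1 h2
      exact eq_inv_of_mul_eq_one_left this
    have e2 : k' = (k.1⁻¹, wd σ R (x * k.1)) := Prod.ext e1 (by rw [← y4, h2])
    have e3 : k = (k'.1⁻¹, wd σ R (y * k'.1)) := Prod.ext (by rw [e1, inv_inv]) (by rw [← x4, h1])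
    rw [← e2] at x5
    rw [← e3] at y5
    exact asymm_of WellOrderingRel x5 y5

theorem QQ_clopen {T R : ℕ} {q : ℝ} (k : Fr × Finset ℤ) : Clopen σ (QQ σ T R q k) := by
  set A : ℕ := ⌈|q|⌉₊ + ⌈|ph k.1 q|⌉₊ + ⌈|q|⌉₊ with hA
  set E : ℕ := A + k.1.n.natAbs with hE
  refine ⟨T + R + 2 * E, fun x y hxy ⟨x1, x2, x3, x4, x5⟩ => ?_⟩
  have mul : ∀ d : Fr, d.n.natAbs ≤ E → agree σ (T + R) (x * d) (y * d) := fun d hd => (hxy.mono (by omega)).mul d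
  have hk := mul k.1 (by omega)
  refine ⟨(hxy.symm.mono (by omega)).trans x1, (hk.symm.mono (by omega)).trans x2, fun w hw hb => ?_, ?_, ?_⟩
  · refine x3 w (((mul w ?_).mono (by omega)).trans hw) hb
    have a1 := Nat.le_ceil |q|
    have a2 := Nat.le_ceil |ph k.1 q|
    have b1 := abs_le.1 (le_refl |q|)
    have b2 := abs_le.1 (le_refl |ph k.1 q|)
    have key : |(w.n:ℝ)| ≤ A := by
      rw [hA]; push_cast
      rw [abs_le]
      rcases w.cases with e | e <;> simp only [bt] at hb <;> simp only [ph, e] at hb a2 b2 ⊢ <;> push_cast at hb ⊢ <;>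
        rcases hb with ⟨h1, h2⟩ | ⟨h1, h2⟩ <;> constructor <;> linarith
    have : |w.n| ≤ (A:ℤ) := by exact_mod_cast key
    rw [abs_le] at this
    omega
  · rw [← x4]; exact (wd_of_agree (hxy.mono (by omega))).symm
  · rw [← wd_of_agree (hk.mono (by omega))]; exact x5

theorem comm_disj {a b : ℝ ≃o ℝ} (h : ∀ y, a y = y ∨ b y = y) : Commute a b := by
  ext y
  rw [RelIso.mul_apply, RelIso.mul_apply]
  rcases h y with h1 | h1
  · rcases h (b y) with h2 | h2
    · rw [h2, h1]
    · have := b.injective h2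
      rw [this, h1, this]
  · rcases h (a y) with h2 | h2
    · have := a.injective h2
      rw [h1, this, h1]
    · rw [h2, h1]

/-- covering of the complement of the marked points -/
theorem cover (S : Setup σ G) (T : ℕ) (q : ℝ) (hq : ∀ x y : Fr, ph x q = ph y q → x = y) :
    ∃ D : ℕ, ∀ R, D ≤ R → ∀ y : ℝ, (∃ x ∈ ZZ σ T, ph x q = y) ∨ ∃ k : Fr × Finset ℤ, |k.1.n| ≤ D ∧ k.2 ⊆ Finset.Icc (-(R:ℤ)) R ∧
      ∃ x ∈ QQ σ T R q k, ∃ t, bt q (ph k.1 q) t ∧ ph x t = y := by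
  obtain ⟨B, hB⟩ := S.recur T 1
  set Lq := ⌈|q|⌉₊ with hLq
  have a1 : |q| ≤ Lq := Nat.le_ceil |q|
  rw [abs_le] at a1
  set K : ℕ := B + Lq + 1 with hK
  set C : ℕ := 2 * K + 1 with hC
  refine ⟨2 * C + 2 * Lq, fun R hR y => ?_⟩
  by_cases hy : ∃ x ∈ ZZ σ T, ph x q = y
  · exact Or.inl hy
  right
  push Not at hy
  have phn : ∀ x : Fr, |(x.n:ℝ) - ph x q| ≤ Lq := by
    intro x
    rw [abs_le]
    rcases x.cases with e | e <;> simp only [ph, e] <;> push_cast <;> constructor <;> linarith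
  have fl1 := Int.floor_le y
  have fl2 := Int.lt_floor_add_one y
  have fin : ∀ P : Set Fr, (∀ x ∈ P, |ph x q - y| ≤ C) → P.Finite := by
    intro P hP
    refine (fin_fr (⌈|y|⌉₊ + C + Lq)).subset fun x hx => ?_
    have h1 := abs_le.1 (hP x hx)
    have h2 := abs_le.1 (phn x)
    have h3 := Nat.le_ceil |y|
    have h4 := abs_le.1 (le_refl |y|)
    have : |(x.n:ℝ)| ≤ (⌈|y|⌉₊ + C + Lq : ℕ) := by
      push_cast; rw [abs_le]; constructor <;> linarith
    show |x.n| ≤ _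
    exact_mod_cast this
  have Kr : (K:ℝ) = B + Lq + 1 := by rw [hK]; push_cast; ring
  have Cr : (C:ℝ) = 2 * K + 1 := by rw [hC]; push_cast; ring
  have B0 : (0:ℝ) ≤ B := by positivity
  have L0 : (0:ℝ) ≤ Lq := by positivity
  obtain ⟨x1, ⟨m1, m2, m3⟩, hx1⟩ := Set.exists_max_image {x | x ∈ ZZ σ T ∧ y - C ≤ ph x q ∧ ph x q < y} (fun x => ph x q)
    (fin _ (fun x hx => by obtain ⟨_, h1, h2⟩ := hx; rw [abs_le]; constructor <;> linarith)) (by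
      obtain ⟨x, h1, h2⟩ := hB (⌊y⌋ - K)
      have h2 : |(x.n:ℝ) - (⌊y⌋ - K)| ≤ B := by exact_mod_cast h2
      have h2 := abs_le.1 h2
      have h3 := abs_le.1 (phn x)
      exact ⟨x, h1, by linarith, by linarith⟩)
  obtain ⟨x2, ⟨n1, n2, n3⟩, hx2⟩ := Set.exists_min_image {x | x ∈ ZZ σ T ∧ ph x q ≤ y + C ∧ y < ph x q} (fun x => ph x q)
    (fin _ (fun x hx => by obtain ⟨_, h1, h2⟩ := hx; rw [abs_le]; constructor <;> linarith)) (by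
      obtain ⟨x, h1, h2⟩ := hB (⌊y⌋ + K)
      have h2 : |(x.n:ℝ) - (⌊y⌋ + K)| ≤ B := by exact_mod_cast h2
      have h2 := abs_le.1 h2
      have h3 := abs_le.1 (phn x)
      exact ⟨x, h1, by linarith, by linarith⟩)
  have nob : ∀ w ∈ ZZ σ T, ¬ bt (ph x1 q) (ph x2 q) (ph w q) := by
    rintro w hw (⟨h1, h2⟩ | ⟨h1, h2⟩)
    · rcases lt_trichotomy (ph w q) y with h | h | h
      · have := hx1 w ⟨hw, by linarith, h⟩
        linarith
      · exact hy w hw h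
      · have := hx2 w ⟨hw, by linarith, h⟩
        linarith
    · linarith
  -- symmetric statement for both ordered pairs
  have sym : ∀ a b : Fr, a ∈ ZZ σ T → b ∈ ZZ σ T → |ph a q - ph b q| ≤ 2 * C → (∀ w ∈ ZZ σ T, ¬ bt (ph a q) (ph b q) (ph w q)) →
      bt (ph a q) (ph b q) y → WellOrderingRel (a⁻¹ * b, wd σ R a) (b⁻¹ * a, wd σ R b) →
      ∃ k : Fr × Finset ℤ, |k.1.n| ≤ (2 * C + 2 * Lq : ℕ) ∧ k.2 ⊆ Finset.Icc (-(R:ℤ)) R ∧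
      ∃ x ∈ QQ σ T R q k, ∃ t, bt q (ph k.1 q) t ∧ ph x t = y := by
    intro a b ha hb hd hn hby hw
    refine ⟨(a⁻¹ * b, wd σ R a), ?_, Finset.filter_subset _ _, a, ⟨ha, by simpa using hb, ?_, rfl, ?_⟩, ph a⁻¹ y, ?_, by simp⟩
    · have h1 : |ph (a⁻¹ * b) q - q| ≤ 2 * C := by
        rw [← ph_abs a, ← ph_mul, mul_inv_cancel_left, abs_sub_comm]; exact hd
      have h1 := abs_le.1 h1
      have h2 := abs_le.1 (phn (a⁻¹ * b))
      have : |((a⁻¹ * b).n:ℝ)| ≤ (2 * C + 2 * Lq : ℕ) := by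
        push_cast; rw [abs_le]; constructor <;> linarith
      exact_mod_cast this
    · intro w hw h
      rw [← bt_ph a, ← ph_mul, ← ph_mul, mul_inv_cancel_left] at h
      exact hn _ hw h
    · simpa using hw
    · rw [← bt_ph a, ← ph_mul, mul_inv_cancel_left, ph_ph_inv]; exact hby
  have hd : |ph x1 q - ph x2 q| ≤ 2 * C := by rw [abs_le]; constructor <;> linarith
  have bts : ∀ {a b t}, bt a b t ↔ bt b a t := fun {a b t} => by unfold bt; tauto
  rcases trichotomous_of WellOrderingRel ((x1⁻¹ * x2, wd σ R x1) : Fr × Finset ℤ) (x2⁻¹ * x1, wd σ R x2) with h | h | h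
  · exact sym x1 x2 m1 n1 hd nob (Or.inl ⟨m3, n3⟩) h
  · exfalso
    obtain ⟨h1, h2⟩ := Prod.mk.inj h
    have ag := agree_of_wd S h2
    set δ := x1⁻¹ * x2 with hδ
    have e2 : x2 = x1 * δ := by simp [hδ]
    have e3 : δ = δ⁻¹ := h1.trans (by rw [hδ]; simp)
    rw [e2] at ag
    have b1 : |δ.n| ≤ (2 * C + 2 * Lq : ℕ) := by
      have h1 : |ph δ q - q| ≤ 2 * C := by
        rw [← ph_abs x1, ← ph_mul, ← e2, abs_sub_comm]; exact hd
      have h1 := abs_le.1 h1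
      have h2 := abs_le.1 (phn δ)
      have : |(δ.n:ℝ)| ≤ (2 * C + 2 * Lq : ℕ) := by
        push_cast; rw [abs_le]; constructor <;> linarith
      exact_mod_cast this
    rcases δ.cases with e | e
    · have : δ * δ = 1 := by nth_rewrite 1 [e3]; simp
      have := congrArg Fr.n this
      simp [e] at this
      have : δ = 1 := Fr.ext (by simp; omega) e
      rw [this, mul_one] at e2
      rw [e2] at n3; linarith
    · have := ag δ.n (by omega)
      rw [V_mul, e] at this
      push_cast at this
      rw [show 2 * δ.n + -1 * δ.n = δ.n by ring] at this
      rcases V_sgn S x1 δ.n with h | h <;> rw [h] at this <;> omega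
  · exact sym x2 x1 n1 m1 (by rwa [abs_sub_comm]) (fun w hw => by rw [bts]; exact nob w hw) (Or.inr ⟨m3, n3⟩) h
end
end GR

namespace GR
open Set
section
variable {σ : ℤ → ℤ} {G : Subgroup (ℝ ≃o ℝ)}

theorem dyadic_ph {q : ℝ} (hq : IsDyadic q) (x : Fr) : IsDyadic (ph x q) := by
  have hn : IsDyadic (x.n : ℝ) := ⟨x.n, 0, by simp⟩
  rcases x.cases with e | e <;> simp only [ph, e] <;> push_cast
  · rw [one_mul]; exact hn.add hq
  · rw [neg_one_mul]; exact hn.add hq.neg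

theorem R1_fin (S : Setup σ G) {Φ : G →* (Circle' ≃ₜ Circle')} (hΦ : ∀ γ, ∃ u, IsLift u (Φ γ)) (p ε : ℝ) (hε : 0 < ε) (s : Finset G)
    (hs : ∀ g ∈ s, ∀ t, |t - p| < ε → (g : ℝ ≃o ℝ) t = t) : ∃ x : Circle', ∀ g ∈ s, Φ g x = x := by
  choose r0 _ hr0 using fun g : G => G_loc S g.2
  set r := s.sup r0 with hr
  have hloc : ∀ g ∈ s, ∀ (L : ℕ) (x y : Fr), agree σ (2 * L + r) x y → ∀ t : ℝ, |t| ≤ L → cj x g t = cj y (g : ℝ ≃o ℝ) t := by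
    intro g hg L x y hxy
    have : r0 g ≤ r := Finset.le_sup hg
    exact hr0 g L x y (hxy.mono (by omega))
  obtain ⟨q, qd, hqp, hq⟩ := exists_q p ε hε
  have a1 : |q| ≤ ⌈|q|⌉₊ := Nat.le_ceil |q|
  set Lq := ⌈|q|⌉₊ with hLq
  set T := 2 * (Lq + 1) + r with hT
  set η := min (ε - |q - p|) 1 with hη
  have η0 : 0 < η := lt_min (by linarith) one_pos
  have nearq : ∀ x ∈ ZZ σ T, ∀ g ∈ s, ∀ t, |t - q| < η → cj x (g : ℝ ≃o ℝ) t = t := by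
    intro x hx g hg t ht
    have h1 : |t - q| < 1 := ht.trans_le (min_le_right _ _)
    have h2 : |t - q| < ε - |q - p| := ht.trans_le (min_le_left _ _)
    rw [hloc g hg (Lq + 1) x 1 hx t, cj_one]
    · apply hs g hg
      have := abs_sub_le t q p
      linarith
    · have h3 := abs_add_le (t - q) q
      rw [sub_add_cancel] at h3
      push_cast; linarith
  obtain ⟨D, hD⟩ := cover S T q hq
  set L := D + Lq with hL
  set R := D + (2 * L + r) with hR
  have hcov := hD R (by omega)
  set U : Fr × Finset ℤ → ℝ := fun k => min q (ph k.1 q) with hU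
  set W : Fr × Finset ℤ → ℝ := fun k => max q (ph k.1 q) with hW
  -- the subgroups
  have hSS : ∀ k, SS G (QQ σ T R q k) (U k) (W k) := by
    intro k
    rcases (min_le_max : U k ≤ W k).lt_or_eq with h | h
    · refine thmD S (QQ_clopen k) h fun x hx y hy s hs t ht e => ?_
      exact (QQ_gap hq hx hy (bt_iff.1 hs) (bt_iff.1 ht) e).2
    · intro f hf
      refine ⟨1, one_mem _, fun x hx t ht => ?_, fun _ _ => rfl⟩
      have := ht.1.trans ht.2
      linarith
  let K : Fr × Finset ℤ → Subgroup G := fun k => (hSS k).hom.range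
  have finK : {k : Fr × Finset ℤ | |k.1.n| ≤ D ∧ k.2 ⊆ Finset.Icc (-(R:ℤ)) R}.Finite := by
    refine ((fin_fr D).prod (Finset.Icc (-(R:ℤ)) R).powerset.finite_toSet).subset ?_
    rintro ⟨a, b⟩ ⟨h1, h2⟩
    exact ⟨h1, Finset.mem_coe.2 (Finset.mem_powerset.2 h2)⟩
  have off : ∀ k (f : Fc (U k) (W k)) y, (∀ x ∈ QQ σ T R q k, ∀ t, bt q (ph k.1 q) t → y ≠ ph x t) → ((hSS k).hom f : ℝ ≃o ℝ) y = y := by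
    intro k f y hy
    exact ((hSS k).hom_spec f).2 y fun x hx t ht => hy x hx t (bt_iff.1 ht)
  obtain ⟨z, hz⟩ := fix_family hΦ K finK.toFinset (by
    rintro i - j - hij _ ⟨f, rfl⟩ _ ⟨f', rfl⟩
    apply Subtype.ext
    apply (comm_disj _).eq
    intro y
    by_cases h : ∀ x ∈ QQ σ T R q i, ∀ t, bt q (ph i.1 q) t → y ≠ ph x t
    · exact Or.inl (off i f y h)
    · refine Or.inr (off j f' y fun x' hx' t' ht' e' => ?_)
      push Not at h
      obtain ⟨x, hx, t, ht, e⟩ := h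
      exact hij (QQ_gap hq hx hx' ht ht' (e.symm.trans e')).1) (fun k _ => range_fix hΦ (hSS k))
  refine ⟨z, fun g hg => ?_⟩
  have hgD : InD (g : ℝ ≃o ℝ) := G_inD S g.2
  -- pieces of g
  have piece : ∀ k, |k.1.n| ≤ (D:ℤ) → ∃ a ∈ K k, ∀ x ∈ QQ σ T R q k, ∀ t, bt q (ph k.1 q) t → (a : ℝ ≃o ℝ) (ph x t) = (g : ℝ ≃o ℝ) (ph x t) := by
    intro k hk
    by_cases hne : (QQ σ T R q k).Nonempty
    · obtain ⟨x, hx⟩ := hne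
      set F := cj x (g : ℝ ≃o ℝ) with hF
      have n1 : ∀ t, |t - q| < η → F t = t := nearq x hx.1 g hg
      have n2 : ∀ t, |t - ph k.1 q| < η → F t = t := by
        intro t ht
        have := nearq _ hx.2.1 g hg (ph k.1⁻¹ t) (by rw [← ph_abs k.1, ph_ph_inv]; exact ht)
        rw [cj_mul, cj_eq, ph_ph_inv] at this
        exact this
      have n3 : ∀ t, |t - U k| < η → F t = t := by
        intro t
        rcases min_choice q (ph k.1 q) with h | h <;> simp only [hU, h]
        · exact n1 t
        · exact n2 t
      have n4 : ∀ t, |t - W k| < η → F t = t := by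
        intro t
        rcases max_choice q (ph k.1 q) with h | h <;> simp only [hW, h]
        · exact n1 t
        · exact n2 t
      have dU : IsDyadic (U k) := by
        rcases min_choice q (ph k.1 q) with h | h <;> simp only [hU, h]
        · exact qd
        · exact dyadic_ph qd _
      have dW : IsDyadic (W k) := by
        rcases max_choice q (ph k.1 q) with h | h <;> simp only [hW, h]
        · exact qd
        · exact dyadic_ph qd _
      obtain ⟨f, f1, f2, f3⟩ := exists_trunc (n3 (U k) (by simpa using η0)) (n4 (W k) (by simpa using η0))
      have hf : f ∈ Fc (U k) (W k) := by
        refine ⟨f3 (hgD.cj x) dU dW, U k + η / 2, W k - η / 2, by linarith, by linarith, fun t ht => ?_, fun t ht => ?_⟩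
        · by_cases h : t ∈ Ioo (U k) (W k)
          · rw [f1 t ⟨h.1.le, h.2.le⟩]
            apply n3
            rw [abs_lt]; constructor <;> linarith [h.1]
          · exact f2 t h
        · by_cases h : t ∈ Ioo (U k) (W k)
          · rw [f1 t ⟨h.1.le, h.2.le⟩]
            apply n4
            rw [abs_lt]; constructor <;> linarith [h.2]
          · exact f2 t h
      refine ⟨(hSS k).hom ⟨f, hf⟩, ⟨_, rfl⟩, fun x' hx' t ht => ?_⟩
      have ht' := bt_iff.2 ht
      have sp := ((hSS k).hom_spec ⟨f, hf⟩).1 x' hx' t ht'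
      have ag : agree σ (2 * L + r) x x' := (agree_of_wd S (hx.2.2.2.1.trans hx'.2.2.2.1.symm)).mono (by omega)
      have tb : |t| ≤ L := by
        have h1 := abs_le.1 a1
        have h2 : |(k.1.n:ℝ)| ≤ D := by exact_mod_cast hk
        have h2 := abs_le.1 h2
        have d0 : (0:ℝ) ≤ D := by positivity
        rw [hL]; push_cast
        rw [abs_le]
        rcases k.1.cases with e | e <;> simp only [bt, ph, e] at ht <;> push_cast at ht <;>
          rcases ht with ⟨h3, h4⟩ | ⟨h3, h4⟩ <;> constructor <;> linarith
      have := hloc g hg L x x' ag t tb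
      simp only at sp
      rw [f1 t ⟨ht'.1.le, ht'.2.le⟩, hF, this] at sp
      rw [cj_eq, ph_cj] at sp
      exact sp
    · exact ⟨1, one_mem _, fun x hx => absurd ⟨x, hx⟩ hne⟩
  have assemble : ∀ A : Finset (Fr × Finset ℤ), A ⊆ finK.toFinset → ∃ h ∈ FixS Φ z,
      (∀ k ∈ A, ∀ x ∈ QQ σ T R q k, ∀ t, bt q (ph k.1 q) t → (h : ℝ ≃o ℝ) (ph x t) = (g : ℝ ≃o ℝ) (ph x t)) ∧
      ∀ y, (∀ k ∈ A, ∀ x ∈ QQ σ T R q k, ∀ t, bt q (ph k.1 q) t → y ≠ ph x t) → (h : ℝ ≃o ℝ) y = y := by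
    classical
    intro A
    induction A using Finset.induction_on with
    | empty => exact fun _ => ⟨1, one_mem _, by simp, fun y _ => rfl⟩
    | insert i A hi ih =>
      intro hA
      obtain ⟨h, h1, h2, h3⟩ := ih fun k hk => hA (by simp [hk])
      have hi' : i ∈ finK.toFinset := hA (by simp)
      have hin := (finK.mem_toFinset.1 hi').1
      obtain ⟨a, a1, a2⟩ := piece i hin
      have aoff : ∀ y, (∀ x ∈ QQ σ T R q i, ∀ t, bt q (ph i.1 q) t → y ≠ ph x t) → (a : ℝ ≃o ℝ) y = y := by
        obtain ⟨f, rfl⟩ := a1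
        exact off i f
      -- a preserves its support
      refine ⟨h * a, mul_mem h1 (hz i hi' a1), fun k hk x hx t ht => ?_, fun y hy => ?_⟩
      · show (h : ℝ ≃o ℝ) ((a : ℝ ≃o ℝ) (ph x t)) = _
        rcases Finset.mem_insert.1 hk with rfl | hk'
        · rw [← a2 x hx t ht]
          apply h3
          intro k' hk' x' hx' t' ht' e
          by_cases hh : ∀ x'' ∈ QQ σ T R q k, ∀ t₂, bt q (ph k.1 q) t₂ → (a : ℝ ≃o ℝ) (ph x t) ≠ ph x'' t₂
          · have := (a : ℝ ≃o ℝ).injective (aoff _ hh)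
            exact hh x hx t ht this
          · push Not at hh
            obtain ⟨x'', hx'', t'', ht'', e''⟩ := hh
            have := (QQ_gap hq hx'' hx' ht'' ht' (e''.symm.trans e)).1
            exact hi (this ▸ hk')
        · rw [aoff (ph x t), h2 k hk' x hx t ht]
          intro x' hx' t' ht' e
          have := (QQ_gap hq hx hx' ht ht' e).1
          exact hi (this ▸ hk')
      · show (h : ℝ ≃o ℝ) ((a : ℝ ≃o ℝ) y) = y
        rw [aoff y (hy i (by simp)), h3 y fun k hk => hy k (by simp [hk])]
  obtain ⟨h, h1, h2, h3⟩ := assemble finK.toFinset subset_rfl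
  have : h = g := by
    ext y
    by_cases hy : ∀ k ∈ finK.toFinset, ∀ x ∈ QQ σ T R q k, ∀ t, bt q (ph k.1 q) t → y ≠ ph x t
    · rw [h3 y hy]
      rcases hcov y with ⟨x, hx, rfl⟩ | ⟨k, k1, k2, x, hx, t, ht, rfl⟩
      · have := nearq x hx g hg q (by simpa using η0)
        rw [cj_eq] at this
        exact this.symm
      · exact absurd rfl (hy k (finK.mem_toFinset.2 ⟨k1, k2⟩) x hx t ht)
    · push Not at hy
      obtain ⟨k, hk, x, hx, t, ht, rfl⟩ := hy
      exact h2 k hk x hx t ht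
  rw [← this]
  exact h1

theorem R1 (S : Setup σ G) {Φ : G →* (Circle' ≃ₜ Circle')} (hΦ : ∀ γ, ∃ u, IsLift u (Φ γ)) (p : ℝ) :
    ∃ x : Circle', ∀ g : G, (∃ ε > 0, ∀ t, |t - p| < ε → (g : ℝ ≃o ℝ) t = t) → Φ g x = x := by
  let I := {g : G // ∃ ε > 0, ∀ t, |t - p| < ε → (g : ℝ ≃o ℝ) t = t}
  have := CompactSpace.iInter_nonempty (X := Circle') (ι := I) (t := fun g => {x | Φ g.1 x = x})
    (fun g => isClosed_eq (Φ g.1).continuous continuous_id) (fun s => by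
      classical
      choose e he h using fun g : I => g.2
      obtain ⟨ε, hε, hle⟩ : ∃ ε > 0, ∀ g ∈ s, ε ≤ e g := by
        rcases s.eq_empty_or_nonempty with rfl | hne
        · exact ⟨1, one_pos, by simp⟩
        · obtain ⟨g, hg, hm⟩ := s.exists_min_image e hne
          exact ⟨e g, he g, hm⟩
      obtain ⟨x, hx⟩ := R1_fin S hΦ p ε hε (s.image Subtype.val) (by
        intro g hg t ht
        obtain ⟨g', hg', rfl⟩ := Finset.mem_image.1 hg
        exact h g' t (ht.trans_le (hle g' hg')))
      refine ⟨x, ?_⟩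
      simp only [mem_iInter]
      exact fun g hg => hx g.1 (Finset.mem_image_of_mem _ hg))
  obtain ⟨x, hx⟩ := this
  rw [mem_iInter] at hx
  exact ⟨x, fun g hg => hx ⟨g, hg⟩⟩
end
end GR

namespace GR
open Set Filter Topology

section
variable {σ : ℤ → ℤ} {G : Subgroup (ℝ ≃o ℝ)}

/-- `g` and `h` have the same germ at `q` -/
def Eqn (g h : G) (q : ℝ) : Prop := ∀ᶠ t in 𝓝 q, (g : ℝ ≃o ℝ) t = (h : ℝ ≃o ℝ) t

/-- lifts with translation number zero -/
def Lz (Φ : G →* (Circle' ≃ₜ Circle')) (g : G) (u : UL) : Prop := IsLift u (Φ g) ∧ tau u = 0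

theorem Eqn.inv_mul {g h : G} {q : ℝ} (e : Eqn g h q) : Eqn (h⁻¹ * g) 1 q := by
  filter_upwards [e] with t ht
  show (h : ℝ ≃o ℝ).symm ((g : ℝ ≃o ℝ) t) = t
  rw [ht, OrderIso.symm_apply_apply]

theorem Eqn.one_mul {g h : G} {q : ℝ} (e : Eqn g 1 q) (e' : Eqn h 1 q) : Eqn (g * h) 1 q := by
  filter_upwards [e, e'] with t ht ht'
  show (g : ℝ ≃o ℝ) ((h : ℝ ≃o ℝ) t) = t
  have ht : (g : ℝ ≃o ℝ) t = t := ht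
  have ht' : (h : ℝ ≃o ℝ) t = t := ht'
  rw [ht', ht]

theorem Eqn.one_inv {g : G} {q : ℝ} (e : Eqn g 1 q) : Eqn g⁻¹ 1 q := by
  filter_upwards [e] with t ht
  show (g : ℝ ≃o ℝ).symm t = t
  have ht : (g : ℝ ≃o ℝ) t = t := ht
  rw [OrderIso.symm_apply_eq, ht]

theorem final (S : Setup σ G) (Φ : G →* (Circle' ≃ₜ Circle')) (hΦ : ∀ γ, ∃ u, IsLift u (Φ γ)) :
    ∃ x : Circle', ∀ g : G, Φ g x = x := by
  have fixpt : ∀ p : ℝ, ∃ x : ℝ, ∀ g : G, Eqn g 1 p → Φ g (x : Circle') = x := by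
    intro p
    obtain ⟨x, hx⟩ := R1 S hΦ p
    obtain ⟨x, rfl⟩ := coe_surj x
    refine ⟨x, fun g hg => hx g ?_⟩
    obtain ⟨ε, hε, h⟩ := Metric.eventually_nhds_iff.1 hg
    exact ⟨ε, hε, fun t ht => h (by rwa [Real.dist_eq])⟩
  have exL : ∀ {g : G} {q}, Eqn g 1 q → ∃ u, Lz Φ g u := by
    intro g q hg
    obtain ⟨x, hx⟩ := fixpt q
    obtain ⟨u, hu⟩ := hΦ g
    obtain ⟨v, h1, h2⟩ := exists_lift_at hu (hx g hg)
    exact ⟨v, h1, tau_fix h2⟩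
  have mulL : ∀ {g h : G} {q u v}, Eqn g 1 q → Eqn h 1 q → Lz Φ g u → Lz Φ h v → Lz Φ (g * h) (u * v) := by
    intro g h q u v hg hh hu hv
    obtain ⟨x, hx⟩ := fixpt q
    refine ⟨by rw [map_mul]; exact hu.1.mul hv.1, tau_fix (x := x) ?_⟩
    rw [ul_mul, l0_fix hv.1 hv.2 (hx h hh), l0_fix hu.1 hu.2 (hx g hg)]
  have invL : ∀ {g : G} {u}, Lz Φ g u → Lz Φ g⁻¹ u⁻¹ := by
    intro g u hu
    exact ⟨by rw [map_inv]; exact hu.1.inv, by rw [tau_inv, hu.2, neg_zero]⟩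
  obtain ⟨x, hx⟩ := fixpt 0
  have bound : ∀ {g : G} {q u}, Eqn g 1 q → Lz Φ g u → (u : CircleDeg1Lift) x ≤ x + 1 := by
    intro g q u hg hu
    obtain ⟨z, hz⟩ := fixpt q
    have e : ((z + ⌊x - z⌋ : ℝ) : Circle') = z := (coe_iff _ _).2 ⟨_, rfl⟩
    have h1 : (u : CircleDeg1Lift) (z + ⌊x - z⌋) = z + ⌊x - z⌋ := l0_fix hu.1 hu.2 (by rw [e]; exact hz g hg)
    have h2 : (u : CircleDeg1Lift) (z + ⌊x - z⌋ + 1) = z + ⌊x - z⌋ + 1 := by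
      rw [CircleDeg1Lift.map_add_one, h1]
    have h3 := Int.lt_floor_add_one (x - z)
    have h4 := Int.floor_le (x - z)
    have := ul_mono u (s := x) (t := z + ⌊x - z⌋ + 1) (by linarith)
    linarith
  have cmp : ∀ {h h' : G} {q u u'}, Eqn h 1 q → Eqn h' 1 q → Eqn h' h 0 → Lz Φ h u → Lz Φ h' u' →
      (u : CircleDeg1Lift) x = (u' : CircleDeg1Lift) x := by
    intro h h' q u u' hh hh' e hu hu'
    have k := mulL hh.one_inv hh' (invL hu) hu'
    have := l0_fix k.1 k.2 (hx _ e.inv_mul)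
    have h2 := congrArg (u : CircleDeg1Lift) this
    rw [← ul_mul, mul_inv_cancel_left] at h2
    exact h2.symm
  have icc : ∀ {M M' q : ℝ} {h : ℝ ≃o ℝ} (hG : h ∈ G), (∀ t ∈ Icc M M', h t = t) → M < q → q < M' → Eqn ⟨h, hG⟩ 1 q := by
    intro M M' q h hG hh h1 h2
    filter_upwards [Icc_mem_nhds h1 h2] with t ht using hh t ht
  have absn : ∀ {R q : ℝ} {h : ℝ ≃o ℝ} {g : G} (hG : h ∈ G), (∀ t, |t| ≤ R → h t = (g : ℝ ≃o ℝ) t) → |q| < R → Eqn ⟨h, hG⟩ g q := by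
    intro R q h g hG hh h1
    have : ∀ᶠ t in 𝓝 q, |t| < R := (continuous_abs.tendsto q).eventually (gt_mem_nhds h1)
    filter_upwards [this] with t ht using hh t ht.le
  -- the function E
  have exE : ∀ g : G, ∃ y N : ℝ, ∀ q > N, ∀ h : G, ∀ u, Eqn h 1 q → Eqn h g 0 → Lz Φ h u → (u : CircleDeg1Lift) x = y := by
    intro g
    obtain ⟨M, hM⟩ := R2 S g.2 1
    obtain ⟨h0, g0, a0, b0⟩ := hM (M + 2)
    have i0 := icc g0 b0 (q := M + 1) (by linarith) (by linarith)
    obtain ⟨u0, hu0⟩ := exL i0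
    refine ⟨(u0 : CircleDeg1Lift) x, M, fun q hq h u hh e hu => ?_⟩
    obtain ⟨h1, g1, a1, b1⟩ := hM (max (M + 2) (q + 1))
    have m1 := le_max_left (M + 2) (q + 1)
    have m2 := le_max_right (M + 2) (q + 1)
    have i1 := icc g1 b1 (q := M + 1) (by linarith) (by linarith)
    have i2 := icc g1 b1 (q := q) (by linarith) (by linarith)
    have e1 := absn (q := 0) g1 a1 (by simp)
    have e0 := absn (q := 0) g0 a0 (by simp)
    obtain ⟨u1, hu1⟩ := exL i1
    have c1 := cmp i1 i0 (by filter_upwards [e0, e1] with t s1 s2 using s1.trans s2.symm) hu1 hu0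
    have c2 := cmp hh i2 (by filter_upwards [e, e1] with t s1 s2 using s2.trans s1.symm) hu hu1
    rw [c2, c1]
  choose E N hE using exE
  have pick : ∀ (g : G) (R K : ℝ), ∃ q0 : ℝ, ∀ q > q0, ∃ h : G, Eqn h 1 q ∧ ∀ t, |t| ≤ R → (h : ℝ ≃o ℝ) t = (g : ℝ ≃o ℝ) t := by
    intro g R K
    obtain ⟨M, hM⟩ := R2 S g.2 R
    refine ⟨M, fun q hq => ?_⟩
    obtain ⟨h, h1, h2, h3⟩ := hM (q + 1)
    exact ⟨⟨h, h1⟩, icc h1 h3 hq (by linarith), h2⟩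
  have bdd : BddAbove (range E) := by
    refine ⟨x + 1, ?_⟩
    rintro _ ⟨g, rfl⟩
    obtain ⟨q0, hq0⟩ := pick g 1 0
    obtain ⟨h, h1, h2⟩ := hq0 (max (N g) q0 + 1) (by linarith [le_max_right (N g) q0])
    obtain ⟨u, hu⟩ := exL h1
    rw [← hE g _ (by linarith [le_max_left (N g) q0]) h u h1 (absn h.2 h2 (by simp)) hu]
    exact bound h1 hu
  have key : ∀ g : G, ∃ w, IsLift w (Φ g) ∧ ∀ g' : G, (w : CircleDeg1Lift) (E g') = E (g * g') := by
    intro g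
    have e : Φ g (x : Circle') = (E g : ℝ) := by
      obtain ⟨q0, hq0⟩ := pick g 1 0
      obtain ⟨h, h1, h2⟩ := hq0 (max (N g) q0 + 1) (by linarith [le_max_right (N g) q0])
      have e0 := absn (q := 0) h.2 h2 (by simp)
      obtain ⟨u, hu⟩ := exL h1
      rw [← hE g _ (by linarith [le_max_left (N g) q0]) h u h1 e0 hu, ← hu.1 x]
      have := hx (g⁻¹ * h) (Eqn.inv_mul e0)
      rw [map_mul, map_inv] at this
      have h3 := congrArg (Φ g) this
      have h4 : Φ g (((Φ g)⁻¹ * Φ h) (x : Circle')) = Φ h x := (Φ g).apply_symm_apply _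
      rw [← h3, h4]
    obtain ⟨w0, hw0⟩ := hΦ g
    obtain ⟨w, hw, hwx⟩ := exists_lift_at hw0 e
    refine ⟨w, hw, fun g' => ?_⟩
    set R := |(g' : ℝ ≃o ℝ) 0| + 1 with hR
    obtain ⟨q1, hq1⟩ := pick g R 0
    obtain ⟨q2, hq2⟩ := pick g' 1 0
    obtain ⟨q, a1, a2, a3, a4, a5⟩ : ∃ q : ℝ, q > q1 ∧ q > q2 ∧ q > N g ∧ q > N g' ∧ q > N (g * g') := by
      have := (((eventually_gt_atTop q1).and (eventually_gt_atTop q2)).and ((eventually_gt_atTop (N g)).and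
        ((eventually_gt_atTop (N g')).and (eventually_gt_atTop (N (g * g')))))).exists
      obtain ⟨q, ⟨a1, a2⟩, a3, a4, a5⟩ := this
      exact ⟨q, a1, a2, a3, a4, a5⟩
    obtain ⟨h, h1, h2⟩ := hq1 q a1
    obtain ⟨h', h1', h2'⟩ := hq2 q a2
    obtain ⟨u, hu⟩ := exL h1
    obtain ⟨u', hu'⟩ := exL h1'
    have e0 : Eqn h g 0 := absn h.2 h2 (by rw [abs_zero]; positivity)
    have e1 : Eqn h g ((g' : ℝ ≃o ℝ) 0) := absn h.2 h2 (by rw [hR]; linarith)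
    have e0' : Eqn h' g' 0 := absn h'.2 h2' (by simp)
    have ee : Eqn (h * h') (g * g') 0 := by
      filter_upwards [e0', ((g' : ℝ ≃o ℝ).continuous.tendsto 0).eventually e1] with t s1 s2
      show (h : ℝ ≃o ℝ) ((h' : ℝ ≃o ℝ) t) = (g : ℝ ≃o ℝ) ((g' : ℝ ≃o ℝ) t)
      rw [s1, s2]
    have E1 := hE g q a3 h u h1 e0 hu
    have E2 := hE g' q a4 h' u' h1' e0' hu'
    have E3 := hE (g * g') q a5 _ _ (h1.one_mul h1') ee (mulL h1 h1' hu hu')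
    rw [ul_mul, E2] at E3
    rw [← E3]
    -- k = h⁻¹ g
    have k0 : Eqn (h⁻¹ * g) 1 0 := Eqn.inv_mul (by filter_upwards [e0] with t ht using ht.symm)
    have k1 : Eqn (h⁻¹ * g) 1 ((g' : ℝ ≃o ℝ) 0) := Eqn.inv_mul (by filter_upwards [e1] with t ht using ht.symm)
    obtain ⟨v, hv⟩ := exL k0
    have vx := l0_fix hv.1 hv.2 (hx _ k0)
    have huv : IsLift (u * v) (Φ g) := by
      have := hu.1.mul hv.1
      rwa [← map_mul, mul_inv_cancel_left] at this
    have wuv : w = u * v := by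
      obtain ⟨m, hm⟩ := hw.diff huv
      have := hm x
      rw [hwx, ul_mul, vx, E1] at this
      exact ul_ext fun t => by rw [hm t]; linarith
    rw [wuv, ul_mul]
    congr 1
    apply l0_fix hv.1 hv.2
    rw [← E2, ← hu'.1 x]
    have kk : Eqn (h'⁻¹ * ((h⁻¹ * g) * h')) 1 0 := by
      apply Eqn.inv_mul
      filter_upwards [e0', ((g' : ℝ ≃o ℝ).continuous.tendsto 0).eventually k1] with t s1 s2
      show ((h⁻¹ * g : G) : ℝ ≃o ℝ) ((h' : ℝ ≃o ℝ) t) = (h' : ℝ ≃o ℝ) t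
      rw [s1]; exact s2
    have h3 := congrArg (Φ h') (hx _ kk)
    have h4 : Φ h' (Φ (h'⁻¹ * ((h⁻¹ * g) * h')) (x : Circle')) = Φ (h⁻¹ * g) (Φ h' x) := by
      rw [map_mul Φ h'⁻¹, map_inv, map_mul Φ (h⁻¹ * g)]
      exact (Φ h').apply_symm_apply _
    rw [← h4, h3]
  refine ⟨((sSup (range E) : ℝ) : Circle'), fun g => ?_⟩
  obtain ⟨w, hw, hw'⟩ := key g
  rw [hw, sup_fix ⟨_, mem_range_self 1⟩ bdd w]
  · rintro _ ⟨g', rfl⟩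
    exact ⟨_, (hw' g').symm⟩
  · rintro _ ⟨g', rfl⟩
    refine ⟨g⁻¹ * g', ?_⟩
    have := hw' (g⁻¹ * g')
    rw [mul_inv_cancel_left] at this
    rw [← this, ← ul_mul, inv_mul_cancel]
    rfl
end
end GR


/-- For a quasi-periodic labelling `ρ`, every action of `G_ρ` on the
circle `ℝ/ℤ` by homeomorphisms has a global fixed point. -/
theorem circle_action_has_global_fixpoint
    (ρ : ℤ → Letter) (hρ : IsQuasiPeriodic ρ)
    (H : Subgroup (ℝ ≃o ℝ)) (hH : ∀ f : ℝ ≃o ℝ, f ∈ H ↔ InH f)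
    (ν₁ ν₂ ν₃ : ℝ ≃o ℝ) (hgen : Subgroup.closure {ν₁, ν₂, ν₃} = H)
    (ζ₁ ζ₂ ζ₃ χ₁ χ₂ χ₃ : ℝ ≃o ℝ)
    (hζ₁ : IsZeta ρ ν₁ ζ₁) (hζ₂ : IsZeta ρ ν₂ ζ₂) (hζ₃ : IsZeta ρ ν₃ ζ₃)
    (hχ₁ : IsChi ρ ν₁ χ₁) (hχ₂ : IsChi ρ ν₂ χ₂) (hχ₃ : IsChi ρ ν₃ χ₃)
    (G : Subgroup (ℝ ≃o ℝ))
    (hG : G = Subgroup.closure {ζ₁, ζ₂, ζ₃, χ₁, χ₂, χ₃})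
    (Φ : ↥G →* (Circle' ≃ₜ Circle')) :
    ∃ x : Circle', ∀ g : ↥G, Φ g x = x := by
  have S := GR.setup_of hρ hH hgen hζ₁ hζ₂ hζ₃ hχ₁ hχ₂ hχ₃ hG
  exact GR.final S Φ (GR.lifts_of_perf Φ (GR.G_perf S))
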